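/- Let n ≥ 2, let A, B ⊆ ℝⁿ be compact sets, let 0 < τ ≤ 1/2, t ∈ [τ, 1 − τ], and set S := tA + (1 − t)B. There exists a constant N_n > 1 depending only on n with the following property. Assume ||A| − 1| + ||B| − 1| + ||S| − 1| ≤ δ, that A, B ⊆ B_R for some R ≤ τ^{−N_n} (B_R the ball of radius R centered at the origin), and that there exist convex sets K_A, K_B ⊆ ℝⁿ with |A Δ K_A| + |B Δ K_B| ≤ ζ for some ζ ≥ δ. Then there exists a constant L_n > 1 depending only on n such that, for some vector v ∈ ℝⁿ: |A Δ (B + v)| ≤ τ^{−L_n} ζ^{1/(2n)}, and there exists a convex set 𝒦 containing both A and B + v with |𝒦 \ A| + |𝒦 \ (B + v)| ≤ τ^{−L_n} ζ^{1/(2n³)}. -/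

import Mathlib

open MeasureTheory Set Pointwise
open MeasureTheory Set Pointwise

set_option linter.unusedSectionVars false

namespace St8

/-- One-dimensional Brunn-Minkowski, compact case. -/
lemma bm1_compact {t : ℝ} (h0 : 0 < t) (h1 : t < 1) {A B C : Set ℝ}
    (hA : IsCompact A) (hB : IsCompact B) (hAn : A.Nonempty) (hBn : B.Nonempty)
    (hC : ∀ a ∈ A, ∀ b ∈ B, t * a + (1 - t) * b ∈ C) :
    ENNReal.ofReal t * volume A + ENNReal.ofReal (1 - t) * volume B ≤ volume C := by
  obtain ⟨a1, ha1, hmax⟩ := hA.exists_isGreatest hAn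
  obtain ⟨b0, hb0, hmin⟩ := hB.exists_isLeast hBn
  have hs : 0 < 1 - t := by linarith
  set P : Set ℝ := (fun x => t * x + (1 - t) * b0) '' A with hP
  set Q : Set ℝ := (fun x => t * a1 + (1 - t) * x) '' B with hQ
  have hPv : volume P = ENNReal.ofReal t * volume A := by
    have : P = (fun x => x + (1 - t) * b0) '' ((fun x => t * x) '' A) := by
      rw [image_image]
    rw [this, show (fun x => t * x) '' A = (t • A : Set ℝ) from rfl]
    simp [Measure.addHaar_smul, abs_of_pos h0, measure_preimage_add_right]
  have hQv : volume Q = ENNReal.ofReal (1 - t) * volume B := by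
    have : Q = (fun x => t * a1 + x) '' ((fun x => (1 - t) * x) '' B) := by
      rw [image_image]
    rw [this, show (fun x => (1 - t) * x) '' B = ((1 - t) • B : Set ℝ) from rfl]
    simp [Measure.addHaar_smul, abs_of_pos hs, measure_preimage_add]
  have hcap : P ∩ Q ⊆ {t * a1 + (1 - t) * b0} := by
    rintro z ⟨⟨x, hx, rfl⟩, ⟨y, hy, hxy⟩⟩
    have e1 := hmax hx
    have e2 := hmin hy
    simp only at hxy
    have : t * x ≤ t * a1 := by gcongr
    have : (1 - t) * b0 ≤ (1 - t) * y := by gcongr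
    simp only [mem_singleton_iff]; linarith
  have hcap0 : volume (P ∩ Q) = 0 := measure_mono_null hcap (by simp)
  have hQm : MeasurableSet Q := (hB.image (by fun_prop)).measurableSet
  have := measure_union_add_inter (μ := volume) P hQm
  rw [hcap0, add_zero, hPv, hQv] at this
  rw [← this]
  apply measure_mono
  rintro z (⟨x, hx, rfl⟩ | ⟨y, hy, rfl⟩)
  · exact hC x hx b0 hb0
  · exact hC a1 ha1 y hy

lemma compact_sup_aux {A : Set ℝ} (hA : MeasurableSet A) (hAn : A.Nonempty) {a c X : ENNReal}
    (h : ∀ K ⊆ A, IsCompact K → K.Nonempty → a * volume K + c ≤ X) : a * volume A + c ≤ X := by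
  obtain ⟨x, hx⟩ := hAn
  have hcX : c ≤ X := le_trans le_add_self (h {x} (by simpa using hx) isCompact_singleton (by simp))
  by_cases hc : c = ⊤
  · subst hc; simpa using hcX
  have key : a * volume A ≤ X - c := by
    rw [hA.measure_eq_iSup_isCompact]
    simp only [ENNReal.mul_iSup]
    refine iSup_le fun K => iSup_le fun hK => iSup_le fun hKc => ?_
    rcases K.eq_empty_or_nonempty with rfl | hn
    · simp
    · exact ENNReal.le_sub_of_add_le_right hc (h K hK hKc hn)
  calc a * volume A + c ≤ (X - c) + c := by gcongr
    _ = X := tsub_add_cancel_of_le hcX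

lemma bm1 {t : ℝ} (h0 : 0 < t) (h1 : t < 1) {A B C : Set ℝ}
    (hA : MeasurableSet A) (hB : MeasurableSet B) (hAn : A.Nonempty) (hBn : B.Nonempty)
    (hC : ∀ a ∈ A, ∀ b ∈ B, t * a + (1 - t) * b ∈ C) :
    ENNReal.ofReal t * volume A + ENNReal.ofReal (1 - t) * volume B ≤ volume C := by
  refine compact_sup_aux hA hAn fun K hK hKc hKn => ?_
  rw [add_comm]
  refine compact_sup_aux hB hBn fun L hL hLc hLn => ?_
  rw [add_comm]
  exact bm1_compact h0 h1 hKc hLc hKn hLn fun a ha b hb => hC a (hK ha) b (hL hb)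

/-- Normalized one-dimensional Prekopa-Leindler. -/
lemma pl1_norm {t : ℝ} (h0 : 0 < t) (h1 : t < 1) {f g h : ℝ → ℝ}
    (hf : Measurable f) (hg : Measurable g) (hh : Measurable h)
    (f0 : ∀ x, 0 ≤ f x) (g0 : ∀ x, 0 ≤ g x) (h0' : ∀ x, 0 ≤ h x)
    (f1 : ∀ x, f x ≤ 1) (g1 : ∀ x, g x ≤ 1)
    (fs : ∀ s < 1, ∃ x, s < f x) (gs : ∀ s < 1, ∃ x, s < g x)
    (H : ∀ x y, f x ^ t * g y ^ (1 - t) ≤ h (t * x + (1 - t) * y)) :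
    ENNReal.ofReal t * (∫⁻ x, ENNReal.ofReal (f x)) +
      ENNReal.ofReal (1 - t) * (∫⁻ x, ENNReal.ofReal (g x)) ≤ ∫⁻ x, ENNReal.ofReal (h x) := by
  rw [lintegral_eq_lintegral_meas_lt volume (Filter.Eventually.of_forall f0) hf.aemeasurable,
    lintegral_eq_lintegral_meas_lt volume (Filter.Eventually.of_forall g0) hg.aemeasurable,
    lintegral_eq_lintegral_meas_lt volume (Filter.Eventually.of_forall h0') hh.aemeasurable]
  have anti : ∀ u : ℝ → ℝ, Measurable fun s : ℝ => volume {a : ℝ | s < u a} := fun u =>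
    Antitone.measurable fun s s' hs => measure_mono fun x hx => lt_of_le_of_lt hs hx
  rw [← lintegral_const_mul _ (anti f), ← lintegral_const_mul _ (anti g),
    ← lintegral_add_left ((anti f).const_mul _)]
  refine setLIntegral_mono (anti h) fun s hs => ?_
  have hs : 0 < s := hs
  by_cases hs1 : s < 1
  · refine bm1 h0 h1 (measurableSet_lt measurable_const hf) (measurableSet_lt measurable_const hg)
      (fs s hs1) (gs s hs1) ?_
    intro a ha b hb
    have ha : s < f a := ha
    have hb : s < g b := hb
    refine lt_of_lt_of_le ?_ (H a b)
    calc s = s ^ t * s ^ (1 - t) := by rw [← Real.rpow_add hs]; simp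
      _ < f a ^ t * g b ^ (1 - t) := by
        have e1 := Real.rpow_lt_rpow hs.le ha h0
        have e2 := Real.rpow_lt_rpow hs.le hb (by linarith : 0 < 1 - t)
        have e3 := Real.rpow_nonneg hs.le t
        have e4 := Real.rpow_nonneg hs.le (1 - t)
        gcongr
  · have e1 : {a | s < f a} = ∅ := by
      ext x; simp; linarith [f1 x]
    have e2 : {a | s < g a} = ∅ := by
      ext x; simp; linarith [g1 x]
    simp [e1, e2]

/-- One-dimensional Prekopa-Leindler for bounded integrable functions. -/
lemma pl1 {t : ℝ} (h0 : 0 < t) (h1 : t < 1) {f g h : ℝ → ℝ}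
    (hf : Measurable f) (hg : Measurable g) (hh : Measurable h)
    (f0 : ∀ x, 0 ≤ f x) (g0 : ∀ x, 0 ≤ g x) (h0' : ∀ x, 0 ≤ h x)
    (fb : BddAbove (range f)) (gb : BddAbove (range g))
    (fi : Integrable f) (gi : Integrable g) (hi : Integrable h)
    (H : ∀ x y, f x ^ t * g y ^ (1 - t) ≤ h (t * x + (1 - t) * y)) :
    (∫ x, f x) ^ t * (∫ x, g x) ^ (1 - t) ≤ ∫ x, h x := by
  have hs : 0 < 1 - t := by linarith
  have hI : 0 ≤ ∫ x, h x := integral_nonneg h0'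
  set a := ⨆ x, f x with ha
  set b := ⨆ x, g x with hb
  have fa : ∀ x, f x ≤ a := fun x => le_ciSup fb x
  have gb' : ∀ x, g x ≤ b := fun x => le_ciSup gb x
  have a0 : 0 ≤ a := (f0 0).trans (fa 0)
  have b0 : 0 ≤ b := (g0 0).trans (gb' 0)
  rcases a0.eq_or_lt with ha0 | ha0
  · have : ∀ x, f x = 0 := fun x => le_antisymm (by rw [ha0]; exact fa x) (f0 x)
    simp [this, Real.zero_rpow h0.ne', hI]
  rcases b0.eq_or_lt with hb0 | hb0
  · have : ∀ x, g x = 0 := fun x => le_antisymm (by rw [hb0]; exact gb' x) (g0 x)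
    simp [this, Real.zero_rpow hs.ne', hI]
  have hat := Real.rpow_pos_of_pos ha0 t
  have hbt := Real.rpow_pos_of_pos hb0 (1 - t)
  set c := a ^ t * b ^ (1 - t) with hc
  have c0 : 0 < c := by positivity
  have key := pl1_norm h0 h1 (f := fun x => f x / a) (g := fun x => g x / b) (h := fun x => h x / c)
    (hf.div_const _) (hg.div_const _) (hh.div_const _)
    (fun x => div_nonneg (f0 x) a0) (fun x => div_nonneg (g0 x) b0) (fun x => div_nonneg (h0' x) c0.le)
    (fun x => (div_le_one ha0).2 (fa x)) (fun x => (div_le_one hb0).2 (gb' x))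
    (fun s hs => by
      obtain ⟨x, hx⟩ := exists_lt_of_lt_ciSup (show s * a < ⨆ x, f x by rw [← ha]; nlinarith)
      exact ⟨x, (lt_div_iff₀ ha0).2 hx⟩)
    (fun s hs => by
      obtain ⟨x, hx⟩ := exists_lt_of_lt_ciSup (show s * b < ⨆ x, g x by rw [← hb]; nlinarith)
      exact ⟨x, (lt_div_iff₀ hb0).2 hx⟩)
    (fun x y => by
      rw [Real.div_rpow (f0 x) a0, Real.div_rpow (g0 y) b0, div_mul_div_comm]
      gcongr
      exact H x y)
  rw [← ofReal_integral_eq_lintegral_ofReal (fi.div_const _)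
      (Filter.Eventually.of_forall fun x => div_nonneg (f0 x) a0),
    ← ofReal_integral_eq_lintegral_ofReal (gi.div_const _)
      (Filter.Eventually.of_forall fun x => div_nonneg (g0 x) b0),
    ← ofReal_integral_eq_lintegral_ofReal (hi.div_const _)
      (Filter.Eventually.of_forall fun x => div_nonneg (h0' x) c0.le),
    integral_div, integral_div, integral_div] at key
  have If : 0 ≤ ∫ x, f x := integral_nonneg f0
  have Ig : 0 ≤ ∫ x, g x := integral_nonneg g0
  rw [← ENNReal.ofReal_mul h0.le, ← ENNReal.ofReal_mul hs.le,
    ← ENNReal.ofReal_add (by positivity) (by positivity),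
    ENNReal.ofReal_le_ofReal_iff (by positivity)] at key
  have amgm := Real.geom_mean_le_arith_mean2_weighted h0.le hs.le
    (div_nonneg If a0) (div_nonneg Ig b0) (by ring)
  have := amgm.trans key
  rw [Real.div_rpow If a0, Real.div_rpow Ig b0, div_mul_div_comm] at this
  rwa [div_le_div_iff_of_pos_right c0] at this

/-- Multiplicative Brunn-Minkowski property for compact sets. -/
def BM (V : Type*) [AddCommGroup V] [Module ℝ V] [TopologicalSpace V] [MeasureSpace V] : Prop :=
  ∀ t : ℝ, 0 < t → t < 1 → ∀ A B C : Set V, IsCompact A → IsCompact B → IsCompact C →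
    (∀ a ∈ A, ∀ b ∈ B, t • a + (1 - t) • b ∈ C) →
    volume.real A ^ t * volume.real B ^ (1 - t) ≤ volume.real C

section slices
variable {V : Type*} [NormedAddCommGroup V] [NormedSpace ℝ V] [MeasureSpace V] [BorelSpace V]
  [SecondCountableTopology V] [IsFiniteMeasureOnCompacts (volume : Measure V)]
  [SFinite (volume : Measure V)]

/-- slice of a set in a product -/
def sl (A : Set (ℝ × V)) (s : ℝ) : Set V := Prod.mk s ⁻¹' A

lemma sl_compact {A : Set (ℝ × V)} (hA : IsCompact A) (s : ℝ) : IsCompact (sl A s) := by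
  refine IsCompact.of_isClosed_subset (hA.image continuous_snd)
    (hA.isClosed.preimage (by fun_prop)) ?_
  intro y hy
  exact ⟨_, hy, rfl⟩

lemma sl_meas {A : Set (ℝ × V)} (hA : IsCompact A) : Measurable fun s => volume.real (sl A s) :=
  (measurable_measure_prodMk_left hA.measurableSet).ennreal_toReal

lemma sl_bdd {A : Set (ℝ × V)} (hA : IsCompact A) : BddAbove (range fun s => volume.real (sl A s)) := by
  refine ⟨volume.real (Prod.snd '' A), ?_⟩
  rintro _ ⟨s, rfl⟩
  refine measureReal_mono ?_ (hA.image continuous_snd).measure_lt_top.ne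
  intro y hy
  exact ⟨_, hy, rfl⟩

lemma sl_int_aux {A : Set (ℝ × V)} (hA : IsCompact A) :
    volume A = ∫⁻ s, ENNReal.ofReal (volume.real (sl A s)) := by
  rw [Measure.volume_eq_prod, Measure.prod_apply hA.measurableSet]
  congr 1
  ext s
  exact (ENNReal.ofReal_toReal (sl_compact hA s).measure_lt_top.ne).symm

lemma sl_integrable {A : Set (ℝ × V)} (hA : IsCompact A) :
    Integrable fun s => volume.real (sl A s) := by
  refine ⟨(sl_meas hA).aestronglyMeasurable, ?_⟩
  rw [hasFiniteIntegral_iff_ofReal (Filter.Eventually.of_forall fun s => measureReal_nonneg)]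
  rw [← sl_int_aux hA, Measure.volume_eq_prod]
  exact hA.measure_lt_top

lemma sl_integral {A : Set (ℝ × V)} (hA : IsCompact A) :
    volume.real A = ∫ s, volume.real (sl A s) := by
  rw [integral_eq_lintegral_of_nonneg_ae (Filter.Eventually.of_forall fun s => measureReal_nonneg)
    (sl_meas hA).aestronglyMeasurable, ← sl_int_aux hA]
  rfl

lemma sl_bm (hV : BM V) {t : ℝ} (h0 : 0 < t) (h1 : t < 1) {A B C : Set (ℝ × V)}
    (hA : IsCompact A) (hB : IsCompact B) (hC : IsCompact C)
    (H : ∀ a ∈ A, ∀ b ∈ B, t • a + (1 - t) • b ∈ C) (x y : ℝ) :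
    volume.real (sl A x) ^ t * volume.real (sl B y) ^ (1 - t) ≤
      volume.real (sl C (t * x + (1 - t) * y)) := by
  refine hV t h0 h1 _ _ _ (sl_compact hA x) (sl_compact hB y) (sl_compact hC _) ?_
  intro a ha b hb
  simpa [sl] using H _ ha _ hb

lemma BM_prod (hV : BM V) : BM (ℝ × V) := by
  intro t h0 h1 A B C hA hB hC H
  rw [sl_integral hA, sl_integral hB, sl_integral hC]
  exact pl1 h0 h1 (sl_meas hA) (sl_meas hB) (sl_meas hC) (fun _ => measureReal_nonneg)
    (fun _ => measureReal_nonneg) (fun _ => measureReal_nonneg) (sl_bdd hA) (sl_bdd hB)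
    (sl_integrable hA) (sl_integrable hB) (sl_integrable hC)
    (fun x y => sl_bm hV h0 h1 hA hB hC H x y)

end slices

lemma BM_transfer {V W : Type*} [AddCommGroup V] [Module ℝ V] [TopologicalSpace V] [MeasureSpace V]
    [AddCommGroup W] [Module ℝ W] [TopologicalSpace W] [MeasureSpace W] [BorelSpace V] [BorelSpace W]
    (e : V ≃L[ℝ] W) (he : MeasurePreserving e) (hW : BM W) : BM V := by
  have em : MeasurableEmbedding e := e.toHomeomorph.measurableEmbedding
  have key : ∀ A : Set V, volume.real (e '' A) = volume.real A := by
    intro A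
    rw [measureReal_def, measureReal_def, ← he.measure_preimage_emb em,
      preimage_image_eq _ e.injective]
  intro t h0 h1 A B C hA hB hC H
  rw [← key A, ← key B, ← key C]
  refine hW t h0 h1 _ _ _ (hA.image e.continuous) (hB.image e.continuous) (hC.image e.continuous) ?_
  rintro _ ⟨a, ha, rfl⟩ _ ⟨b, hb, rfl⟩
  exact ⟨_, H a ha b hb, by simp⟩

lemma BM_pi (k : ℕ) : BM (Fin k → ℝ) := by
  induction k with
  | zero =>
    intro t h0 h1 A B C hA hB hC H
    rcases A.eq_empty_or_nonempty with rfl | ⟨a, ha⟩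
    · simp [Real.zero_rpow h0.ne']
    rcases B.eq_empty_or_nonempty with rfl | ⟨b, hb⟩
    · simp [Real.zero_rpow (by linarith : (1 - t) ≠ 0)]
    have e1 : ∀ D : Set (Fin 0 → ℝ), D.Nonempty → D = univ := fun D hD =>
      Subsingleton.eq_univ_of_nonempty hD
    rw [e1 A ⟨a, ha⟩, e1 B ⟨b, hb⟩, e1 C ⟨_, H a ha b hb⟩]
    have hv : volume.real (univ : Set (Fin 0 → ℝ)) = 1 := by
      rw [measureReal_def, volume_pi, Measure.pi_of_empty]; simp
    simp [hv]
  | succ k ih =>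
    let e : (Fin (k + 1) → ℝ) ≃L[ℝ] ℝ × (Fin k → ℝ) :=
      (Fin.consEquivL ℝ (fun _ : Fin (k+1) => ℝ)).symm
    refine BM_transfer e ?_ (BM_prod ih)
    have := volume_preserving_piFinSuccAbove (fun _ : Fin (k+1) => ℝ) 0
    have he : ⇑e = ⇑(MeasurableEquiv.piFinSuccAbove (fun _ : Fin (k+1) => ℝ) 0) := by
      ext x
      · rfl
      · rfl
    rw [he]
    exact this

end St8

open MeasureTheory Set Pointwise
set_option linter.unusedSectionVars false
namespace St8

/-- log-concave probability density on the line supported in `[-R, R]` -/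
structure LC (R : ℝ) (f : ℝ → ℝ) : Prop where
  R0 : 0 < R
  nn : ∀ x, 0 ≤ f x
  int : Integrable f
  one : ∫ x, f x = 1
  supp : ∀ x, f x ≠ 0 → |x| ≤ R
  lc : ∀ t, 0 < t → t < 1 → ∀ x y, f x ^ t * f y ^ (1 - t) ≤ f (t * x + (1 - t) * y)

lemma LC.quasi {R : ℝ} {f : ℝ → ℝ} (h : LC R f) {x y z : ℝ} (hxy : x < y) (hyz : y < z) :
    min (f x) (f z) ≤ f y := by
  set t := (z - y) / (z - x) with ht
  have hzx : 0 < z - x := by linarith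
  have t0 : 0 < t := div_pos (by linarith) hzx
  have t1 : t < 1 := (div_lt_one hzx).2 (by linarith)
  have e : t * x + (1 - t) * z = y := by rw [ht]; field_simp; ring
  have := h.lc t t0 t1 x z
  rw [e] at this
  refine le_trans ?_ this
  have m0 : 0 ≤ min (f x) (f z) := le_min (h.nn x) (h.nn z)
  rcases m0.eq_or_lt with m0 | m0
  · rw [← m0]; exact mul_nonneg (Real.rpow_nonneg (h.nn _) _) (Real.rpow_nonneg (h.nn _) _)
  calc min (f x) (f z) = min (f x) (f z) ^ t * min (f x) (f z) ^ (1 - t) := by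
        rw [← Real.rpow_add m0]; simp
    _ ≤ _ := by
        have e1 := Real.rpow_le_rpow m0.le (min_le_left (f x) (f z)) t0.le
        have e2 := Real.rpow_le_rpow m0.le (min_le_right (f x) (f z)) (by linarith : 0 ≤ 1 - t)
        exact mul_le_mul e1 e2 (Real.rpow_nonneg m0.le _) (Real.rpow_nonneg (h.nn _) _)

lemma LC.exists_supp {R : ℝ} {f : ℝ → ℝ} (h : LC R f) :
    ∃ a b : ℝ, a < b ∧ (∀ x, a < x → x < b → 0 < f x) ∧ (∀ x, x < a → f x = 0) ∧
      (∀ x, b < x → f x = 0) := by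
  set S := {x | f x ≠ 0} with hS
  have bb : BddBelow S := ⟨-R, fun x hx => (abs_le.1 (h.supp x hx)).1⟩
  have ba : BddAbove S := ⟨R, fun x hx => (abs_le.1 (h.supp x hx)).2⟩
  have z1 : ∀ x, x < sInf S → f x = 0 := fun x hx => by
    by_contra hc
    exact absurd (csInf_le bb hc) (not_le.2 hx)
  have z2 : ∀ x, sSup S < x → f x = 0 := fun x hx => by
    by_contra hc
    exact absurd (le_csSup ba hc) (not_le.2 hx)
  have hne : S.Nonempty := by
    by_contra hc
    have : ∀ x, f x = 0 := fun x => by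
      by_contra hx
      exact hc ⟨x, hx⟩
    have h1 := h.one
    simp [this] at h1
  refine ⟨sInf S, sSup S, ?_, ?_, z1, z2⟩
  · by_contra hc
    push Not at hc
    have : ∀ᵐ x, f x = 0 := by
      have : ∀ᵐ x : ℝ, x ≠ sInf S := by simp [ae_iff]
      filter_upwards [this] with x hx
      rcases lt_or_gt_of_ne hx with hx | hx
      · exact z1 x hx
      · exact z2 x (by linarith)
    have h1 := h.one
    rw [integral_congr_ae this] at h1
    simp at h1
  · intro x hx1 hx2
    obtain ⟨y, hy, hyx⟩ := exists_lt_of_csInf_lt hne hx1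
    obtain ⟨z, hz, hxz⟩ := exists_lt_of_lt_csSup hne hx2
    have := h.quasi hyx hxz
    refine lt_of_lt_of_le (lt_min ?_ ?_) this
    · exact lt_of_le_of_ne (h.nn _) (Ne.symm hy)
    · exact lt_of_le_of_ne (h.nn _) (Ne.symm hz)

lemma LC.contOn {R : ℝ} {f : ℝ → ℝ} (h : LC R f) {a b : ℝ}
    (hp : ∀ x, a < x → x < b → 0 < f x) : ContinuousOn f (Ioo a b) := by
  have hc : ConcaveOn ℝ (Ioo a b) (fun x => Real.log (f x)) := by
    refine ⟨convex_Ioo a b, ?_⟩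
    intro x hx y hy s t hs ht hst
    rcases hs.eq_or_lt with hs | hs
    · obtain rfl : s = 0 := hs.symm
      obtain rfl : t = 1 := by linarith
      simp
    rcases ht.eq_or_lt with ht | ht
    · obtain rfl : t = 0 := ht.symm
      obtain rfl : s = 1 := by linarith
      simp
    obtain rfl : t = 1 - s := by linarith
    have := h.lc s hs (by linarith) x y
    have fx := hp x hx.1 hx.2
    have fy := hp y hy.1 hy.2
    have := Real.log_le_log (by positivity) this
    rw [Real.log_mul (by positivity) (by positivity), Real.log_rpow fx, Real.log_rpow fy] at this
    simpa using this
  have := (hc.continuousOn isOpen_Ioo).rexp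
  refine this.congr ?_
  intro x hx
  simp [Real.exp_log (hp x hx.1 hx.2)]

/-- existence of a nice quantile function -/
lemma LC.quantile {R : ℝ} {f : ℝ → ℝ} (h : LC R f) :
    ∃ q : ℝ → ℝ, StrictMonoOn q (Ioo 0 1) ∧
      (∀ p ∈ Ioo (0:ℝ) 1, HasDerivAt q (1 / f (q p)) p ∧ 0 < f (q p) ∧
        min p (1 - p) ≤ 2 * R * f (q p) ∧ |q p| ≤ R ∧
        ∀ s, ∫ x in Iic s, f x = p → s = q p) ∧
      ContinuousOn (fun p => f (q p)) (Ioo 0 1) ∧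
      ∫ p in Ioo (0:ℝ) 1, q p = ∫ x, x * f x := by
  obtain ⟨a, b, hab, hpos, za, zb⟩ := h.exists_supp
  have hcont := h.contOn hpos
  set F : ℝ → ℝ := fun x => ∫ y in Iic x, f y with hF
  have Fsub : ∀ x y, F y - F x = ∫ z in x..y, f z := fun x y =>
    intervalIntegral.integral_Iic_sub_Iic h.int.integrableOn h.int.integrableOn
  have Fder : ∀ x ∈ Ioo a b, HasDerivAt F (f x) x := by
    intro x hx
    have e : F = fun y => F x + ∫ z in x..y, f z := by
      ext y; rw [← Fsub]; ring
    rw [e]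
    refine HasDerivAt.const_add _ ?_
    refine intervalIntegral.integral_hasDerivAt_right (by simp) ?_ ?_
    · exact h.int.aestronglyMeasurable.stronglyMeasurableAtFilter
    · exact hcont.continuousAt (Ioo_mem_nhds hx.1 hx.2)
  have Fcont : Continuous F := by
    have e : F = fun y => F 0 + ∫ z in (0:ℝ)..y, f z := by
      ext y; rw [← Fsub]; ring
    rw [e]
    exact continuous_const.add (intervalIntegral.continuous_primitive (fun x y => h.int.intervalIntegrable) 0)
  have Fa : F a = 0 := by
    have : F a = ∫ y in Iio a, f y := integral_Iic_eq_integral_Iio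
    rw [this]
    exact setIntegral_eq_zero_of_forall_eq_zero fun x hx => za x hx
  have Fb : F b = 1 := by
    have := intervalIntegral.integral_Iic_add_Ioi (b := b) (f := f) h.int.integrableOn h.int.integrableOn
    rw [h.one, setIntegral_eq_zero_of_forall_eq_zero (t := Ioi b) fun x hx => zb x hx] at this
    simpa using this
  have Fmono : Monotone F := by
    intro x y hxy
    have := Fsub x y
    have : 0 ≤ ∫ z in x..y, f z := intervalIntegral.integral_nonneg hxy fun z _ => h.nn z
    linarith [Fsub x y]
  have Fstrict : StrictMonoOn F (Icc a b) := by
    refine strictMonoOn_of_deriv_pos (convex_Icc a b) Fcont.continuousOn ?_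
    intro x hx
    rw [interior_Icc] at hx
    rw [(Fder x hx).deriv]
    exact hpos x hx.1 hx.2
  have ex : ∀ p ∈ Ioo (0:ℝ) 1, ∃ x ∈ Ioo a b, F x = p := by
    intro p hp
    have := intermediate_value_Ioo hab.le Fcont.continuousOn
    rw [Fa, Fb] at this
    exact this hp
  choose! q hq hFq using ex
  have qF : ∀ x ∈ Ioo a b, F x ∈ Ioo (0:ℝ) 1 ∧ q (F x) = x := by
    intro x hx
    have h1 : F x ∈ Ioo (0:ℝ) 1 := by
      constructor
      · rw [← Fa]; exact Fstrict ⟨le_rfl, hab.le⟩ (Ioo_subset_Icc_self hx) hx.1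
      · rw [← Fb]; exact Fstrict (Ioo_subset_Icc_self hx) ⟨hab.le, le_rfl⟩ hx.2
    refine ⟨h1, ?_⟩
    exact Fstrict.injOn (Ioo_subset_Icc_self (hq _ h1)) (Ioo_subset_Icc_self hx) (hFq _ h1)
  have qmono : StrictMonoOn q (Ioo 0 1) := by
    intro p hp p' hp' hpp
    by_contra hc
    push Not at hc
    have := Fmono hc
    rw [hFq _ hp, hFq _ hp'] at this
    linarith
  have qimg : q '' Ioo 0 1 = Ioo a b := by
    ext x
    constructor
    · rintro ⟨p, hp, rfl⟩; exact hq p hp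
    · intro hx; exact ⟨F x, (qF x hx).1, (qF x hx).2⟩
  have qcont : ∀ p ∈ Ioo (0:ℝ) 1, ContinuousAt q p := by
    intro p hp
    refine qmono.continuousAt_of_image_mem_nhds (Ioo_mem_nhds hp.1 hp.2) ?_
    rw [qimg]
    exact Ioo_mem_nhds (hq p hp).1 (hq p hp).2
  refine ⟨q, qmono, ?_, ?_, ?_⟩
  · intro p hp
    have hx := hq p hp
    have fx := hpos _ hx.1 hx.2
    refine ⟨?_, fx, ?_, h.supp _ fx.ne', ?_⟩
    · rw [one_div]
      refine HasDerivAt.of_local_left_inverse (qcont p hp) (Fder _ hx) fx.ne' ?_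
      filter_upwards [Ioo_mem_nhds hp.1 hp.2] with r hr
      exact hFq r hr
    · -- quasi-concavity
      set x := q p with hxdef
      have hxR := abs_le.1 (h.supp _ fx.ne')
      have zR : ∀ y, y < -R → f y = 0 := fun y hy => by
        by_contra hc
        linarith [(abs_le.1 (h.supp y hc)).1]
      have zR' : ∀ y, R < y → f y = 0 := fun y hy => by
        by_contra hc
        linarith [(abs_le.1 (h.supp y hc)).2]
      by_cases hl : ∀ y < x, f y ≤ f x
      · refine (min_le_left _ _).trans ?_
        have e1 : F (-R) = 0 := by
          have : F (-R) = ∫ y in Iio (-R), f y := integral_Iic_eq_integral_Iio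
          rw [this]
          exact setIntegral_eq_zero_of_forall_eq_zero fun x hx => zR x hx
        have e2 := Fsub (-R) x
        rw [e1, hFq p hp, sub_zero] at e2
        rw [e2]
        calc ∫ z in (-R)..x, f z ≤ ∫ z in (-R)..x, f x := by
              refine intervalIntegral.integral_mono_on hxR.1 h.int.intervalIntegrable (by simp) ?_
              intro z hz
              rcases hz.2.eq_or_lt with h' | h'
              · rw [h']
              · exact hl z h'
          _ = (x + R) * f x := by simp
          _ ≤ _ := by nlinarith
      · push Not at hl
        obtain ⟨y, hy, hfy⟩ := hl
        have hr : ∀ z, x < z → f z ≤ f x := by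
          intro z hz
          by_contra hc
          push Not at hc
          have := h.quasi hy hz
          rcases min_le_iff.1 this with h' | h' <;> linarith
        refine (min_le_right _ _).trans ?_
        have e1 : F R = 1 := by
          have := intervalIntegral.integral_Iic_add_Ioi (b := R) (f := f) h.int.integrableOn h.int.integrableOn
          rw [h.one, setIntegral_eq_zero_of_forall_eq_zero (t := Ioi R) fun x hx => zR' x hx] at this
          simpa using this
        have e2 := Fsub x R
        rw [e1, hFq p hp] at e2
        rw [e2]
        calc ∫ z in x..R, f z ≤ ∫ z in x..R, f x := by
              refine intervalIntegral.integral_mono_on hxR.2 h.int.intervalIntegrable (by simp) ?_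
              intro z hz
              rcases hz.1.eq_or_lt with h' | h'
              · rw [h']
              · exact hr z h'
          _ = (R - x) * f x := by simp
          _ ≤ _ := by nlinarith
    · intro s hs
      have hs : F s = p := hs
      have hsa : a < s := by
        by_contra hc
        push Not at hc
        have := Fmono hc
        rw [Fa, hs] at this
        linarith [hp.1]
      have hsb : s < b := by
        by_contra hc
        push Not at hc
        have := Fmono hc
        rw [Fb, hs] at this
        linarith [hp.2]
      rw [← hs]
      exact (qF s ⟨hsa, hsb⟩).2.symm
  · exact hcont.comp (fun p hp => (qcont p hp).continuousWithinAt) (fun p hp => hq p hp)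
  · have Fimg : F '' Ioo a b = Ioo 0 1 := by
      ext p
      constructor
      · rintro ⟨x, hx, rfl⟩; exact (qF x hx).1
      · intro hp; exact ⟨q p, hq p hp, hFq p hp⟩
    have cv := integral_image_eq_integral_abs_deriv_smul (s := Ioo a b) (f := F) (f' := f)
      measurableSet_Ioo (fun x hx => (Fder x hx).hasDerivWithinAt)
      (Fstrict.injOn.mono Ioo_subset_Icc_self) q
    rw [Fimg] at cv
    rw [cv]
    have e1 : ∫ x in Ioo a b, |f x| • q (F x) = ∫ x in Ioo a b, x * f x := by
      refine setIntegral_congr_fun measurableSet_Ioo ?_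
      intro x hx
      simp only [smul_eq_mul]
      rw [(qF x hx).2, abs_of_nonneg (h.nn x), mul_comm]
    rw [e1]
    rw [← integral_Icc_eq_integral_Ioo]
    refine setIntegral_eq_integral_of_forall_compl_eq_zero ?_
    intro x hx
    rw [mem_Icc, not_and_or, not_le, not_le] at hx
    rcases hx with hx | hx
    · simp [za x hx]
    · simp [zb x hx]

end St8

open MeasureTheory Set Pointwise
set_option linter.unusedSectionVars false
namespace St8

lemma amgm_aux {a b w R κ : ℝ} (ha : 0 < a) (hb : 0 < b) (hw : 0 ≤ w) (hκ : 0 < κ) (hR : 0 < R)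
    (h1 : w * a ^ 2 ≤ 2 * R) (h2 : w * b ^ 2 ≤ 2 * R) :
    w * |a ^ 2 - b ^ 2| ≤ (1 / κ) * ((a ^ 2 + b ^ 2) / (2 * (a * b)) - 1) + 8 * κ * R ^ 2 := by
  have e0 : (a ^ 2 + b ^ 2) / (2 * (a * b)) - 1 = (a - b) ^ 2 / (2 * (a * b)) := by
    field_simp; ring
  rw [e0]
  have e1 : |a ^ 2 - b ^ 2| = |a - b| * (a + b) := by
    rw [show a ^ 2 - b ^ 2 = (a - b) * (a + b) by ring, abs_mul, abs_of_pos (add_pos ha hb)]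
  rw [e1]
  have hwab : w * (a * b) ≤ 2 * R := by nlinarith [sq_nonneg (a - b)]
  have hwab2 : w * (a + b) ^ 2 ≤ 8 * R := by nlinarith [sq_nonneg (a - b)]
  have hY : (w * (a + b)) ^ 2 * (a * b) ≤ 16 * R ^ 2 := by
    have : (w * (a + b)) ^ 2 * (a * b) = (w * (a * b)) * (w * (a + b) ^ 2) := by ring
    rw [this]
    calc _ ≤ (2 * R) * (8 * R) := mul_le_mul hwab hwab2 (by positivity) (by positivity)
      _ = _ := by ring
  have hab : 0 < a * b := by positivity
  have key : w * (|a - b| * (a + b)) ≤ (1 / κ) * ((a - b) ^ 2 / (2 * (a * b)))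
      + (κ / 2) * ((w * (a + b)) ^ 2 * (a * b)) := by
    have : (1 / κ) * ((a - b) ^ 2 / (2 * (a * b))) + (κ / 2) * ((w * (a + b)) ^ 2 * (a * b))
        - w * (|a - b| * (a + b)) = (|a - b| - κ * (a * b) * (w * (a + b))) ^ 2 / (2 * κ * (a * b)) := by
      field_simp
      rw [← sq_abs (a - b)]
      ring
    have h3 : 0 ≤ (|a - b| - κ * (a * b) * (w * (a + b))) ^ 2 / (2 * κ * (a * b)) := by positivity
    linarith
  have : (κ / 2) * ((w * (a + b)) ^ 2 * (a * b)) ≤ (κ / 2) * (16 * R ^ 2) := by gcongr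
  linarith

/-- The transport inequality. -/
lemma transport_aux {R ε : ℝ} {f g h : ℝ → ℝ} (hε : 0 < ε) (hR : 0 < R)
    (h0 : ∀ x, 0 ≤ h x) (hi : Integrable h) (hI : ∫ x, h x ≤ 1 + ε)
    (H : ∀ x y, √(f x * g y) ≤ h ((x + y) / 2)) {q r : ℝ → ℝ}
    (qm : StrictMonoOn q (Ioo 0 1)) (rm : StrictMonoOn r (Ioo 0 1))
    (hq : ∀ p ∈ Ioo (0:ℝ) 1, HasDerivAt q (1 / f (q p)) p ∧ 0 < f (q p) ∧
        min p (1 - p) ≤ 2 * R * f (q p))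
    (hr : ∀ p ∈ Ioo (0:ℝ) 1, HasDerivAt r (1 / g (r p)) p ∧ 0 < g (r p) ∧
        min p (1 - p) ≤ 2 * R * g (r p))
    (qc : ContinuousOn (fun p => f (q p)) (Ioo 0 1))
    (rc : ContinuousOn (fun p => g (r p)) (Ioo 0 1)) :
    IntegrableOn (fun p => min p (1 - p) * |1 / g (r p) - 1 / f (q p)|) (Ioo 0 1) ∧
    ∫ p in Ioo (0:ℝ) 1, min p (1 - p) * |1 / g (r p) - 1 / f (q p)| ≤ 9 * R * √ε := by
  set z : ℝ → ℝ := fun p => (q p + r p) / 2 with hz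
  have zder : ∀ p ∈ Ioo (0:ℝ) 1, HasDerivAt z ((1 / f (q p) + 1 / g (r p)) / 2) p := fun p hp =>
    ((hq p hp).1.add (hr p hp).1).div_const 2
  have zinj : InjOn z (Ioo 0 1) := by
    have : StrictMonoOn z (Ioo 0 1) := by
      intro p hp p' hp' hpp
      have := qm hp hp' hpp
      have := rm hp hp' hpp
      simp only [hz]; linarith
    exact this.injOn
  -- the defect
  set Df : ℝ → ℝ := fun p => (1 / f (q p) + 1 / g (r p)) / 2 * √(f (q p) * g (r p)) with hDf
  have cDf : ContinuousOn Df (Ioo 0 1) := by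
    refine ContinuousOn.mul ?_ (qc.mul rc).sqrt
    refine ContinuousOn.div_const (ContinuousOn.add ?_ ?_) 2
    · exact continuousOn_const.div qc fun p hp => (hq p hp).2.1.ne'
    · exact continuousOn_const.div rc fun p hp => (hr p hp).2.1.ne'
  have l1 : ∫⁻ p in Ioo (0:ℝ) 1, ENNReal.ofReal (Df p) ≤ ENNReal.ofReal (1 + ε) := by
    calc ∫⁻ p in Ioo (0:ℝ) 1, ENNReal.ofReal (Df p)
        ≤ ∫⁻ p in Ioo (0:ℝ) 1, ENNReal.ofReal |(1 / f (q p) + 1 / g (r p)) / 2| *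
            ENNReal.ofReal (h (z p)) := by
          refine setLIntegral_mono' measurableSet_Ioo ?_
          intro p hp
          have a1 := (hq p hp).2.1
          have a2 := (hr p hp).2.1
          rw [abs_of_pos (by positivity), ← ENNReal.ofReal_mul (by positivity)]
          refine ENNReal.ofReal_le_ofReal ?_
          exact mul_le_mul_of_nonneg_left (H _ _) (by positivity)
      _ = ∫⁻ x in z '' Ioo 0 1, ENNReal.ofReal (h x) := by
          rw [lintegral_image_eq_lintegral_abs_deriv_mul measurableSet_Ioo
            (fun p hp => (zder p hp).hasDerivWithinAt) zinj]
      _ ≤ ∫⁻ x, ENNReal.ofReal (h x) := setLIntegral_le_lintegral _ _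
      _ = ENNReal.ofReal (∫ x, h x) :=
          (ofReal_integral_eq_lintegral_ofReal hi (Filter.Eventually.of_forall h0)).symm
      _ ≤ _ := ENNReal.ofReal_le_ofReal hI
  have Df0 : ∀ p ∈ Ioo (0:ℝ) 1, 0 ≤ Df p := by
    intro p hp
    have a1 := (hq p hp).2.1
    have a2 := (hr p hp).2.1
    simp only [hDf]; positivity
  have iDf : IntegrableOn Df (Ioo 0 1) := by
    refine ⟨cDf.aestronglyMeasurable measurableSet_Ioo, ?_⟩
    rw [hasFiniteIntegral_iff_ofReal]
    · exact l1.trans_lt ENNReal.ofReal_lt_top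
    · exact (ae_restrict_iff' measurableSet_Ioo).2 (Filter.Eventually.of_forall Df0)
  have iDfb : ∫ p in Ioo (0:ℝ) 1, Df p ≤ 1 + ε := by
    rw [integral_eq_lintegral_of_nonneg_ae
      ((ae_restrict_iff' measurableSet_Ioo).2 (Filter.Eventually.of_forall Df0))
      (cDf.aestronglyMeasurable measurableSet_Ioo)]
    exact ENNReal.toReal_le_of_le_ofReal (by positivity) l1
  set κ := √ε / R with hκ
  have κ0 : 0 < κ := by positivity
  have pw : ∀ p ∈ Ioo (0:ℝ) 1, min p (1 - p) * |1 / g (r p) - 1 / f (q p)| ≤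
      (1 / κ) * (Df p - 1) + 8 * κ * R ^ 2 := by
    intro p hp
    obtain ⟨-, a1, b1⟩ := hq p hp
    obtain ⟨-, a2, b2⟩ := hr p hp
    have s1 := Real.sqrt_pos.2 a1
    have s2 := Real.sqrt_pos.2 a2
    have q1 := Real.sq_sqrt a1.le
    have q2 := Real.sq_sqrt a2.le
    have hw : 0 ≤ min p (1 - p) := le_min hp.1.le (by linarith [hp.2])
    have := amgm_aux (a := 1 / √(g (r p))) (b := 1 / √(f (q p))) (w := min p (1 - p)) (R := R) (κ := κ)
      (by positivity) (by positivity) hw κ0 hR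
      (by rw [div_pow, q2, one_pow, mul_one_div, div_le_iff₀ a2]; exact b2)
      (by rw [div_pow, q1, one_pow, mul_one_div, div_le_iff₀ a1]; exact b1)
    simp only [div_pow, q1, q2, one_pow] at this
    refine this.trans (le_of_eq ?_)
    congr 3
    simp only [hDf]
    rw [Real.sqrt_mul a1.le]
    field_simp
    ring
  have iR : IntegrableOn (fun p => (1 / κ) * (Df p - 1) + 8 * κ * R ^ 2) (Ioo 0 1) := by
    refine Integrable.add (Integrable.const_mul (iDf.sub ?_) _) ?_
    · exact integrable_const _
    · exact integrable_const _
  have cL : ContinuousOn (fun p => min p (1 - p) * |1 / g (r p) - 1 / f (q p)|) (Ioo 0 1) := by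
    refine ContinuousOn.mul (by fun_prop) (ContinuousOn.abs (ContinuousOn.sub ?_ ?_))
    · exact continuousOn_const.div rc fun p hp => (hr p hp).2.1.ne'
    · exact continuousOn_const.div qc fun p hp => (hq p hp).2.1.ne'
  have nnL : ∀ p ∈ Ioo (0:ℝ) 1, 0 ≤ min p (1 - p) * |1 / g (r p) - 1 / f (q p)| := fun p hp =>
    mul_nonneg (le_min hp.1.le (by linarith [hp.2])) (abs_nonneg _)
  have iL : IntegrableOn (fun p => min p (1 - p) * |1 / g (r p) - 1 / f (q p)|) (Ioo 0 1) := by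
    refine Integrable.mono' iR (cL.aestronglyMeasurable measurableSet_Ioo) ?_
    refine (ae_restrict_iff' measurableSet_Ioo).2 (Filter.Eventually.of_forall fun p hp => ?_)
    rw [Real.norm_of_nonneg (nnL p hp)]
    exact pw p hp
  refine ⟨iL, (setIntegral_mono_on iL iR measurableSet_Ioo pw).trans ?_⟩
  have iC : IntegrableOn (fun _ : ℝ => (1:ℝ)) (Ioo 0 1) := integrable_const _
  have iD1 : IntegrableOn (fun p => 1 / κ * (Df p - 1)) (Ioo 0 1) :=
    Integrable.const_mul (iDf.sub iC) _
  rw [integral_add iD1 (integrable_const _),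
    integral_const_mul, integral_sub iDf iC]
  simp only [integral_const, measureReal_restrict_apply_univ, Real.volume_real_Ioo, sub_zero, smul_eq_mul]
  have e1 : max (1:ℝ) 0 = 1 := by simp
  rw [e1]
  have hs : √ε * √ε = ε := Real.mul_self_sqrt hε.le
  have hs0 := Real.sqrt_pos.2 hε
  have : 1 / κ * ((∫ p in Ioo (0:ℝ) 1, Df p) - 1 * 1) ≤ 1 / κ * ε := by
    gcongr; linarith
  have e2 : 1 / κ * ε = R * √ε := by
    rw [hκ]; field_simp; nlinarith
  have e3 : 8 * κ * R ^ 2 = 8 * R * √ε := by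
    rw [hκ]; field_simp
  linarith

lemma transport {R ε : ℝ} {f g h : ℝ → ℝ} (hε : 0 < ε) (hf : LC R f) (hg : LC R g)
    (h0 : ∀ x, 0 ≤ h x) (hi : Integrable h) (hI : ∫ x, h x ≤ 1 + ε)
    (H : ∀ x y, √(f x * g y) ≤ h ((x + y) / 2)) {p s s' : ℝ} (hp : p ∈ Ioo (0:ℝ) 1)
    (hs : ∫ x in Iic s, f x = p) (hs' : ∫ x in Iic s', g x = p) :
    min p (1 - p) * |s' - s - ((∫ x, x * g x) - ∫ x, x * f x)| ≤ 27 * R * √ε := by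
  have hR := hf.R0
  obtain ⟨q, qm, hq, qc, qb⟩ := hf.quantile
  obtain ⟨r, rm, hr, rc, rb⟩ := hg.quantile
  obtain ⟨iL, bL⟩ := transport_aux hε hR h0 hi hI H qm rm
    (fun p hp => ⟨(hq p hp).1, (hq p hp).2.1, (hq p hp).2.2.1⟩)
    (fun p hp => ⟨(hr p hp).1, (hr p hp).2.1, (hr p hp).2.2.1⟩) qc rc
  rw [(hq p hp).2.2.2.2 s hs, (hr p hp).2.2.2.2 s' hs', ← qb, ← rb]
  set E := 9 * R * √ε with hE
  set d : ℝ → ℝ := fun p => 1 / g (r p) - 1 / f (q p) with hd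
  set D : ℝ → ℝ := fun p => r p - q p with hD
  have dD : ∀ p ∈ Ioo (0:ℝ) 1, HasDerivAt D (d p) p := fun p hp => (hr p hp).1.sub (hq p hp).1
  have cd : ContinuousOn d (Ioo 0 1) := by
    refine ContinuousOn.sub ?_ ?_
    · exact continuousOn_const.div rc fun p hp => (hr p hp).2.1.ne'
    · exact continuousOn_const.div qc fun p hp => (hq p hp).2.1.ne'
  have cq : ContinuousOn q (Ioo 0 1) := fun p hp => (hq p hp).1.continuousAt.continuousWithinAt
  have cr : ContinuousOn r (Ioo 0 1) := fun p hp => (hr p hp).1.continuousAt.continuousWithinAt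
  have cD : ContinuousOn D (Ioo 0 1) := cr.sub cq
  have bD : ∀ p ∈ Ioo (0:ℝ) 1, |D p| ≤ 2 * R := by
    intro p hp
    have h1 := (hq p hp).2.2.2.1
    have h2 := (hr p hp).2.2.2.1
    exact (abs_sub _ _).trans (by linarith)
  have bdi : ∀ u : ℝ → ℝ, ContinuousOn u (Ioo 0 1) → ∀ C, (∀ p ∈ Ioo (0:ℝ) 1, |u p| ≤ C) →
      IntegrableOn u (Ioo 0 1) := by
    intro u hu C hC
    refine Integrable.mono' (integrable_const C) (hu.aestronglyMeasurable measurableSet_Ioo) ?_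
    exact (ae_restrict_iff' measurableSet_Ioo).2 (Filter.Eventually.of_forall hC)
  have iq : IntegrableOn q (Ioo 0 1) := bdi q cq R fun p hp => (hq p hp).2.2.2.1
  have ir : IntegrableOn r (Ioo 0 1) := bdi r cr R fun p hp => (hr p hp).2.2.2.1
  have hm : (1/2 : ℝ) ∈ Ioo (0:ℝ) 1 := by constructor <;> norm_num
  have hsub : ∀ a b : ℝ, 0 < a → b < 1 → a ≤ b → uIcc a b ⊆ Ioo (0:ℝ) 1 := by
    intro a b ha hb hab
    rw [uIcc_of_le hab]
    exact fun x hx => ⟨lt_of_lt_of_le ha hx.1, lt_of_le_of_lt hx.2 hb⟩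
  -- weighted integrals over subintervals
  have hwb : ∀ (a b : ℝ) (w : ℝ → ℝ), 0 < a → b < 1 → a ≤ b → Continuous w →
      (∀ x ∈ Icc a b, |w x| ≤ min x (1 - x)) → |∫ x in a..b, w x * d x| ≤ E := by
    intro a b w ha hb hab hw hwx
    have hs := hsub a b ha hb hab
    rw [uIcc_of_le hab] at hs
    calc |∫ x in a..b, w x * d x| ≤ ∫ x in a..b, |w x * d x| :=
          intervalIntegral.abs_integral_le_integral_abs hab
      _ ≤ ∫ x in a..b, min x (1 - x) * |d x| := by
          refine intervalIntegral.integral_mono_on hab ?_ ?_ ?_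
          · refine ContinuousOn.intervalIntegrable ?_
            rw [uIcc_of_le hab]
            exact (hw.continuousOn.mul (cd.mono hs)).abs
          · refine ContinuousOn.intervalIntegrable ?_
            rw [uIcc_of_le hab]
            exact ContinuousOn.mul (by fun_prop) (cd.mono hs).abs
          · intro x hx
            rw [abs_mul]
            exact mul_le_mul_of_nonneg_right (hwx x hx) (abs_nonneg _)
      _ = ∫ x in Ioc a b, min x (1 - x) * |d x| := intervalIntegral.integral_of_le hab
      _ ≤ ∫ x in Ioo (0:ℝ) 1, min x (1 - x) * |d x| := by
          refine setIntegral_mono_set iL ?_ ?_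
          · refine (ae_restrict_iff' measurableSet_Ioo).2 (Filter.Eventually.of_forall fun x hx => ?_)
            exact mul_nonneg (le_min hx.1.le (by linarith [hx.2])) (abs_nonneg _)
          · exact (Ioc_subset_Icc_self.trans hs).eventuallyLE
      _ ≤ E := bL
  have ftc : ∀ (u u' : ℝ → ℝ) (a b : ℝ), 0 < a → b < 1 → a ≤ b →
      (∀ p ∈ Ioo (0:ℝ) 1, HasDerivAt u (u' p) p) → ContinuousOn u' (Ioo 0 1) →
      ∫ x in a..b, u' x = u b - u a := by
    intro u u' a b ha hb hab hu hu'
    have hs := hsub a b ha hb hab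
    exact intervalIntegral.integral_eq_sub_of_hasDerivAt (fun x hx => hu x (hs hx))
      (hu'.mono hs).intervalIntegrable
  set D₀ := D (1/2) with hD₀
  have bD₀ : |D₀| ≤ 2 * R := bD _ hm
  -- pointwise bound
  have pwb : min p (1 - p) * |D p - D₀| ≤ E := by
    have hw0 : 0 ≤ min p (1 - p) := le_min hp.1.le (by linarith [hp.2])
    rcases le_total p (1/2) with hp2 | hp2
    · have e1 := ftc D d p (1/2) hp.1 hm.2 hp2 dD cd
      have e2 := hwb p (1/2) (fun _ => min p (1 - p)) hp.1 hm.2 hp2 continuous_const (by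
        intro x hx
        rw [abs_of_nonneg hw0, min_eq_left (by linarith)]
        exact le_min hx.1 (by linarith [hx.2]))
      rw [intervalIntegral.integral_const_mul, e1, abs_mul, abs_of_nonneg hw0, abs_sub_comm] at e2
      exact e2
    · have e1 := ftc D d (1/2) p hm.1 hp.2 hp2 dD cd
      have e2 := hwb (1/2) p (fun _ => min p (1 - p)) hm.1 hp.2 hp2 continuous_const (by
        intro x hx
        rw [abs_of_nonneg hw0, min_eq_right (by linarith)]
        exact le_min (by linarith [hx.1, hp.2]) (by linarith [hx.2]))
      rw [intervalIntegral.integral_const_mul, e1, abs_mul, abs_of_nonneg hw0] at e2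
      exact e2
  -- integral bound
  have cDD : ContinuousOn (fun x => D x - D₀) (Ioo 0 1) := cD.sub continuousOn_const
  have bDD : ∀ x ∈ Ioo (0:ℝ) 1, |D x - D₀| ≤ 4 * R := fun x hx =>
    (abs_sub _ _).trans (by linarith [bD x hx])
  have iDD : IntegrableOn (fun x => D x - D₀) (Ioo 0 1) := bdi _ cDD _ bDD
  have iI : IntervalIntegrable (fun x => D x - D₀) volume 0 1 :=
    (intervalIntegrable_iff_integrableOn_Ioo_of_le zero_le_one).2 iDD
  have ibd : |∫ x in (0:ℝ)..1, (D x - D₀)| ≤ 2 * E := by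
    refine le_of_forall_pos_le_add fun η hη => ?_
    set a := min (1/4) (η / (16 * R)) with ha
    have a0 : 0 < a := lt_min (by norm_num) (by positivity)
    have a4 : a ≤ 1/4 := min_le_left _ _
    have aη : a * (16 * R) ≤ η := by
      have := min_le_right (1/4) (η / (16 * R))
      rwa [← ha, le_div_iff₀ (by positivity)] at this
    have ii : ∀ x y : ℝ, 0 ≤ x → x ≤ y → y ≤ 1 → IntervalIntegrable (fun x => D x - D₀) volume x y := by
      intro x y hx hxy hy
      refine iI.mono_set ?_
      rw [uIcc_of_le hxy, uIcc_of_le zero_le_one]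
      exact Icc_subset_Icc hx hy
    have split : ∫ x in (0:ℝ)..1, (D x - D₀) = (∫ x in (0:ℝ)..a, (D x - D₀)) +
        (∫ x in a..(1/2), (D x - D₀)) + (∫ x in (1/2)..(1-a), (D x - D₀)) +
        ∫ x in (1-a)..1, (D x - D₀) := by
      rw [intervalIntegral.integral_add_adjacent_intervals (ii _ _ le_rfl a0.le (by linarith))
          (ii _ _ a0.le (by linarith) (by norm_num)),
        intervalIntegral.integral_add_adjacent_intervals (ii _ _ le_rfl (by norm_num) (by norm_num))
          (ii _ _ (by norm_num) (by linarith) (by linarith)),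
        intervalIntegral.integral_add_adjacent_intervals (ii _ _ le_rfl (by linarith) (by linarith))
          (ii _ _ (by linarith) (by linarith) (by norm_num))]
    have ends : ∀ x y : ℝ, 0 ≤ x → x ≤ y → y ≤ 1 → |∫ x in x..y, (D x - D₀)| ≤ 4 * R * (y - x) := by
      intro x y hx hxy hy
      rw [intervalIntegral.integral_of_le hxy, integral_Ioc_eq_integral_Ioo]
      have := norm_setIntegral_le_of_norm_le_const (μ := volume) (s := Ioo x y) (f := fun x => D x - D₀)
        (C := 4 * R) (by simp) (fun z hz => bDD z ⟨lt_of_le_of_lt hx hz.1, lt_of_lt_of_le hz.2 hy⟩)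
      rwa [Real.volume_real_Ioo_of_le hxy, Real.norm_eq_abs] at this
    have m1 : |∫ x in a..(1/2), (D x - D₀)| ≤ E + a * (4 * R) := by
      have e1 := ftc (fun x => x * (D x - D₀)) (fun x => 1 * (D x - D₀) + x * d x) a (1/2) a0 hm.2
        (by linarith) (fun x hx => (hasDerivAt_id' x).mul ((dD x hx).sub_const D₀))
        ((continuousOn_const.mul cDD).add (continuousOn_id.mul cd))
      have hs := hsub a (1/2) a0 hm.2 (by linarith)
      have k1 : IntervalIntegrable (fun x => 1 * (D x - D₀)) volume a (1/2) :=
        ((continuousOn_const.mul cDD).mono hs).intervalIntegrable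
      have k2 : IntervalIntegrable (fun x => x * d x) volume a (1/2) :=
        ((continuousOn_id.mul cd).mono hs).intervalIntegrable
      rw [intervalIntegral.integral_add k1 k2] at e1
      simp only [one_mul] at e1
      have e2 := hwb a (1/2) (fun x => x) a0 hm.2 (by linarith) continuous_id (by
        intro x hx
        rw [abs_of_pos (by linarith [hx.1])]
        exact le_min le_rfl (by linarith [hx.2]))
      have e3 : |a * (D a - D₀)| ≤ a * (4 * R) := by
        rw [abs_mul, abs_of_pos a0]
        exact mul_le_mul_of_nonneg_left (bDD a ⟨a0, by linarith⟩) a0.le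
      rw [← hD₀, sub_self, mul_zero, zero_sub] at e1
      have : ∫ x in a..(1/2), (D x - D₀) = -(a * (D a - D₀)) - ∫ x in a..(1/2), x * d x := by
        linarith
      rw [this]
      refine (abs_sub _ _).trans ?_
      rw [abs_neg]; linarith
    have m2 : |∫ x in (1/2)..(1-a), (D x - D₀)| ≤ E + a * (4 * R) := by
      have e1 := ftc (fun x => (1 - x) * (D x - D₀)) (fun x => (-1) * (D x - D₀) + (1 - x) * d x) (1/2) (1-a)
        hm.1 (by linarith)
        (by linarith) (fun x hx => ((hasDerivAt_id' x).const_sub 1).mul ((dD x hx).sub_const D₀))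
        ((continuousOn_const.mul cDD).add ((continuousOn_const.sub continuousOn_id).mul cd))
      have hs := hsub (1/2) (1-a) hm.1 (by linarith) (by linarith)
      have k1 : IntervalIntegrable (fun x => (-1) * (D x - D₀)) volume (1/2) (1-a) :=
        ((continuousOn_const.mul cDD).mono hs).intervalIntegrable
      have k2 : IntervalIntegrable (fun x => (1 - x) * d x) volume (1/2) (1-a) :=
        (((continuousOn_const.sub continuousOn_id).mul cd).mono hs).intervalIntegrable
      rw [intervalIntegral.integral_add k1 k2, intervalIntegral.integral_const_mul] at e1
      have e2 := hwb (1/2) (1-a) (fun x => 1 - x) hm.1 (by linarith) (by linarith) (by fun_prop) (by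
        intro x hx
        rw [abs_of_pos (by linarith [hx.2])]
        exact le_min (by linarith [hx.1]) le_rfl)
      have e3 : |a * (D (1-a) - D₀)| ≤ a * (4 * R) := by
        rw [abs_mul, abs_of_pos a0]
        exact mul_le_mul_of_nonneg_left (bDD _ ⟨by linarith, by linarith⟩) a0.le
      rw [← hD₀, sub_self, mul_zero, sub_zero, sub_sub_cancel] at e1
      have : ∫ x in (1/2)..(1-a), (D x - D₀) = (∫ x in (1/2)..(1-a), (1 - x) * d x) - a * (D (1-a) - D₀) := by
        linarith
      rw [this]
      refine (abs_sub _ _).trans ?_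
      linarith
    have n1 := ends 0 a le_rfl a0.le (by linarith)
    have n2 := ends (1-a) 1 (by linarith) (by linarith) le_rfl
    rw [split]
    refine (abs_add_le _ _).trans ?_
    have := abs_add_le ((∫ x in (0:ℝ)..a, (D x - D₀)) + (∫ x in a..(1/2), (D x - D₀)))
      (∫ x in (1/2)..(1-a), (D x - D₀))
    have := abs_add_le (∫ x in (0:ℝ)..a, (D x - D₀)) (∫ x in a..(1/2), (D x - D₀))
    linarith
  have eqI : ∫ x in (0:ℝ)..1, (D x - D₀) = (∫ p in Ioo (0:ℝ) 1, r p) - (∫ p in Ioo (0:ℝ) 1, q p) - D₀ := by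
    rw [intervalIntegral.integral_of_le zero_le_one, integral_Ioc_eq_integral_Ioo,
      integral_sub (f := D) (ir.sub iq) (integrable_const _), hD, integral_sub ir iq]
    simp
  rw [eqI] at ibd
  have hw1 : min p (1 - p) ≤ 1 / 2 := by
    rcases le_total p (1/2) with h | h
    · exact (min_le_left _ _).trans h
    · exact (min_le_right _ _).trans (by linarith)
  have hw0 : 0 ≤ min p (1 - p) := le_min hp.1.le (by linarith [hp.2])
  set X := (∫ p in Ioo (0:ℝ) 1, r p) - (∫ p in Ioo (0:ℝ) 1, q p)
  have tri : |r p - q p - X| ≤ |D p - D₀| + |X - D₀| := by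
    have : r p - q p - X = (D p - D₀) - (X - D₀) := by simp only [hD]; ring
    rw [this]; exact abs_sub _ _
  have hE0 : 0 ≤ E := by positivity
  calc min p (1 - p) * |r p - q p - X| ≤ min p (1 - p) * (|D p - D₀| + |X - D₀|) := by gcongr
    _ = min p (1 - p) * |D p - D₀| + min p (1 - p) * |X - D₀| := by ring
    _ ≤ E + (1 / 2) * (2 * E) := by gcongr
    _ ≤ 27 * R * √ε := by rw [hE] at hE0 ⊢; linarith

end St8

open MeasureTheory Set Pointwise
set_option linter.unusedSectionVars false
namespace St8

/-- ambient Euclidean space of dimension `m + 1` -/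
abbrev E (m : ℕ) := EuclideanSpace ℝ (Fin (m + 1))

/-- coordinates adapted to a unit vector -/
structure Coord {m : ℕ} (θ : E m) (Φ : E m ≃L[ℝ] ℝ × (Fin m → ℝ)) : Prop where
  mp : MeasurePreserving Φ
  fst : ∀ x, (Φ x).1 = inner ℝ θ x
  nrm : ∀ x, ‖x‖ ^ 2 = (Φ x).1 ^ 2 + ∑ i, (Φ x).2 i ^ 2
  snd : ∃ e : Fin m → E m, (∀ i, ‖e i‖ = 1) ∧ ∀ x i, (Φ x).2 i = inner ℝ (e i) x

lemma exists_coord {m : ℕ} {θ : E m} (hθ : ‖θ‖ = 1) : ∃ Φ, Coord θ Φ := by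
  obtain ⟨b, hb⟩ := Orthonormal.exists_orthonormalBasis_extension_of_card_eq (𝕜 := ℝ) (E := E m)
    (ι := Fin (m + 1)) (by simp) (v := fun _ => θ) (s := {0}) (by
      constructor
      · intro i; simpa using hθ
      · intro i j hij; exact absurd (Subsingleton.elim i j) hij)
  have hb0 : b 0 = θ := hb 0 (by simp)
  let c : (Fin (m + 1) → ℝ) ≃L[ℝ] ℝ × (Fin m → ℝ) := (Fin.consEquivL ℝ (fun _ : Fin (m+1) => ℝ)).symm
  let o : E m ≃L[ℝ] (Fin (m + 1) → ℝ) := PiLp.continuousLinearEquiv 2 ℝ (fun _ : Fin (m+1) => ℝ)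
  let Φ : E m ≃L[ℝ] ℝ × (Fin m → ℝ) := (b.repr.toContinuousLinearEquiv.trans o).trans c
  have f1 : ∀ x, (Φ x).1 = inner ℝ (b 0) x := fun x => b.repr_apply_apply x 0
  have f2 : ∀ x i, (Φ x).2 i = inner ℝ (b i.succ) x := fun x i => b.repr_apply_apply x i.succ
  refine ⟨Φ, ?_, ?_, ?_, fun i => b i.succ, fun i => b.norm_eq_one _, f2⟩
  · have hc : MeasurePreserving c := by
      have := volume_preserving_piFinSuccAbove (fun _ : Fin (m+1) => ℝ) 0
      have he : ⇑c = ⇑(MeasurableEquiv.piFinSuccAbove (fun _ : Fin (m+1) => ℝ) 0) := by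
        ext x
        · rfl
        · rfl
      rw [he]
      exact this
    exact hc.comp ((PiLp.volume_preserving_ofLp (Fin (m+1))).comp b.measurePreserving_repr)
  · intro x; rw [f1, hb0]
  · intro x
    rw [← b.sum_sq_norm_inner_right x, Fin.sum_univ_succ, f1]
    simp [f2]

lemma BM_E (m : ℕ) : BM (E m) := by
  obtain ⟨Φ, hΦ⟩ := exists_coord (m := m) (θ := EuclideanSpace.single 0 1) (by simp)
  exact BM_transfer Φ hΦ.mp (BM_prod (BM_pi m))

/-- mass of the half space part -/
noncomputable def mu {m : ℕ} (θ : E m) (M : Set (E m)) (s : ℝ) : ℝ :=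
  volume.real (M ∩ {x | inner ℝ θ x ≤ s})

/-- barycenter -/
noncomputable def bar {m : ℕ} (M : Set (E m)) : E m := (volume.real M)⁻¹ • ∫ x in M, x

/-- midpoint set -/
def mid {m : ℕ} (M N : Set (E m)) : Set (E m) :=
  (fun p : E m × E m => (1/2 : ℝ) • p.1 + (1/2 : ℝ) • p.2) '' (M ×ˢ N)

lemma mid_compact {m : ℕ} {M N : Set (E m)} (hM : IsCompact M) (hN : IsCompact N) :
    IsCompact (mid M N) := (hM.prod hN).image (by fun_prop)

lemma mem_mid {m : ℕ} {M N : Set (E m)} {a b : E m} (ha : a ∈ M) (hb : b ∈ N) :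
    (1/2 : ℝ) • a + (1/2 : ℝ) • b ∈ mid M N := ⟨(a, b), ⟨ha, hb⟩, rfl⟩

lemma mid_mono {m : ℕ} {M N M' N' : Set (E m)} (h : M ⊆ M') (h' : N ⊆ N') : mid M N ⊆ mid M' N' :=
  image_mono (prod_mono h h')

lemma half_compact {m : ℕ} {M : Set (E m)} (hM : IsCompact M) (θ : E m) (s : ℝ) :
    IsCompact (M ∩ {x | inner ℝ θ x ≤ s}) :=
  hM.inter_right (isClosed_le (by fun_prop) continuous_const)

lemma half_convex {m : ℕ} {M : Set (E m)} (hM : Convex ℝ M) (θ : E m) (s : ℝ) :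
    Convex ℝ (M ∩ {x | inner ℝ θ x ≤ s}) :=
  hM.inter (convex_halfSpace_le (innerₛₗ ℝ θ).isLinear s)

lemma bm_half {m : ℕ} {M N : Set (E m)} (hM : IsCompact M) (hN : IsCompact N) :
    √(volume.real M * volume.real N) ≤ volume.real (mid M N) := by
  have := BM_E m (1/2) (by norm_num) (by norm_num) M N (mid M N) hM hN (mid_compact hM hN) (by
    intro a ha b hb
    have := mem_mid ha hb
    norm_num at this ⊢
    exact this)
  rw [Real.sqrt_mul measureReal_nonneg, Real.sqrt_eq_rpow, Real.sqrt_eq_rpow]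
  norm_num at this ⊢
  exact this

section marg
variable {m : ℕ} {θ : E m} {Φ : E m ≃L[ℝ] ℝ × (Fin m → ℝ)}

/-- marginal density -/
noncomputable def mg (Φ : E m ≃L[ℝ] ℝ × (Fin m → ℝ)) (M : Set (E m)) (s : ℝ) : ℝ :=
  volume.real (sl (Φ '' M) s)

lemma Coord.vol (h : Coord θ Φ) (M : Set (E m)) : volume.real (Φ '' M) = volume.real M := by
  rw [measureReal_def, measureReal_def, ← h.mp.measure_preimage_emb Φ.toHomeomorph.measurableEmbedding,
      preimage_image_eq _ Φ.injective]

lemma mg_integrable {M : Set (E m)} (hM : IsCompact M) : Integrable (mg Φ M) :=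
  sl_integrable (hM.image Φ.continuous)

lemma mg_nonneg (M : Set (E m)) (s : ℝ) : 0 ≤ mg Φ M s := measureReal_nonneg

lemma mg_integral (h : Coord θ Φ) {M : Set (E m)} (hM : IsCompact M) :
    ∫ s, mg Φ M s = volume.real M := by
  rw [← h.vol M, sl_integral (hM.image Φ.continuous)]; rfl

lemma mg_mu (h : Coord θ Φ) {M : Set (E m)} (hM : IsCompact M) (s : ℝ) :
    ∫ x in Iic s, mg Φ M x = mu θ M s := by
  rw [mu, ← mg_integral h (half_compact hM θ s), ← integral_indicator measurableSet_Iic]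
  congr 1
  ext x
  by_cases hx : x ∈ Iic s
  · rw [indicator_of_mem hx]
    unfold mg
    congr 1
    ext z
    simp only [sl, mem_preimage, mem_image, mem_inter_iff, mem_ofPred_eq]
    constructor
    · rintro ⟨y, hy, e⟩
      refine ⟨y, ⟨hy, ?_⟩, e⟩
      rw [← h.fst, e]; exact hx
    · rintro ⟨y, ⟨hy, -⟩, e⟩; exact ⟨y, hy, e⟩
  · rw [indicator_of_notMem hx]
    unfold mg
    have : sl (Φ '' (M ∩ {x | inner ℝ θ x ≤ s})) x = ∅ := by
      ext z
      simp only [sl, mem_preimage, mem_image, mem_inter_iff, mem_ofPred_eq, mem_empty_iff_false, iff_false]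
      rintro ⟨y, ⟨hy, h1⟩, e⟩
      rw [← h.fst, e] at h1
      exact hx h1
    rw [this]; simp

lemma mg_supp (h : Coord θ Φ) {M : Set (E m)} {R : ℝ} (hθ : ‖θ‖ = 1)
    (hR : M ⊆ Metric.closedBall 0 R) (s : ℝ) (hs : mg Φ M s ≠ 0) : |s| ≤ R := by
  have : (sl (Φ '' M) s).Nonempty := by
    by_contra hc
    rw [not_nonempty_iff_eq_empty] at hc
    exact hs (by simp [mg, hc])
  obtain ⟨z, y, hy, e⟩ := this
  have h1 : s = inner ℝ θ y := by rw [← h.fst, e]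
  rw [h1]
  have := abs_real_inner_le_norm θ y
  rw [hθ, one_mul] at this
  exact this.trans (by simpa using hR hy)

lemma Coord.abs_snd_le (h : Coord θ Φ) (x : E m) (i : Fin m) : |(Φ x).2 i| ≤ ‖x‖ := by
  refine abs_le_of_sq_le_sq ?_ (norm_nonneg x)
  rw [h.nrm]
  have := Finset.single_le_sum (f := fun i => (Φ x).2 i ^ 2) (fun i _ => sq_nonneg _) (Finset.mem_univ i)
  nlinarith [sq_nonneg (Φ x).1]

lemma mg_le (h : Coord θ Φ) {M : Set (E m)} {R : ℝ} (hR0 : 0 ≤ R)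
    (hR : M ⊆ Metric.closedBall 0 R) (s : ℝ) : mg Φ M s ≤ (2 * R) ^ m := by
  have hsub : sl (Φ '' M) s ⊆ Metric.closedBall (0 : Fin m → ℝ) R := by
    rintro z ⟨y, hy, e⟩
    rw [mem_closedBall_zero_iff, pi_norm_le_iff_of_nonneg hR0]
    intro i
    have := h.abs_snd_le y i
    rw [e] at this
    exact this.trans (by simpa using hR hy)
  have e1 : volume (Metric.closedBall (0 : Fin m → ℝ) R) = ENNReal.ofReal ((2 * R) ^ m) := by
    rw [Real.volume_pi_closedBall _ hR0]; simp
  calc mg Φ M s ≤ volume.real (Metric.closedBall (0 : Fin m → ℝ) R) :=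
        measureReal_mono hsub (by rw [e1]; simp)
    _ = _ := by rw [measureReal_def, e1, ENNReal.toReal_ofReal (by positivity)]

lemma mg_lc {M N C : Set (E m)} (hM : IsCompact M) (hN : IsCompact N) (hC : IsCompact C)
    {t : ℝ} (h0 : 0 < t) (h1 : t < 1) (H : ∀ a ∈ M, ∀ b ∈ N, t • a + (1 - t) • b ∈ C) (x y : ℝ) :
    mg Φ M x ^ t * mg Φ N y ^ (1 - t) ≤ mg Φ C (t * x + (1 - t) * y) := by
  refine sl_bm (BM_pi m) h0 h1 (hM.image Φ.continuous) (hN.image Φ.continuous)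
    (hC.image Φ.continuous) ?_ x y
  rintro _ ⟨a, ha, rfl⟩ _ ⟨b, hb, rfl⟩
  exact ⟨_, H a ha b hb, by simp⟩

lemma mg_first (h : Coord θ Φ) {M : Set (E m)} (hM : IsCompact M) :
    ∫ s, s * mg Φ M s = inner ℝ θ (∫ x in M, x) := by
  have hMi : IntegrableOn (fun x : E m => x) M := continuousOn_id.integrableOn_compact hM
  rw [← integral_inner hMi]
  have e1 : ∫ x in M, inner ℝ θ x = ∫ y in Φ '' M, y.1 := by
    rw [h.mp.setIntegral_image_emb Φ.toHomeomorph.measurableEmbedding]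
    simp only [h.fst]
  have hc := hM.image Φ.continuous
  rw [e1, ← integral_indicator hc.measurableSet]
  have hcap : Integrable (indicator (Φ '' M) (fun y : ℝ × (Fin m → ℝ) => y.1)) := by
    rw [integrable_indicator_iff hc.measurableSet]
    exact continuous_fst.continuousOn.integrableOn_compact hc
  rw [Measure.volume_eq_prod] at hcap ⊢
  rw [integral_prod _ hcap]
  congr 1
  ext s
  have : (fun y => (Φ '' M).indicator (fun y : ℝ × (Fin m → ℝ) => y.1) (s, y)) =
      (sl (Φ '' M) s).indicator (fun _ => s) := by
    ext y
    by_cases hy : (s, y) ∈ Φ '' M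
    · rw [indicator_of_mem hy, indicator_of_mem (show y ∈ sl (Φ '' M) s from hy)]
    · rw [indicator_of_notMem hy, indicator_of_notMem (show y ∉ sl (Φ '' M) s from hy)]
  rw [this, integral_indicator (sl_compact hc s).measurableSet]
  simp [mg, mul_comm]

lemma mg_LC (h : Coord θ Φ) (hθ : ‖θ‖ = 1) {M : Set (E m)} {R : ℝ} (hM : IsCompact M)
    (hc : Convex ℝ M) (hR0 : 0 < R)
    (hR : M ⊆ Metric.closedBall 0 R) (hv : 0 < volume.real M) :
    LC R (fun s => mg Φ M s / volume.real M) where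
  R0 := hR0
  nn := fun s => div_nonneg (mg_nonneg _ _) hv.le
  int := (mg_integrable hM).div_const _
  one := by rw [integral_div, mg_integral h hM, div_self hv.ne']
  supp := fun s hs => mg_supp h hθ hR s fun h0 => hs (by simp [h0])
  lc := by
    intro t h0 h1 x y
    rw [Real.div_rpow (mg_nonneg _ _) hv.le, Real.div_rpow (mg_nonneg _ _) hv.le, div_mul_div_comm,
      ← Real.rpow_add hv]
    simp only [add_sub_cancel, Real.rpow_one]
    gcongr
    exact mg_lc hM hM hM h0 h1 (fun a ha b hb => hc ha hb h0.le (by linarith) (by ring)) x y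

end marg

variable {m : ℕ} {θ : E m}

/-- Lemma T -/
lemma lemT (hθ : ‖θ‖ = 1) {M N : Set (E m)} {R ε : ℝ} (hM : IsCompact M) (hN : IsCompact N)
    (cM : Convex ℝ M) (cN : Convex ℝ N) (hR0 : 0 < R)
    (hMR : M ⊆ Metric.closedBall 0 R) (hNR : N ⊆ Metric.closedBall 0 R)
    (vM : 0 < volume.real M) (vN : 0 < volume.real N) (hε : 0 < ε)
    (hV : volume.real (mid M N) ≤ √(volume.real M * volume.real N) * (1 + ε))
    {p s s' : ℝ} (hp : p ∈ Ioo (0:ℝ) 1) (hs : mu θ M s = p * volume.real M)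
    (hs' : mu θ N s' = p * volume.real N) :
    min p (1 - p) * |s' - s - inner ℝ θ (bar N - bar M)| ≤ 27 * R * √ε := by
  obtain ⟨Φ, h⟩ := exists_coord hθ
  have hC := mid_compact hM hN
  set c := √(volume.real M * volume.real N) with hc
  have c0 : 0 < c := by positivity
  have key := transport (h := fun s => mg Φ (mid M N) s / c) hε (mg_LC h hθ hM cM hR0 hMR vM) (mg_LC h hθ hN cN hR0 hNR vN)
    (fun x => div_nonneg (mg_nonneg _ _) c0.le) ((mg_integrable hC).div_const _)
    (by rw [integral_div, mg_integral h hC, div_le_iff₀ c0, mul_comm]; exact hV)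
    (by
      intro x y
      have := mg_lc (Φ := Φ) hM hN hC (t := 1/2) (by norm_num) (by norm_num) (by
        intro a ha b hb
        have := mem_mid ha hb
        norm_num at this ⊢
        exact this) x y
      rw [div_mul_div_comm, Real.sqrt_div (mul_nonneg (mg_nonneg _ _) (mg_nonneg _ _)), ← hc,
        Real.sqrt_mul (mg_nonneg _ _), Real.sqrt_eq_rpow, Real.sqrt_eq_rpow]
      gcongr
      have e : (x + y) / 2 = 1 / 2 * x + (1 - 1/2) * y := by ring
      rw [e]
      rw [show (1:ℝ) - 1/2 = 1/2 by norm_num] at this ⊢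
      exact this)
    (s := s) (s' := s') hp
    (by rw [integral_div, mg_mu h hM, hs]; field_simp)
    (by rw [integral_div, mg_mu h hN, hs']; field_simp)
  have fb : ∀ {K : Set (E m)}, IsCompact K → ∫ x, x * (mg Φ K x / volume.real K) = inner ℝ θ (bar K) := by
    intro K hK
    simp only [← mul_div_assoc]
    rw [integral_div, mg_first h hK, bar, real_inner_smul_right]
    ring
  rw [fb hM, fb hN, ← inner_sub_right] at key
  exact key

lemma mu_nonneg (M : Set (E m)) (s : ℝ) : 0 ≤ mu θ M s := measureReal_nonneg

lemma mu_le {M : Set (E m)} (hM : IsCompact M) (s : ℝ) : mu θ M s ≤ volume.real M :=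
  measureReal_mono inter_subset_left hM.measure_lt_top.ne

lemma mu_mono {M : Set (E m)} (hM : IsCompact M) : Monotone (mu θ M) := by
  intro s s' h
  refine measureReal_mono ?_ (half_compact hM _ _).measure_lt_top.ne
  exact inter_subset_inter_right _ fun x hx => le_trans hx h

lemma mu_lip (hθ : ‖θ‖ = 1) {M : Set (E m)} {R : ℝ} (hM : IsCompact M)
    (hR0 : 0 < R) (hR : M ⊆ Metric.closedBall 0 R) {s s' : ℝ} (hs : s ≤ s') :
    mu θ M s' - mu θ M s ≤ (2 * R) ^ m * (s' - s) := by
  obtain ⟨Φ, h⟩ := exists_coord hθ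
  have hi := mg_integrable (Φ := Φ) hM
  rw [← mg_mu h hM, ← mg_mu h hM, intervalIntegral.integral_Iic_sub_Iic hi.integrableOn hi.integrableOn]
  calc ∫ x in s..s', mg Φ M x ≤ ∫ x in s..s', (2 * R) ^ m := by
        refine intervalIntegral.integral_mono_on hs hi.intervalIntegrable (by simp) ?_
        intro x _
        exact mg_le h hR0.le hR x
    _ = _ := by simp [mul_comm]

lemma mu_quasi (hθ : ‖θ‖ = 1) {M : Set (E m)} {R : ℝ} (hM : IsCompact M)
    (cM : Convex ℝ M) (hR0 : 0 < R) (hR : M ⊆ Metric.closedBall 0 R) (vM : 0 < volume.real M)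
    {s s' : ℝ} (hs : s ≤ s') :
    (s' - s) * min (mu θ M s) (volume.real M - mu θ M s') ≤ 2 * R * (mu θ M s' - mu θ M s) := by
  obtain ⟨Φ, h⟩ := exists_coord hθ
  have hi := mg_integrable (Φ := Φ) hM
  have hLC := mg_LC h hθ hM cM hR0 hR vM
  set μ0 := min (mu θ M s) (volume.real M - mu θ M s') with hμ
  have quasi : ∀ x y z, x < y → y < z → min (mg Φ M x) (mg Φ M z) ≤ mg Φ M y := by
    intro x y z hxy hyz
    have := hLC.quasi hxy hyz
    rcases min_le_iff.1 this with h' | h'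
    · exact (min_le_left _ _).trans ((div_le_div_iff_of_pos_right vM).1 h')
    · exact (min_le_right _ _).trans ((div_le_div_iff_of_pos_right vM).1 h')
  have z1 : ∀ y, y ∉ Icc (-R) R → mg Φ M y = 0 := by
    intro y hy
    by_contra hc
    exact hy (abs_le.1 (mg_supp h hθ hR y hc))
  have bd : ∀ S : Set ℝ, MeasurableSet S → ∀ c : ℝ, 0 ≤ c → (∀ y ∈ S, mg Φ M y ≤ c) →
      ∫ y in S, mg Φ M y ≤ 2 * R * c := by
    intro S hS c hc hSc
    calc ∫ y in S, mg Φ M y ≤ ∫ y in S, (Icc (-R) R).indicator (fun _ => c) y := by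
          refine setIntegral_mono_on hi.integrableOn ?_ hS ?_
          · exact ((integrable_indicator_iff measurableSet_Icc).2 (by simp)).integrableOn
          · intro y hy
            by_cases hyR : y ∈ Icc (-R) R
            · rw [indicator_of_mem hyR]; exact hSc y hy
            · rw [indicator_of_notMem hyR, z1 y hyR]
      _ ≤ ∫ y, (Icc (-R) R).indicator (fun _ => c) y := by
          refine setIntegral_le_integral ((integrable_indicator_iff measurableSet_Icc).2 (by simp)) ?_
          exact Filter.Eventually.of_forall fun y => indicator_nonneg (fun _ _ => hc) _
      _ = 2 * R * c := by
          rw [integral_indicator measurableSet_Icc]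
          simp only [integral_const, measureReal_restrict_apply_univ, smul_eq_mul]
          rw [Real.volume_real_Icc_of_le (by linarith)]; ring
  have comp : ∀ x, volume.real M - mu θ M x = ∫ y in Ioi x, mg Φ M y := by
    intro x
    have := intervalIntegral.integral_Iic_add_Ioi (b := x) hi.integrableOn hi.integrableOn
    rw [mg_integral h hM, mg_mu h hM] at this
    linarith
  have pw : ∀ x ∈ Ioo s s', μ0 / (2 * R) ≤ mg Φ M x := by
    intro x hx
    rw [div_le_iff₀ (by positivity), mul_comm]
    by_cases hl : ∀ y < x, mg Φ M y ≤ mg Φ M x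
    · refine (min_le_left _ _).trans ((mu_mono hM hx.1.le).trans ?_)
      rw [← mg_mu h hM, integral_Iic_eq_integral_Iio]
      exact bd _ measurableSet_Iio _ (mg_nonneg _ _) hl
    · push Not at hl
      obtain ⟨y, hy, hfy⟩ := hl
      refine (min_le_right _ _).trans ((sub_le_sub_left (mu_mono hM hx.2.le) _).trans ?_)
      rw [comp]
      refine bd _ measurableSet_Ioi _ (mg_nonneg _ _) ?_
      intro z hz
      by_contra hc
      push Not at hc
      rcases min_le_iff.1 (quasi y x z hy hz) with h' | h' <;> linarith
  have : (s' - s) * (μ0 / (2 * R)) ≤ mu θ M s' - mu θ M s := by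
    rw [← mg_mu h hM, ← mg_mu h hM, intervalIntegral.integral_Iic_sub_Iic hi.integrableOn hi.integrableOn]
    calc (s' - s) * (μ0 / (2 * R)) = ∫ x in s..s', (μ0 / (2 * R)) := by
          rw [intervalIntegral.integral_const, smul_eq_mul]
      _ ≤ _ := by
        rw [intervalIntegral.integral_of_le hs, intervalIntegral.integral_of_le hs,
          integral_Ioc_eq_integral_Ioo, integral_Ioc_eq_integral_Ioo]
        exact setIntegral_mono_on (by simp) hi.integrableOn measurableSet_Ioo pw
  rw [← mul_div_assoc, div_le_iff₀ (by positivity)] at this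
  linarith

lemma mu_ivt (hθ : ‖θ‖ = 1) {M : Set (E m)} {R : ℝ} (hM : IsCompact M)
    (hR0 : 0 < R) (hR : M ⊆ Metric.closedBall 0 R) {c : ℝ} (h0 : 0 ≤ c) (h1 : c ≤ volume.real M) :
    ∃ s, mu θ M s = c := by
  have hin : ∀ x ∈ M, |inner ℝ θ x| ≤ R := by
    intro x hx
    have := abs_real_inner_le_norm θ x
    rw [hθ, one_mul] at this
    exact this.trans (by simpa using hR hx)
  have e1 : mu θ M (-R - 1) = 0 := by
    have : M ∩ {x | inner ℝ θ x ≤ -R - 1} = ∅ := by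
      ext x
      simp only [mem_inter_iff, mem_ofPred_eq, mem_empty_iff_false, iff_false, not_and, not_le]
      intro hx
      linarith [(abs_le.1 (hin x hx)).1]
    simp [mu, this]
  have e2 : mu θ M R = volume.real M := by
    have : M ∩ {x | inner ℝ θ x ≤ R} = M := by
      refine inter_eq_left.2 fun x hx => (abs_le.1 (hin x hx)).2
    rw [mu, this]
  have hc : Continuous (mu θ M) := by
    have : LipschitzWith (Real.toNNReal ((2 * R) ^ m)) (mu θ M) := by
      refine LipschitzWith.of_dist_le_mul fun x y => ?_
      rw [Real.coe_toNNReal _ (by positivity), Real.dist_eq, Real.dist_eq]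
      rcases le_total x y with hxy | hxy
      · rw [abs_sub_comm, abs_of_nonneg (sub_nonneg.2 (mu_mono hM hxy)), abs_sub_comm,
          abs_of_nonneg (sub_nonneg.2 hxy)]
        exact mu_lip hθ hM hR0 hR hxy
      · rw [abs_of_nonneg (sub_nonneg.2 (mu_mono hM hxy)), abs_of_nonneg (sub_nonneg.2 hxy)]
        exact mu_lip hθ hM hR0 hR hxy
    exact this.continuous
  have := intermediate_value_Icc (by linarith : -R - 1 ≤ R) hc.continuousOn
  rw [e1, e2] at this
  obtain ⟨s, -, hs⟩ := this ⟨h0, h1⟩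
  exact ⟨s, hs⟩

end St8

open MeasureTheory Set Pointwise
set_option linter.unusedSectionVars false
namespace St8

lemma gm_low {a b Λ : ℝ} (hΛ : 0 < Λ) (ha : 1 / Λ ≤ a) (hb : 0 ≤ b) :
    (a + b) / 2 - √(a * b) ≤ Λ * (a - b) ^ 2 := by
  have a0 : 0 < a := lt_of_lt_of_le (by positivity) ha
  have h1 := Real.sq_sqrt a0.le
  have h2 := Real.sq_sqrt hb
  rw [Real.sqrt_mul a0.le]
  set x := √a
  set y := √b
  have hy : 0 ≤ y := Real.sqrt_nonneg _
  have hx : 0 ≤ x := Real.sqrt_nonneg _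
  rw [← h1, ← h2]
  have h3 : 1 ≤ Λ * x ^ 2 := by rw [h1]; rw [div_le_iff₀ hΛ] at ha; linarith
  have h4 : (x ^ 2 - y ^ 2) ^ 2 = (x - y) ^ 2 * (x + y) ^ 2 := by ring
  rw [h4]
  have h5 : 1 ≤ Λ * (x + y) ^ 2 := by
    refine h3.trans ?_
    gcongr
    linarith
  nlinarith [sq_nonneg (x - y)]

section
variable {m : ℕ} {θ : E m}

/-- Lemma T in polynomial form -/
lemma lemT2 (hθ : ‖θ‖ = 1) {M N : Set (E m)} {Λ η : ℝ} (hM : IsCompact M) (hN : IsCompact N)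
    (cM : Convex ℝ M) (cN : Convex ℝ N) (hΛ : 2 ≤ Λ)
    (hMR : M ⊆ Metric.closedBall 0 Λ) (hNR : N ⊆ Metric.closedBall 0 Λ)
    (vM : 1 / Λ ≤ volume.real M) (vN : 1 / Λ ≤ volume.real N) (hη : 0 < η)
    (hd : |volume.real M - volume.real N| ≤ η)
    (hV : volume.real (mid M N) ≤ (volume.real M + volume.real N) / 2 + η ^ 2)
    {p s s' : ℝ} (hp : 1 / Λ ≤ p) (hp1 : 1 / Λ ≤ 1 - p) (hs : mu θ M s = p * volume.real M)
    (hs' : mu θ N s' = p * volume.real N) :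
    |s' - s - inner ℝ θ (bar N - bar M)| ≤ 54 * Λ ^ 3 * η := by
  have Λ0 : 0 < Λ := by linarith
  have i0 : 0 < 1 / Λ := by positivity
  have h1 := gm_low Λ0 vM (b := volume.real N) measureReal_nonneg
  have h2 : (volume.real M - volume.real N) ^ 2 ≤ η ^ 2 := by
    rw [← sq_abs]; gcongr
  have h3 : 1 / Λ ≤ √(volume.real M * volume.real N) := by
    apply Real.le_sqrt_of_sq_le
    rw [sq]
    exact mul_le_mul vM vN i0.le (i0.le.trans vM)
  have h4 : volume.real (mid M N) ≤ √(volume.real M * volume.real N) * (1 + (2 * Λ * η) ^ 2) := by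
    have : Λ * η ^ 2 + η ^ 2 ≤ 1 / Λ * (2 * Λ * η) ^ 2 := by
      have : 1 / Λ * (2 * Λ * η) ^ 2 = 4 * Λ * η ^ 2 := by field_simp; ring
      rw [this]; nlinarith [sq_nonneg η]
    have h5 : 1 / Λ * (2 * Λ * η) ^ 2 ≤ √(volume.real M * volume.real N) * (2 * Λ * η) ^ 2 := by
      gcongr
    have h6 : Λ * (volume.real M - volume.real N) ^ 2 ≤ Λ * η ^ 2 := by gcongr
    linarith
  have key := lemT hθ hM hN cM cN Λ0 hMR hNR (i0.trans_le vM) (i0.trans_le vN)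
    (by positivity) h4 (p := p) ⟨i0.trans_le hp, by linarith⟩ hs hs'
  rw [Real.sqrt_sq (by positivity)] at key
  have h7 : 1 / Λ * |s' - s - inner ℝ θ (bar N - bar M)| ≤ 27 * Λ * (2 * Λ * η) :=
    (mul_le_mul_of_nonneg_right (le_min hp hp1) (abs_nonneg _)).trans key
  rw [one_div, inv_mul_le_iff₀ Λ0] at h7
  linarith [show Λ * (27 * Λ * (2 * Λ * η)) = 54 * Λ ^ 3 * η by ring]

/-- the half of `M` below the hyperplane -/
lemma hyper_null (hθ : ‖θ‖ = 1) (s : ℝ) : volume {x : E m | inner ℝ θ x = s} = 0 := by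
  obtain ⟨Φ, h⟩ := exists_coord hθ
  have : {x : E m | inner ℝ θ x = s} = Φ ⁻¹' ({s} ×ˢ univ) := by
    ext x; simp [← h.fst]
  rw [this, h.mp.measure_preimage_emb Φ.toHomeomorph.measurableEmbedding, Measure.volume_eq_prod,
    Measure.prod_prod]
  simp

lemma half_meas (s : ℝ) : MeasurableSet {x : E m | inner ℝ θ x ≤ s} :=
  (isClosed_le (by fun_prop) continuous_const).measurableSet

lemma mu_split (hθ : ‖θ‖ = 1) {M : Set (E m)} (hM : IsCompact M) (s : ℝ) :
    mu θ M s + mu (-θ) M (-s) = volume.real M := by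
  have hf := hM.measure_lt_top (μ := volume) |>.ne
  have h1 := measureReal_inter_add_sdiff (μ := volume) (s := M) (half_meas (θ := θ) s) hf
  have h2 : mu (-θ) M (-s) = volume.real (M \ {x | inner ℝ θ x ≤ s}) := by
    unfold mu
    apply measureReal_congr
    have : ∀ᵐ x : E m, inner ℝ θ x ≠ s := by
      rw [ae_iff]; simpa using hyper_null hθ s
    filter_upwards [this] with x hx
    apply propext
    show (x ∈ M ∧ inner ℝ (-θ) x ≤ -s) ↔ (x ∈ M ∧ ¬ inner ℝ θ x ≤ s)
    rw [inner_neg_left, neg_le_neg_iff, not_le]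
    constructor
    · rintro ⟨a, b⟩; exact ⟨a, lt_of_le_of_ne b (Ne.symm hx)⟩
    · rintro ⟨a, b⟩; exact ⟨a, b.le⟩
  rw [h2]; exact h1

lemma ball_half {M : Set (E m)} (hM : IsCompact M) {x : E m} {ρ s : ℝ} (hb : Metric.closedBall x ρ ⊆ M)
    (hθ : ‖θ‖ = 1) (h : inner ℝ θ x + ρ ≤ s) : volume.real (Metric.closedBall x ρ) ≤ mu θ M s := by
  refine measureReal_mono (subset_inter hb ?_) (half_compact hM _ _).measure_lt_top.ne
  intro y hy
  have h1 : inner ℝ θ (y - x) ≤ ρ := by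
    have := real_inner_le_norm θ (y - x)
    rw [hθ, one_mul, ← dist_eq_norm] at this
    exact this.trans hy
  rw [inner_sub_right] at h1
  show inner ℝ θ y ≤ s
  linarith

/-- Comparison of distribution functions -/
lemma cdf (hθ : ‖θ‖ = 1) {M N : Set (E m)} {Λ η : ℝ} (hM : IsCompact M) (hN : IsCompact N)
    (cM : Convex ℝ M) (cN : Convex ℝ N) (hΛ : 2 ≤ Λ)
    (hMR : M ⊆ Metric.closedBall 0 Λ) (hNR : N ⊆ Metric.closedBall 0 Λ)
    (vN : 1 / Λ ≤ volume.real N) (hη : 0 < η)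
    (hd : |volume.real M - volume.real N| ≤ η)
    (hV : volume.real (mid M N) ≤ (volume.real M + volume.real N) / 2 + η ^ 2)
    (hb : ‖bar M - bar N‖ ≤ η) (hML : volume.real M ≤ Λ)
    {s : ℝ} (h1 : 1 / Λ ≤ mu θ M s) (h2 : 1 / Λ ≤ volume.real M - mu θ M s) :
    |mu θ M s - mu θ N s| ≤ Λ ^ (2 * m + 13) * η := by
  have Λ0 : 0 < Λ := by linarith
  have i0 : 0 < 1 / Λ := by positivity
  have vM : 1 / Λ ≤ volume.real M := by linarith
  have vM0 := i0.trans_le vM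
  have LL : Λ ≤ Λ ^ 2 := by nlinarith
  have hsub : Metric.closedBall (0 : E m) Λ ⊆ Metric.closedBall 0 (Λ ^ 2) :=
    Metric.closedBall_subset_closedBall LL
  have iL : 1 / Λ ^ 2 ≤ 1 / Λ := by gcongr
  set p := mu θ M s / volume.real M with hp
  have hpm : mu θ M s = p * volume.real M := by rw [hp]; field_simp
  have q1 : 1 / Λ ^ 2 ≤ p := by
    rw [hp, div_le_div_iff₀ (by positivity) vM0]
    have : 1 ≤ mu θ M s * Λ := by rwa [div_le_iff₀ Λ0] at h1
    nlinarith
  have q2 : 1 / Λ ^ 2 ≤ 1 - p := by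
    have : 1 - p = (volume.real M - mu θ M s) / volume.real M := by rw [hp]; field_simp
    rw [this, div_le_div_iff₀ (by positivity) vM0]
    have : 1 ≤ (volume.real M - mu θ M s) * Λ := by rwa [div_le_iff₀ Λ0] at h2
    nlinarith
  have p0 : 0 < p := lt_of_lt_of_le (by positivity) q1
  have p1 : p < 1 := by
    have : 0 < 1 / Λ ^ 2 := by positivity
    linarith
  obtain ⟨s', hs'⟩ := mu_ivt hθ hN Λ0 hNR (c := p * volume.real N) (by positivity)
    (by nlinarith [measureReal_nonneg (μ := volume) (s := N)])
  have T := lemT2 hθ hM hN cM cN (by linarith) (hMR.trans hsub) (hNR.trans hsub) (iL.trans vM)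
    (iL.trans vN) hη hd hV q1 q2 hpm hs'
  have hi : |inner ℝ θ (bar N - bar M)| ≤ η := by
    have := abs_real_inner_le_norm θ (bar N - bar M)
    rw [hθ, one_mul, norm_sub_rev] at this
    exact this.trans hb
  have hss : |s' - s| ≤ Λ ^ 12 * η := by
    have e : s' - s = (s' - s - inner ℝ θ (bar N - bar M)) + inner ℝ θ (bar N - bar M) := by ring
    rw [e]
    refine (abs_add_le _ _).trans ((add_le_add T hi).trans ?_)
    have h64 : (64:ℝ) ≤ Λ ^ 6 := by
      calc (64:ℝ) = 2 ^ 6 := by norm_num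
        _ ≤ _ := by gcongr
    have : 54 * (Λ ^ 2) ^ 3 + 1 ≤ Λ ^ 12 := by nlinarith
    nlinarith
  have hl : |mu θ N s' - mu θ N s| ≤ (2 * Λ) ^ m * |s' - s| := by
    rcases le_total s s' with h | h
    · rw [abs_of_nonneg (sub_nonneg.2 h), abs_of_nonneg (sub_nonneg.2 (mu_mono hN h))]
      exact mu_lip hθ hN Λ0 hNR h
    · rw [abs_sub_comm, abs_sub_comm s', abs_of_nonneg (sub_nonneg.2 h), abs_of_nonneg (sub_nonneg.2 (mu_mono hN h))]
      exact mu_lip hθ hN Λ0 hNR h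
  have hm : |mu θ M s - mu θ N s'| ≤ η := by
    rw [hpm, hs', ← mul_sub, abs_mul, abs_of_pos p0]
    nlinarith [abs_nonneg (volume.real M - volume.real N)]
  have h2m : (2 * Λ) ^ m ≤ Λ ^ (2 * m) := by
    rw [pow_mul]; gcongr; nlinarith
  have hpos : 1 ≤ Λ ^ (2 * m + 12) := one_le_pow₀ (by linarith)
  calc |mu θ M s - mu θ N s| ≤ |mu θ M s - mu θ N s'| + |mu θ N s' - mu θ N s| := abs_sub_le _ _ _
    _ ≤ η + Λ ^ (2 * m) * (Λ ^ 12 * η) := by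
        refine add_le_add hm (hl.trans ?_)
        gcongr
    _ = (1 + Λ ^ (2 * m + 12)) * η := by ring
    _ ≤ (Λ * Λ ^ (2 * m + 12)) * η := by gcongr; nlinarith
    _ = _ := by ring

end
end St8

open MeasureTheory Set Pointwise
set_option linter.unusedSectionVars false
namespace St8

/-- two convex bodies almost saturating Brunn-Minkowski -/
structure Good {m : ℕ} (Λ η : ℝ) (M N : Set (E m)) : Prop where
  hM : IsCompact M
  hN : IsCompact N
  cM : Convex ℝ M
  cN : Convex ℝ N
  bM : M ⊆ Metric.closedBall 0 Λ
  bN : N ⊆ Metric.closedBall 0 Λ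
  dV : |volume.real M - volume.real N| ≤ η
  def' : volume.real (mid M N) ≤ (volume.real M + volume.real N) / 2 + η ^ 2
  hb : ‖bar M - bar N‖ ≤ η

variable {m : ℕ}

lemma Good.mono {Λ Λ' η η' : ℝ} {M N : Set (E m)} (h : Good Λ η M N) (hL : Λ ≤ Λ') (h0 : 0 ≤ η)
    (he : η ≤ η') : Good Λ' η' M N :=
  ⟨h.hM, h.hN, h.cM, h.cN, h.bM.trans (Metric.closedBall_subset_closedBall hL),
    h.bN.trans (Metric.closedBall_subset_closedBall hL), h.dV.trans he,
    h.def'.trans (by gcongr), h.hb.trans he⟩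

lemma mu_sub_half {θ θ' : E m} {M : Set (E m)} {s s0 : ℝ} 
    (h : ∀ x ∈ M, inner ℝ θ' x ≤ s → inner ℝ θ x ≤ s0) :
    mu θ' (M ∩ {x | inner ℝ θ x ≤ s0}) s = mu θ' M s := by
  unfold mu
  congr 1
  ext x
  constructor
  · rintro ⟨⟨a, _⟩, b⟩; exact ⟨a, b⟩
  · rintro ⟨a, b⟩; exact ⟨⟨a, h x a b⟩, b⟩

lemma aux_p {x v Λ : ℝ} (hΛ : 0 < Λ) (hx : 1 ≤ x * Λ) (hv : v ≤ Λ) : 1 * v ≤ x * Λ ^ 2 := by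
  have := mul_le_mul_of_nonneg_right hx hΛ.le
  linarith [show x * Λ ^ 2 = x * Λ * Λ by ring]

lemma aux_q {a b c d e f : ℝ} (h1 : a * b ≤ c * d) (h2 : e ≤ b) (ha : 0 ≤ a) (hd : d ≤ f) (hc : 0 ≤ c) :
    a * e ≤ c * f :=
  (mul_le_mul_of_nonneg_left h2 ha).trans (h1.trans (mul_le_mul_of_nonneg_left hd hc))

set_option maxHeartbeats 1600000 in
/-- directional estimate for the barycenters of the halves -/
lemma cut_dir {θ θ' : E m} (hθ : ‖θ‖ = 1) (hθ' : ‖θ'‖ = 1) {M N : Set (E m)} {Λ η η1 σ : ℝ}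
    (G : Good Λ η M N) (hΛ : 2 ≤ Λ) (hη : 0 < η) (hη1 : η1 = Λ ^ (2 * m + 13) * η)
    (hsm : η1 ≤ 1 / (4 * Λ)) {x0 : E m} (hx0 : Metric.closedBall x0 σ ⊆ M) (hσ : 1 / Λ ≤ σ)
    (hball : ∀ x : E m, 1 / Λ ≤ volume.real (Metric.closedBall x (σ / 32)))
    (vM : volume.real M ≤ Λ) (vN : 1 / Λ ≤ volume.real N)
    (hcl : ‖θ' - θ‖ ≤ 1 / (16 * Λ ^ 2))
    {M1 N1 : Set (E m)} (hM1 : M1 = M ∩ {x | inner ℝ θ x ≤ inner ℝ θ x0})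
    (hN1 : N1 = N ∩ {x | inner ℝ θ x ≤ inner ℝ θ x0})
    (hd1 : |volume.real M1 - volume.real N1| ≤ η1)
    (hV1 : volume.real (mid M1 N1) ≤ (volume.real M1 + volume.real N1) / 2 + (Λ ^ 2 * η1) ^ 2) :
    |inner ℝ θ' (bar N1 - bar M1)| ≤ Λ ^ 12 * (Λ ^ 2 * η1) := by
  have Λ0 : 0 < Λ := by linarith
  have σ0 : 0 < σ := lt_of_lt_of_le (by positivity) hσ
  have i0 : 0 < 1 / Λ := by positivity
  set s0 := inner ℝ θ x0 with hs0
  set s := s0 - σ / 4 with hs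
  have LL : Λ ≤ Λ ^ 2 := by nlinarith
  have iL : 1 / Λ ^ 2 ≤ 1 / Λ := by gcongr
  have η10 : 0 < η1 := by rw [hη1]; positivity
  have x0M : x0 ∈ M := hx0 (Metric.mem_closedBall_self σ0.le)
  have diff : ∀ x : E m, ‖x‖ ≤ Λ → |inner ℝ θ' x - inner ℝ θ x| ≤ σ / 16 := by
    intro x hx
    rw [← inner_sub_left]
    refine (abs_real_inner_le_norm _ _).trans ?_
    calc ‖θ' - θ‖ * ‖x‖ ≤ 1 / (16 * Λ ^ 2) * Λ := by gcongr
      _ = (1 / Λ) / 16 := by field_simp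
      _ ≤ _ := by gcongr
  have inB : ∀ {x}, x ∈ Metric.closedBall (0 : E m) Λ → ‖x‖ ≤ Λ := by intro x hx; simpa using hx
  have d0 := abs_le.1 (diff x0 (inB (G.bM x0M)))
  have hHM : ∀ x ∈ Metric.closedBall (0 : E m) Λ, inner ℝ θ' x ≤ s → inner ℝ θ x ≤ s0 := by
    intro x hx h
    have := abs_le.1 (diff x (inB hx))
    rw [hs] at h
    linarith
  have eM : mu θ' M1 s = mu θ' M s := by rw [hM1]; exact mu_sub_half fun x hx => hHM x (G.bM hx)
  have eN : mu θ' N1 s = mu θ' N s := by rw [hN1]; exact mu_sub_half fun x hx => hHM x (G.bN hx)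
  have kM1 : IsCompact M1 := by rw [hM1]; exact half_compact G.hM _ _
  have kN1 : IsCompact N1 := by rw [hN1]; exact half_compact G.hN _ _
  have cM1 : Convex ℝ M1 := by rw [hM1]; exact half_convex G.cM _ _
  have cN1 : Convex ℝ N1 := by rw [hN1]; exact half_convex G.cN _ _
  have subM : M1 ⊆ M := by rw [hM1]; exact inter_subset_left
  have subN : N1 ⊆ N := by rw [hN1]; exact inter_subset_left
  have vM1 : volume.real M1 ≤ volume.real M := measureReal_mono subM G.hM.measure_lt_top.ne
  have sub : ∀ (w : E m) (ρ : ℝ), ‖w‖ + ρ ≤ σ → Metric.closedBall (x0 + w) ρ ⊆ M := by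
    intro w ρ h
    refine (Metric.closedBall_subset_closedBall' ?_).trans hx0
    rw [dist_eq_norm, add_sub_cancel_left]; linarith
  have q1 : 1 / Λ ≤ mu θ' M1 s := by
    rw [eM]
    refine (hball (x0 + (-(3 * σ / 4)) • θ')).trans (ball_half G.hM (sub _ _ ?_) hθ' ?_)
    · rw [norm_smul, hθ', Real.norm_eq_abs, abs_neg, abs_of_pos (by positivity)]; linarith
    · rw [inner_add_right, real_inner_smul_right, real_inner_self_eq_norm_sq, hθ', hs]
      linarith
  have q2 : 1 / Λ ≤ volume.real M1 - mu θ' M1 s := by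
    have hs2 := mu_split hθ' kM1 s
    have : 1 / Λ ≤ mu (-θ') M1 (-s) := by
      refine (hball (x0 + (-(σ / 32)) • θ)).trans (ball_half kM1 ?_ (by rwa [norm_neg]) ?_)
      · rw [hM1]
        refine subset_inter (sub _ _ ?_) ?_
        · rw [norm_smul, hθ, Real.norm_eq_abs, abs_neg, abs_of_pos (by positivity)]; linarith
        · intro y hy
          have h1 : inner ℝ θ (y - (x0 + (-(σ / 32)) • θ)) ≤ σ / 32 := by
            have := real_inner_le_norm θ (y - (x0 + (-(σ / 32)) • θ))
            rw [hθ, one_mul, ← dist_eq_norm] at this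
            exact this.trans hy
          rw [inner_sub_right, inner_add_right, real_inner_smul_right, real_inner_self_eq_norm_sq, hθ] at h1
          show inner ℝ θ y ≤ s0
          linarith
      · rw [inner_neg_left, inner_add_right, real_inner_smul_right, hs]
        have : inner ℝ θ' θ ≤ 1 := by
          have := real_inner_le_norm θ' θ
          rwa [hθ, hθ', one_mul] at this
        nlinarith
    linarith
  have q3 : |mu θ' M1 s - mu θ' N1 s| ≤ η1 := by
    rw [eM, eN, hη1]
    exact cdf hθ' G.hM G.hN G.cM G.cN hΛ G.bM G.bN vN hη G.dV G.def' G.hb vM (by rwa [← eM])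
      (by rw [← eM]; linarith)
  have b3 := abs_le.1 q3
  have b1 := abs_le.1 hd1
  have m1 : 1 / Λ ≤ volume.real M1 := by linarith
  have m10 : 0 < volume.real M1 := by linarith
  have hsm' : η1 ≤ 1 / Λ / 4 := by rw [div_div, mul_comm]; exact hsm
  set p := mu θ' M1 s / volume.real M1 with hp
  have hpm : mu θ' M1 s = p * volume.real M1 := by rw [hp]; field_simp
  have p1 : 1 / Λ ^ 2 ≤ p := by
    rw [hp, div_le_div_iff₀ (by positivity) m10]
    have : 1 ≤ mu θ' M1 s * Λ := by rwa [div_le_iff₀ Λ0] at q1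
    exact aux_p Λ0 this (vM1.trans vM)
  have p2 : 1 / Λ ^ 2 ≤ 1 - p := by
    have : 1 - p = (volume.real M1 - mu θ' M1 s) / volume.real M1 := by rw [hp]; field_simp
    rw [this, div_le_div_iff₀ (by positivity) m10]
    have : 1 ≤ (volume.real M1 - mu θ' M1 s) * Λ := by rwa [div_le_iff₀ Λ0] at q2
    exact aux_p Λ0 this (vM1.trans vM)
  have i2 : 0 < 1 / Λ ^ 2 := by positivity
  have hpn1 : |p * volume.real N1 - mu θ' M1 s| ≤ η1 := by
    rw [hpm, ← mul_sub, abs_mul, abs_of_pos (by linarith), abs_sub_comm]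
    exact (mul_le_of_le_one_left (abs_nonneg _) (by linarith)).trans hd1
  have b4 := abs_le.1 hpn1
  have hpn2 : |(1 - p) * volume.real N1 - (1 - p) * volume.real M1| ≤ η1 := by
    rw [← mul_sub, abs_mul, abs_of_pos (by linarith), abs_sub_comm]
    exact (mul_le_of_le_one_left (abs_nonneg _) (by linarith)).trans hd1
  have b5 := abs_le.1 hpn2
  have n1 : 1 / Λ / 2 ≤ volume.real N1 := by linarith
  obtain ⟨s', hs'⟩ := mu_ivt hθ' kN1 Λ0 (subN.trans G.bN) (c := p * volume.real N1)
    (mul_nonneg (by linarith) measureReal_nonneg)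
    (mul_le_of_le_one_left measureReal_nonneg (by linarith))
  have hss : |s' - s| ≤ 8 * (Λ ^ 2 * η1) := by
    have n0 : 0 < volume.real N1 := by linarith
    have hdd : |mu θ' N1 s' - mu θ' N1 s| ≤ 2 * η1 := by
      rw [hs', abs_le]; constructor <;> linarith
    have bd := abs_le.1 hdd
    have main : |s' - s| * (1 / Λ / 2) ≤ 2 * Λ * (2 * η1) := by
      rcases le_total s s' with h | h
      · have Q := mu_quasi hθ' kN1 cN1 Λ0 (subN.trans G.bN) n0 h
        rw [abs_of_nonneg (sub_nonneg.2 h)]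
        have : 1 / Λ / 2 ≤ min (mu θ' N1 s) (volume.real N1 - mu θ' N1 s') := by
          refine le_min (by linarith) ?_
          rw [hs']; linarith
        exact aux_q Q this (sub_nonneg.2 h) bd.2 (by linarith)
      · have Q := mu_quasi hθ' kN1 cN1 Λ0 (subN.trans G.bN) n0 h
        rw [abs_of_nonpos (sub_nonpos.2 h)]
        have : 1 / Λ / 2 ≤ min (mu θ' N1 s') (volume.real N1 - mu θ' N1 s) := by
          refine le_min ?_ (by linarith)
          rw [hs']; linarith
        rw [neg_sub]
        exact aux_q Q this (sub_nonneg.2 h) (by linarith) (by linarith)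
    have e : |s' - s| = (|s' - s| * (1 / Λ / 2)) * (2 * Λ) := by field_simp
    rw [e]
    calc (|s' - s| * (1 / Λ / 2)) * (2 * Λ) ≤ (2 * Λ * (2 * η1)) * (2 * Λ) := by gcongr
      _ = _ := by ring
  have L4 : 4 ≤ Λ ^ 2 := by
    calc (4:ℝ) = 2 ^ 2 := by norm_num
      _ ≤ _ := by gcongr
  have iL2 : 1 / Λ ^ 2 ≤ 1 / Λ / 2 := by
    rw [div_div, sq]; gcongr
  have hsub : Metric.closedBall (0 : E m) Λ ⊆ Metric.closedBall 0 (Λ ^ 2) :=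
    Metric.closedBall_subset_closedBall LL
  have T := lemT2 hθ' kM1 kN1 cM1 cN1 (Λ := Λ ^ 2) (η := Λ ^ 2 * η1) (by linarith)
    ((subM.trans G.bM).trans hsub) ((subN.trans G.bN).trans hsub) (iL.trans m1) (iL2.trans n1)
    (by positivity) (hd1.trans (le_mul_of_one_le_left η10.le (by linarith))) hV1 p1 p2 hpm hs'
  have e : inner ℝ θ' (bar N1 - bar M1) = (s' - s) - (s' - s - inner ℝ θ' (bar N1 - bar M1)) := by ring
  rw [e]
  refine (abs_sub _ _).trans ((add_le_add hss T).trans ?_)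
  have h64 : (64:ℝ) ≤ Λ ^ 6 := by
    calc (64:ℝ) = 2 ^ 6 := by norm_num
      _ ≤ _ := by gcongr
  have : 8 + 54 * (Λ ^ 2) ^ 3 ≤ Λ ^ 12 := by
    have e1 : (Λ ^ 2) ^ 3 = Λ ^ 6 := by ring
    have e2 : Λ ^ 12 = Λ ^ 6 * Λ ^ 6 := by ring
    rw [e1, e2]
    have := mul_le_mul_of_nonneg_right h64 (show 0 ≤ Λ ^ 6 by positivity)
    linarith
  have := mul_le_mul_of_nonneg_right this (mul_pos (show 0 < Λ ^ 2 by positivity) η10).le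
  linarith

lemma vec_est {θ v : E m} (hθ : ‖θ‖ = 1) {κ c : ℝ} (hκ : 0 < κ) (hκ1 : κ ≤ 1 / 2)
    (h : ∀ θ' : E m, ‖θ'‖ = 1 → ‖θ' - θ‖ ≤ 2 * κ → |inner ℝ θ' v| ≤ c) : κ * ‖v‖ ≤ 3 * c := by
  have hc : |inner ℝ θ v| ≤ c := h θ hθ (by simp; linarith)
  have c0 : 0 ≤ c := (abs_nonneg _).trans hc
  by_cases hv : v = 0
  · simp [hv]; linarith
  have nv : 0 < ‖v‖ := norm_pos_iff.2 hv
  set w := (‖v‖)⁻¹ • v with hw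
  have nw : ‖w‖ = 1 := by rw [hw, norm_smul, norm_inv, norm_norm]; field_simp
  set φ := θ + κ • w with hφ
  have nkw : ‖κ • w‖ = κ := by rw [norm_smul, nw, Real.norm_eq_abs, abs_of_pos hκ, mul_one]
  have n1 : ‖φ‖ ≤ 1 + κ := by
    refine (norm_add_le _ _).trans ?_
    rw [hθ, nkw]
  have n2 : 1 - κ ≤ ‖φ‖ := by
    have := norm_sub_norm_le θ (-(κ • w))
    rw [sub_neg_eq_add, norm_neg, hθ, nkw] at this
    exact this
  have φ0 : 0 < ‖φ‖ := by linarith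
  have := h ((‖φ‖)⁻¹ • φ) (by rw [norm_smul, norm_inv, norm_norm]; field_simp) (by
    have e : (‖φ‖)⁻¹ • φ - θ = ((‖φ‖)⁻¹ - 1) • φ + κ • w := by rw [hφ]; module
    rw [e]
    refine (norm_add_le _ _).trans ?_
    rw [nkw, norm_smul, Real.norm_eq_abs]
    have : |(‖φ‖)⁻¹ - 1| * ‖φ‖ = |1 - ‖φ‖| := by
      nth_rewrite 2 [← abs_of_pos φ0]
      rw [← abs_mul]; congr 1; field_simp
    rw [this]
    have : |1 - ‖φ‖| ≤ κ := abs_le.2 ⟨by linarith, by linarith⟩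
    linarith)
  rw [real_inner_smul_left, abs_mul, abs_of_pos (inv_pos.2 φ0), inv_mul_le_iff₀ φ0] at this
  have e : inner ℝ φ v = inner ℝ θ v + κ * ‖v‖ := by
    rw [hφ, inner_add_left, real_inner_smul_left, hw, real_inner_smul_left, real_inner_self_eq_norm_sq]
    field_simp
  rw [e] at this
  have h1 := (abs_le.1 this).2
  have h2 := (abs_le.1 hc).1
  nlinarith

set_option maxHeartbeats 1000000 in
lemma cut_core {θ : E m} (hθ : ‖θ‖ = 1) {M N : Set (E m)} {Λ η σ : ℝ}
    (G : Good Λ η M N) (hΛ : 2 ≤ Λ) (hη : 0 < η) 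
    (hsm : Λ ^ (2 * m + 13) * η ≤ 1 / (4 * Λ)) {x0 : E m} (hx0 : Metric.closedBall x0 σ ⊆ M) (hσ : 1 / Λ ≤ σ)
    (hball : ∀ x : E m, 1 / Λ ≤ volume.real (Metric.closedBall x (σ / 32)))
    (vM : volume.real M ≤ Λ) :
    Good Λ (Λ ^ (2 * m + 36) * η) (M ∩ {x | inner ℝ θ x ≤ inner ℝ θ x0})
      (N ∩ {x | inner ℝ θ x ≤ inner ℝ θ x0}) := by
  have Λ0 : 0 < Λ := by linarith
  have σ0 : 0 < σ := lt_of_lt_of_le (by positivity) hσ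
  have i0 : 0 < 1 / Λ := by positivity
  set η1 := Λ ^ (2 * m + 13) * η with hη1
  have η10 : 0 < η1 := by positivity
  have ηη1 : η ≤ η1 := by
    have : 1 ≤ Λ ^ (2 * m + 13) := one_le_pow₀ (by linarith)
    nlinarith
  set s0 := inner ℝ θ x0 with hs0
  have hsm' : η1 ≤ 1 / Λ / 4 := by rw [div_div, mul_comm]; exact hsm
  have sub : ∀ (w : E m) (ρ : ℝ), ‖w‖ + ρ ≤ σ → Metric.closedBall (x0 + w) ρ ⊆ M := by
    intro w ρ h
    refine (Metric.closedBall_subset_closedBall' ?_).trans hx0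
    rw [dist_eq_norm, add_sub_cancel_left]; linarith
  have q1 : 1 / Λ ≤ mu θ M s0 := by
    refine (hball (x0 + (-(σ / 2)) • θ)).trans (ball_half G.hM (sub _ _ ?_) hθ ?_)
    · rw [norm_smul, hθ, Real.norm_eq_abs, abs_neg, abs_of_pos (by positivity)]; linarith
    · rw [inner_add_right, real_inner_smul_right, real_inner_self_eq_norm_sq, hθ]
      linarith
  have q2 : 1 / Λ ≤ mu (-θ) M (-s0) := by
    refine (hball (x0 + ((σ / 2)) • θ)).trans (ball_half G.hM (sub _ _ ?_) (by rwa [norm_neg]) ?_)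
    · rw [norm_smul, hθ, Real.norm_eq_abs, abs_of_pos (by positivity)]; linarith
    · rw [inner_neg_left, inner_add_right, real_inner_smul_right, real_inner_self_eq_norm_sq, hθ]
      linarith
  have sM := mu_split hθ G.hM s0
  have sN := mu_split hθ G.hN s0
  have dv := abs_le.1 G.dV
  have vN : 1 / Λ ≤ volume.real N := by linarith
  have c1 : |mu θ M s0 - mu θ N s0| ≤ η1 := 
    cdf hθ G.hM G.hN G.cM G.cN hΛ G.bM G.bN vN hη G.dV G.def' G.hb vM q1 (by linarith)
  have b1 := abs_le.1 c1
  have hV1 : volume.real (mid (M ∩ {x | inner ℝ θ x ≤ s0}) (N ∩ {x | inner ℝ θ x ≤ s0})) ≤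
      (mu θ M s0 + mu θ N s0) / 2 + (Λ ^ 2 * η1) ^ 2 := by
    have hc := mid_compact G.hM G.hN
    have sS := mu_split hθ hc s0
    have half : ∀ (φ : E m) (s : ℝ), mid (M ∩ {x | inner ℝ φ x ≤ s}) (N ∩ {x | inner ℝ φ x ≤ s})
        ⊆ mid M N ∩ {x | inner ℝ φ x ≤ s} := by
      rintro φ s _ ⟨⟨a, b⟩, ⟨⟨ha, ha'⟩, ⟨hb, hb'⟩⟩, rfl⟩
      refine ⟨mem_mid ha hb, ?_⟩
      have h1 : inner ℝ φ a ≤ s := ha'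
      have h2 : inner ℝ φ b ≤ s := hb'
      show inner ℝ φ _ ≤ s
      simp only [inner_add_right, real_inner_smul_right]
      linarith
    have u1 : volume.real (mid (M ∩ {x | inner ℝ θ x ≤ s0}) (N ∩ {x | inner ℝ θ x ≤ s0})) ≤
        mu θ (mid M N) s0 := measureReal_mono (half _ _) (half_compact hc _ _).measure_lt_top.ne
    have u2 : √(mu (-θ) M (-s0) * mu (-θ) N (-s0)) ≤ mu (-θ) (mid M N) (-s0) :=
      (bm_half (half_compact G.hM _ _) (half_compact G.hN _ _)).trans
        (measureReal_mono (half _ _) (half_compact hc _ _).measure_lt_top.ne)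
    have u3 := gm_low Λ0 q2 (mu_nonneg (θ := -θ) N (-s0))
    have u4 : (mu (-θ) M (-s0) - mu (-θ) N (-s0)) ^ 2 ≤ (2 * η1) ^ 2 := by
      apply sq_le_sq.2
      rw [abs_of_pos (show 0 < 2 * η1 by positivity), abs_le]
      constructor <;> linarith
    have u5 : Λ * (mu (-θ) M (-s0) - mu (-θ) N (-s0)) ^ 2 ≤ Λ * (2 * η1) ^ 2 := by gcongr
    have u6 : η ^ 2 ≤ η1 ^ 2 := by gcongr
    have u7 : Λ * (2 * η1) ^ 2 + η1 ^ 2 ≤ (Λ ^ 2 * η1) ^ 2 := by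
      have : 4 * Λ + 1 ≤ Λ ^ 4 := by nlinarith [mul_self_nonneg (Λ - 2), pow_pos Λ0 2, pow_pos Λ0 3]
      nlinarith [sq_nonneg η1]
    have := G.def'
    linarith
  have hbar : 1 / (32 * Λ ^ 2) * ‖bar (N ∩ {x | inner ℝ θ x ≤ s0}) - bar (M ∩ {x | inner ℝ θ x ≤ s0})‖ ≤
      3 * (Λ ^ 12 * (Λ ^ 2 * η1)) := by
    refine vec_est hθ (by positivity) ?_ ?_
    · rw [div_le_div_iff₀ (by positivity) (by norm_num)]; nlinarith
    · intro θ' hθ' hcl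
      refine cut_dir hθ hθ' G hΛ hη hη1 hsm hx0 hσ hball vM vN ?_ rfl rfl c1 hV1
      refine hcl.trans (le_of_eq ?_)
      field_simp; norm_num
  have L2 : Λ ^ 2 * η1 ≤ Λ ^ (2 * m + 36) * η := by
    rw [hη1, ← mul_assoc, ← pow_add]
    exact mul_le_mul_of_nonneg_right (pow_le_pow_right₀ (by linarith) (by omega)) hη.le
  refine ⟨half_compact G.hM _ _, half_compact G.hN _ _, half_convex G.cM _ _, half_convex G.cN _ _,
    inter_subset_left.trans G.bM, inter_subset_left.trans G.bN, ?_, ?_, ?_⟩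
  · refine le_trans c1 (le_trans ?_ L2)
    have : 1 ≤ Λ ^ 2 := one_le_pow₀ (by linarith)
    exact le_mul_of_one_le_left η10.le this
  · refine hV1.trans ?_
    unfold mu
    gcongr
  · rw [norm_sub_rev]
    rw [div_mul_eq_mul_div, one_mul, div_le_iff₀ (by positivity)] at hbar
    refine hbar.trans ?_
    have e : Λ ^ (2 * m + 36) * η = Λ ^ 23 * η1 := by
      rw [hη1, ← mul_assoc, ← pow_add]; congr 2; ring
    rw [e]
    have : 3 * (Λ ^ 12 * (Λ ^ 2 * η1)) * (32 * Λ ^ 2) = 96 * (Λ ^ 16 * η1) := by ring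
    rw [this]
    have h96 : (96:ℝ) ≤ Λ ^ 7 := by
      calc (96:ℝ) ≤ 2 ^ 7 := by norm_num
        _ ≤ _ := by gcongr
    calc 96 * (Λ ^ 16 * η1) ≤ Λ ^ 7 * (Λ ^ 16 * η1) := by gcongr
      _ = _ := by ring

end St8

open MeasureTheory Set Pointwise
set_option linter.unusedSectionVars false
namespace St8

variable {m : ℕ}

lemma exists_pow_le {c : ℝ} : ∃ k : ℕ, ∀ Λ : ℝ, 2 ≤ Λ → c ≤ Λ ^ k := by
  obtain ⟨k, hk⟩ := pow_unbounded_of_one_lt c (show (1:ℝ) < 2 by norm_num)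
  exact ⟨k, fun Λ h => hk.le.trans (by gcongr)⟩

lemma vol_ball (x : E m) {r : ℝ} (hr : 0 ≤ r) : volume.real (Metric.closedBall x r) =
    r ^ (m + 1) * volume.real (Metric.closedBall (0 : E m) 1) := by
  rw [Measure.addHaar_real_closedBall' volume x hr]
  congr 1
  simp

lemma vol_unit_pos : 0 < volume.real (Metric.closedBall (0 : E m) 1) :=
  ENNReal.toReal_pos (Metric.measure_closedBall_pos volume 0 one_pos).ne'
    (isCompact_closedBall _ _).measure_lt_top.ne

lemma vol_consts (m : ℕ) : ∃ k : ℕ, 1 ≤ k ∧ ∀ Λ : ℝ, 2 ≤ Λ →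
    (∀ (x : E m) (r : ℝ), 1 / Λ ≤ r → 1 / Λ ^ k ≤ volume.real (Metric.closedBall x r)) ∧
    volume.real (Metric.closedBall (0 : E m) Λ) ≤ Λ ^ k := by
  set ω := volume.real (Metric.closedBall (0 : E m) 1) with hω
  have ω0 : 0 < ω := vol_unit_pos
  obtain ⟨k1, h1⟩ := exists_pow_le (c := ω)
  obtain ⟨k2, h2⟩ := exists_pow_le (c := ω⁻¹)
  refine ⟨m + 1 + k1 + k2, by omega, fun Λ hΛ => ⟨fun x r hr => ?_, ?_⟩⟩
  · have L0 : 0 < Λ := by linarith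
    have r0 : 0 < r := lt_of_lt_of_le (by positivity) hr
    rw [vol_ball x r0.le]
    calc 1 / Λ ^ (m + 1 + k1 + k2) ≤ 1 / Λ ^ (m + 1 + k2) := by
          apply one_div_le_one_div_of_le (by positivity)
          exact pow_le_pow_right₀ (by linarith) (by omega)
      _ = (1 / Λ) ^ (m + 1) * (1 / Λ ^ k2) := by rw [pow_add, one_div_pow]; field_simp
      _ ≤ r ^ (m + 1) * ω := by
          gcongr
          rw [one_div]
          exact inv_le_of_inv_le₀ ω0 (h2 Λ hΛ)
  · have L0 : 0 < Λ := by linarith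
    rw [vol_ball 0 L0.le]
    calc Λ ^ (m + 1) * ω ≤ Λ ^ (m + 1) * Λ ^ k1 := by gcongr; exact h1 Λ hΛ
      _ = Λ ^ (m + 1 + k1) := by ring
      _ ≤ _ := pow_le_pow_right₀ (by linarith) (by omega)

lemma norm_bar_le {M : Set (E m)} (hM : IsCompact M) {R : ℝ} (hR : 0 ≤ R)
    (h : M ⊆ Metric.closedBall 0 R) : ‖bar M‖ ≤ R := by
  unfold bar
  rw [norm_smul, norm_inv, Real.norm_of_nonneg measureReal_nonneg]
  have := norm_setIntegral_le_of_norm_le_const (μ := volume) (f := fun x : E m => x) (s := M) (C := R)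
    hM.measure_lt_top (fun x hx => by simpa using h hx)
  rcases (measureReal_nonneg (μ := volume) (s := M)).eq_or_lt with h0 | h0
  · rw [← h0]; simpa using hR
  · rw [inv_mul_le_iff₀ h0, mul_comm]; exact this

lemma mid_ball {M N : Set (E m)} {R : ℝ} (h : M ⊆ Metric.closedBall 0 R) (h' : N ⊆ Metric.closedBall 0 R) :
    mid M N ⊆ Metric.closedBall 0 R := by
  rintro _ ⟨⟨a, b⟩, ⟨ha, hb⟩, rfl⟩
  have h1 : ‖a‖ ≤ R := by simpa using h ha
  have h2 : ‖b‖ ≤ R := by simpa using h' hb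
  rw [mem_closedBall_zero_iff]
  refine (norm_add_le _ _).trans ?_
  rw [norm_smul, norm_smul]
  norm_num
  linarith

lemma good_triv {M N : Set (E m)} {Λ D η : ℝ} (hM : IsCompact M) (hN : IsCompact N)
    (cM : Convex ℝ M) (cN : Convex ℝ N) (hΛ : 2 ≤ Λ) (bM : M ⊆ Metric.closedBall 0 Λ)
    (bN : N ⊆ Metric.closedBall 0 Λ) (hD : volume.real (Metric.closedBall (0 : E m) Λ) ≤ D)
    (h1 : D ≤ η) (h2 : 2 * Λ ≤ η) : Good Λ η M N := by
  have fin : volume (Metric.closedBall (0 : E m) Λ) ≠ ⊤ := (isCompact_closedBall _ _).measure_lt_top.ne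
  have v1 : volume.real M ≤ D := (measureReal_mono bM fin).trans hD
  have v2 : volume.real N ≤ D := (measureReal_mono bN fin).trans hD
  have v3 : volume.real (mid M N) ≤ D := (measureReal_mono (mid_ball bM bN) fin).trans hD
  have p1 : 0 ≤ volume.real M := measureReal_nonneg
  have p2 : 0 ≤ volume.real N := measureReal_nonneg
  refine ⟨hM, hN, cM, cN, bM, bN, ?_, ?_, ?_⟩
  · rw [abs_le]; constructor <;> linarith
  · nlinarith
  · refine (norm_sub_le _ _).trans ?_
    have := norm_bar_le hM (by linarith) bM
    have := norm_bar_le hN (by linarith) bN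
    linarith

lemma cut (m : ℕ) : ∃ k : ℕ, ∀ (Λ η : ℝ) (M N : Set (E m)) (x0 θ : E m), 2 ≤ Λ → 0 < η → Good Λ η M N →
    Metric.closedBall x0 (1 / Λ) ⊆ M → ‖θ‖ = 1 →
    Good Λ (Λ ^ k * η) (M ∩ {x | inner ℝ θ x ≤ inner ℝ θ x0})
      (N ∩ {x | inner ℝ θ x ≤ inner ℝ θ x0}) := by
  obtain ⟨k1, k11, hk⟩ := vol_consts m
  refine ⟨6 * k1 * (2 * m + 36), fun Λ η M N x0 θ hΛ hη G hx0 hθ => ?_⟩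
  have L0 : 0 < Λ := by linarith
  set L := Λ ^ (6 * k1) with hL
  have LL : Λ ≤ L := le_self_pow₀ (by linarith) (by omega)
  have L2 : 2 ≤ L := hΛ.trans LL
  have hV : volume.real (Metric.closedBall (0 : E m) Λ) ≤ L :=
    (hk Λ hΛ).2.trans (pow_le_pow_right₀ (by linarith) (by omega))
  have e : Λ ^ (6 * k1 * (2 * m + 36)) = L ^ (2 * m + 36) := by rw [hL, pow_mul]
  rw [e]
  by_cases hs : L ^ (2 * m + 13) * η ≤ 1 / (4 * L)
  · have := cut_core hθ (G.mono LL hη.le le_rfl) L2 hη hs hx0 (by gcongr) ?_ ?_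
    · exact ⟨this.hM, this.hN, this.cM, this.cN, inter_subset_left.trans G.bM,
        inter_subset_left.trans G.bN, this.dV, this.def', this.hb⟩
    · intro x
      have h6 : 2 ≤ Λ ^ 6 := hΛ.trans (le_self_pow₀ (by linarith) (by omega))
      have := (hk (Λ ^ 6) h6).1 x (1 / Λ / 32) (by
        rw [div_div]
        apply one_div_le_one_div_of_le (by positivity)
        have : (32:ℝ) ≤ Λ ^ 5 := by
          calc (32:ℝ) = 2 ^ 5 := by norm_num
            _ ≤ _ := by gcongr
        calc Λ * 32 ≤ Λ * Λ ^ 5 := by gcongr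
          _ = _ := by ring)
      rwa [← pow_mul] at this
    · exact (measureReal_mono G.bM (isCompact_closedBall _ _).measure_lt_top.ne).trans hV
  · push Not at hs
    have big : 2 * L ≤ L ^ (2 * m + 36) * η := by
      have e2 : L ^ (2 * m + 36) * η = L ^ 23 * (L ^ (2 * m + 13) * η) := by
        rw [← mul_assoc, ← pow_add]; congr 2; ring
      have e3 : L ^ 23 * (1 / (4 * L)) = L ^ 22 / 4 := by field_simp
      have e4 : 8 ≤ L ^ 21 := by
        calc (8:ℝ) ≤ 2 ^ 21 := by norm_num
          _ ≤ _ := by gcongr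
      have e5 : L ^ 23 * (1 / (4 * L)) ≤ L ^ 23 * (L ^ (2 * m + 13) * η) := by gcongr
      rw [e3] at e5
      rw [e2]
      refine le_trans ?_ e5
      have : L ^ 22 = L ^ 21 * L := by ring
      rw [this]
      have := mul_le_mul_of_nonneg_right e4 (show 0 ≤ L by linarith)
      linarith
    exact good_triv (half_compact G.hM _ _) (half_compact G.hN _ _) (half_convex G.cM _ _) (half_convex G.cN _ _)
      hΛ (inter_subset_left.trans G.bM) (inter_subset_left.trans G.bN) hV (by linarith) (by linarith)

/-- iterated cuts -/
lemma cuts (m : ℕ) : ∃ k : ℕ, ∀ (ι : Type) (S : Finset ι) (Λ η : ℝ) (M N : Set (E m)) (θ x : ι → E m),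
    2 ≤ Λ → 0 < η → Good Λ η M N →
    (∀ i, ‖θ i‖ = 1) → (∀ i, Metric.closedBall (x i) (1 / Λ) ⊆ M) →
    (∀ i j, i ≠ j → Metric.closedBall (x i) (1 / Λ) ⊆ {y | inner ℝ (θ j) y ≤ inner ℝ (θ j) (x j)}) →
    Good Λ (Λ ^ (k * S.card) * η) (M ∩ {y | ∀ i ∈ S, inner ℝ (θ i) y ≤ inner ℝ (θ i) (x i)})
      (N ∩ {y | ∀ i ∈ S, inner ℝ (θ i) y ≤ inner ℝ (θ i) (x i)}) := by
  classical
  obtain ⟨k, hk⟩ := cut m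
  refine ⟨k, fun ι S Λ η M N θ x hΛ hη G hθ hb hij => ?_⟩
  induction S using Finset.induction_on with
  | empty => simpa using G
  | insert a S ha ih =>
    have e : ∀ X : Set (E m), X ∩ {y | ∀ i ∈ insert a S, inner ℝ (θ i) y ≤ inner ℝ (θ i) (x i)} =
        (X ∩ {y | ∀ i ∈ S, inner ℝ (θ i) y ≤ inner ℝ (θ i) (x i)}) ∩
          {y | inner ℝ (θ a) y ≤ inner ℝ (θ a) (x a)} := by
      intro X
      ext y
      simp only [mem_inter_iff, mem_ofPred_eq, Finset.mem_insert, forall_eq_or_imp]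
      tauto
    rw [e, e, Finset.card_insert_of_notMem ha, mul_add, mul_one, add_comm, pow_add, mul_assoc]
    have L0 : 0 < Λ := by linarith
    refine hk Λ _ _ _ (x a) (θ a) hΛ (by positivity) ih ?_ (hθ a)
    refine subset_inter (hb a) fun y hy i hi => ?_
    exact hij a i (by rintro rfl; exact ha hi) hy

/-- upper prism cell -/
def cell {m : ℕ} (Φ : E m ≃L[ℝ] ℝ × (Fin m → ℝ)) (r : ℝ) : Set (E m) :=
  {x | 0 ≤ (Φ x).1 ∧ ‖(Φ x).2‖ ≤ r}

lemma cells (m : ℕ) : ∃ k : ℕ, ∀ (Λ η r : ℝ) (M N : Set (E m)) (u : E m) (Φ : E m ≃L[ℝ] ℝ × (Fin m → ℝ)),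
    2 ≤ Λ → 0 < η → Good Λ η M N → ‖u‖ = 1 → Coord u Φ → 1 / Λ ≤ r →
    Metric.closedBall 0 (3 * r) ⊆ M →
    Good Λ (Λ ^ k * η) (M ∩ cell Φ r) (N ∩ cell Φ r) := by
  classical
  obtain ⟨k, hk⟩ := cuts m
  refine ⟨k * (Finset.univ : Finset (Option (Fin m × Bool))).card, fun Λ η r M N u Φ hΛ hη G hu hΦ hr hM => ?_⟩
  have L0 : 0 < Λ := by linarith
  have r0 : 0 < r := lt_of_lt_of_le (by positivity) hr
  obtain ⟨e, he1, he⟩ := hΦ.snd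
  let sg : Bool → ℝ := fun b => if b then 1 else -1
  have sg2 : ∀ b, sg b * sg b = 1 := by intro b; cases b <;> simp [sg]
  have sgc : ∀ b, sg b = 1 ∨ sg b = -1 := by intro b; cases b <;> simp [sg]
  let θ : Option (Fin m × Bool) → E m := fun o => o.elim (-u) (fun p => sg p.2 • e p.1)
  let x : Option (Fin m × Bool) → E m := fun o => o.elim 0 (fun p => Φ.symm (r, (r * sg p.2) • Pi.single p.1 1))
  have θn : ∀ y, inner ℝ (θ none) y = -(Φ y).1 := by
    intro y; simp only [θ, Option.elim]; rw [inner_neg_left, hΦ.fst]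
  have θs : ∀ i b y, inner ℝ (θ (some (i, b))) y = sg b * (Φ y).2 i := by
    intro i b y; simp only [θ, Option.elim]; rw [real_inner_smul_left, he]
  have xs1 : ∀ i b, (Φ (x (some (i, b)))).1 = r := by intro i b; simp [x]
  have xs2 : ∀ i b j, (Φ (x (some (i, b)))).2 j = r * sg b * (Pi.single i 1 : Fin m → ℝ) j := by
    intro i b j; simp [x]
  have xn : x none = 0 := rfl
  have lvn : inner ℝ (θ none) (x none) = 0 := by rw [xn, inner_zero_right]
  have lvs : ∀ i b, inner ℝ (θ (some (i, b))) (x (some (i, b))) = r := by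
    intro i b
    rw [θs, xs2]
    simp
    rw [mul_left_comm, sg2, mul_one]
  have key := hk _ Finset.univ Λ η M N θ x hΛ hη G ?_ ?_ ?_
  · have ec : {y : E m | ∀ i ∈ (Finset.univ : Finset (Option (Fin m × Bool))), inner ℝ (θ i) y ≤ inner ℝ (θ i) (x i)} = cell Φ r := by
      ext y
      simp only [mem_ofPred_eq, Finset.mem_univ, true_imp_iff, cell, Option.forall, lvn, θn, Prod.forall, lvs, θs]
      rw [pi_norm_le_iff_of_nonneg r0.le]
      constructor
      · rintro ⟨h1, h2⟩
        refine ⟨by linarith, fun i => ?_⟩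
        have a1 := h2 i true
        have a2 := h2 i false
        simp [sg] at a1 a2
        exact abs_le.2 ⟨by linarith, a1⟩
      · rintro ⟨h1, h2⟩
        refine ⟨by linarith, fun i b => ?_⟩
        have := abs_le.1 (h2 i)
        cases b <;> simp [sg] <;> linarith
    rw [ec] at key
    exact key
  · intro o
    rcases o with _ | ⟨i, b⟩
    · simp only [θ, Option.elim]; rw [norm_neg, hu]
    · simp only [θ, Option.elim]; rw [norm_smul, he1]
      rcases sgc b with h | h <;> simp [h]
  · intro o
    refine (Metric.closedBall_subset_closedBall' ?_).trans hM
    have : ‖x o‖ ≤ 2 * r := by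
      rcases o with _ | ⟨i, b⟩
      · rw [xn, norm_zero]; linarith
      · refine (pow_le_pow_iff_left₀ (norm_nonneg _) (by positivity) two_ne_zero).1 ?_
        rw [hΦ.nrm, xs1]
        simp only [xs2, mul_pow]
        have : ∀ j, (Pi.single i 1 : Fin m → ℝ) j ^ 2 = (Pi.single i 1 : Fin m → ℝ) j := by
          intro j
          by_cases h : j = i
          · subst h; simp
          · simp [Pi.single_eq_of_ne h]
        simp only [this, ← Finset.mul_sum]
        rw [sq (sg b), sg2]
        simp
        nlinarith
    rw [dist_zero_right]
    linarith
  · intro o o' hne y hy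
    have hy' : ‖y - x o‖ ≤ r := by
      rw [← dist_eq_norm]; exact le_trans hy hr
    have f2 : ∀ j, |(Φ y).2 j - (Φ (x o)).2 j| ≤ r := by
      intro j
      have := hΦ.abs_snd_le (y - x o) j
      rw [map_sub] at this
      exact this.trans hy'
    have f1 : |(Φ y).1 - (Φ (x o)).1| ≤ r := by
      rw [hΦ.fst, hΦ.fst, ← inner_sub_right]
      refine (abs_real_inner_le_norm _ _).trans ?_
      rw [hu, one_mul]; exact hy'
    rcases o' with _ | ⟨j, c⟩
    · show inner ℝ (θ none) y ≤ _
      rw [lvn, θn]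
      rcases o with _ | ⟨i, b⟩
      · exact absurd rfl hne
      · rw [xs1] at f1
        have := abs_le.1 f1
        linarith
    · show inner ℝ (θ (some (j, c))) y ≤ _
      rw [lvs, θs]
      have B := abs_le.1 (f2 j)
      have val : sg c * (Φ (x o)).2 j ≤ 0 := by
        rcases o with _ | ⟨i, b⟩
        · rw [xn]; simp
        · rw [xs2]
          by_cases h : j = i
          · subst h
            have : b ≠ c := by rintro rfl; exact hne rfl
            cases b <;> cases c <;> simp [sg] at this ⊢ <;> linarith
          · simp [Pi.single_eq_of_ne h]
      rcases sgc c with h | h <;> rw [h] at val ⊢ <;> linarith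

end St8

open MeasureTheory Set Pointwise
set_option linter.unusedSectionVars false
namespace St8

section an
variable {m : ℕ}

lemma bint {V : Type*} [MeasurableSpace V] {μ : Measure V} {f : V → ℝ} (hf : Measurable f) {C : ℝ} (hC : ∀ z, |f z| ≤ C) {S : Set V}
    (hS : μ S < ⊤) : IntegrableOn f S μ :=
  Measure.integrableOn_of_bounded hS.ne hf.aestronglyMeasurable (M := C)
    (Filter.Eventually.of_forall fun z => hC z)

/-- translation of a set integral -/
lemma shift_le {f : (Fin m → ℝ) → ℝ} (hf : Measurable f) {C : ℝ} (hC : ∀ z, |f z| ≤ C)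
    {S T : Set (Fin m → ℝ)} (_ : MeasurableSet S) (hT : MeasurableSet T) (fT : volume T < ⊤)
    (c : Fin m → ℝ) (h : ∀ z, z + c ∈ S → z ∈ T) (hn : ∀ z ∈ T, 0 ≤ f (z + c)) :
    ∫ z in S, f z ≤ ∫ z in T, f (z + c) := by
  rw [← (measurePreserving_add_right volume c).setIntegral_preimage_emb
    (MeasurableEquiv.addRight c).measurableEmbedding f S]
  refine setIntegral_mono_set (bint (f := fun z => f (z + c)) (hf.comp (measurable_add_const c)) (fun z => hC _) fT) ?_ ?_
  · exact (ae_restrict_iff' hT).2 (Filter.Eventually.of_forall hn)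
  · exact Filter.Eventually.of_forall fun z hz => h z hz

lemma shift_le2 {f : (Fin m → ℝ) → ℝ} (hf : Measurable f) {C : ℝ} (hC : ∀ z, |f z| ≤ C)
    {S T : Set (Fin m → ℝ)} (_ : MeasurableSet S) (hT : MeasurableSet T) (fT : volume T < ⊤)
    (c : Fin m → ℝ) (h : ∀ z ∈ S, z + c ∈ T) (hn : ∀ z, 0 ≤ f z) :
    ∫ z in S, f (z + c) ≤ ∫ z in T, f z := by
  have h2 : ∫ z in T, f z = ∫ z in (· + c) ⁻¹' T, f (z + c) :=
    ((measurePreserving_add_right volume c).setIntegral_preimage_emb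
    (MeasurableEquiv.addRight c).measurableEmbedding f T).symm
  rw [h2]
  have fT' : volume ((· + c) ⁻¹' T) < ⊤ := by
    rw [(measurePreserving_add_right volume c).measure_preimage hT.nullMeasurableSet]; exact fT
  refine setIntegral_mono_set (bint (f := fun z => f (z + c)) (hf.comp (measurable_add_const c)) (fun z => hC _) fT') ?_ ?_
  · exact Filter.Eventually.of_forall fun z => hn _
  · exact Filter.Eventually.of_forall fun z hz => h z hz

variable {r Λ : ℝ}

lemma conc_step {b : (Fin m → ℝ) → ℝ} {Q : Set (Fin m → ℝ)} (hb : ConcaveOn ℝ Q b)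
    (b0 : ∀ z, 0 ≤ b z) (b1 : ∀ z, b z ≤ Λ) {k : ℕ} (hk : 1 ≤ k) {x h : Fin m → ℝ}
    (h1 : x ∈ Q) (h2 : x + (k : ℝ) • h ∈ Q) : b x - b (x + h) ≤ Λ / k := by
  have k0 : (0:ℝ) < k := by exact_mod_cast hk
  have k1 : (1:ℝ) ≤ k := by exact_mod_cast hk
  have := hb.2 h1 h2 (show (0:ℝ) ≤ 1 - 1 / k by
    rw [sub_nonneg, div_le_one k0]; exact k1) (show (0:ℝ) ≤ 1 / k by positivity) (by ring)
  have e : (1 - 1 / (k:ℝ)) • x + (1 / (k:ℝ)) • (x + (k:ℝ) • h) = x + h := by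
    rw [smul_add, smul_smul, one_div_mul_cancel k0.ne']; module
  rw [e] at this
  simp only [smul_eq_mul] at this
  have h3 : 1 / (k:ℝ) * b x ≤ 1 / k * Λ := by gcongr; exact b1 x
  have h4 : 0 ≤ 1 / (k:ℝ) * b (x + (k : ℝ) • h) := mul_nonneg (by positivity) (b0 _)
  have h5 : Λ / k = 1 / k * Λ := by ring
  rw [h5]; linarith

lemma nrm_aux {z h : Fin m → ℝ} {a c : ℝ} {k : ℕ} (hz : ‖z‖ ≤ a) (hw : ‖((2 * k : ℕ) : ℝ) • h‖ ≤ c)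
    {j : ℝ} (hj : |j| ≤ ((2 * k : ℕ) : ℝ)) : ‖z + j • h‖ ≤ a + c := by
  refine (norm_add_le _ _).trans (add_le_add hz (le_trans ?_ hw))
  rw [norm_smul, norm_smul, Real.norm_eq_abs, Real.norm_eq_abs, Nat.abs_cast]
  gcongr

/-- second difference bound for concave functions -/
lemma second_diff (hr : 0 < r) {b : (Fin m → ℝ) → ℝ} (mb : Measurable b)
    (hb : ConcaveOn ℝ (Metric.closedBall 0 r) b)
    (b0 : ∀ z, 0 ≤ b z) (b1 : ∀ z, b z ≤ Λ) {k : ℕ} (hk : 1 ≤ k) {h : Fin m → ℝ}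
    (hw : ‖((2 * k : ℕ) : ℝ) • h‖ ≤ r / 4) :
    ∫ z in Metric.closedBall (0 : Fin m → ℝ) (r / 2), (2 * b z - b (z + h) - b (z - h)) ≤
      2 * Λ * volume.real (Metric.closedBall (0 : Fin m → ℝ) r) / k ^ 2 := by
  have k0 : (0:ℝ) < k := by exact_mod_cast hk
  have k1 : (1:ℝ) ≤ k := by exact_mod_cast hk
  have Λ0 : 0 ≤ Λ := (b0 0).trans (b1 0)
  set D0 := Metric.closedBall (0 : Fin m → ℝ) (3 * r / 4) with hD0
  set D1 := Metric.closedBall (0 : Fin m → ℝ) (r / 2) with hD1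
  set Q := Metric.closedBall (0 : Fin m → ℝ) r with hQ
  set ψ : (Fin m → ℝ) → ℝ := fun z => 2 * b z - b (z + h) - b (z - h) with hψ
  have mψ : Measurable ψ := by
    have h1 : Measurable fun z => b (z + h) := mb.comp (measurable_add_const h)
    have h2 : Measurable fun z => b (z - h) := mb.comp (measurable_sub_const h)
    fun_prop
  have bψ : ∀ z, |ψ z| ≤ 4 * Λ := by
    intro z
    rw [hψ, abs_le]
    have := b0 z; have := b0 (z + h); have := b0 (z - h)
    have := b1 z; have := b1 (z + h); have := b1 (z - h)
    constructor <;> simp only <;> linarith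
  have inQ : ∀ z ∈ D0, ∀ j : ℝ, |j| ≤ ((2 * k : ℕ) : ℝ) → z + j • h ∈ Q := by
    intro z hz j hj
    rw [hQ, mem_closedBall_zero_iff]
    refine (nrm_aux (by simpa [hD0] using hz) hw hj).trans ?_
    linarith
  have fin : ∀ ρ, volume (Metric.closedBall (0 : Fin m → ℝ) ρ) < ⊤ := fun ρ => (isCompact_closedBall _ _).measure_lt_top
  have ψ0 : ∀ z ∈ D0, ∀ j : ℕ, j < k → 0 ≤ ψ (z + (j : ℝ) • h) := by
    intro z hz j hj
    have hj' : (j : ℝ) + 1 ≤ k := by exact_mod_cast hj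
    have j0 : (0:ℝ) ≤ j := by positivity
    have c := hb.2 (inQ z hz (j + 1) (by push_cast; rw [abs_le]; constructor <;> linarith))
      (inQ z hz (j - 1) (by push_cast; rw [abs_le]; constructor <;> linarith))
      (show (0:ℝ) ≤ 1/2 by norm_num) (show (0:ℝ) ≤ 1/2 by norm_num) (by norm_num)
    have e : (1/2:ℝ) • (z + ((j:ℝ) + 1) • h) + (1/2:ℝ) • (z + ((j:ℝ) - 1) • h) = z + (j:ℝ) • h := by module
    rw [e] at c
    simp only [hψ, smul_eq_mul] at c ⊢
    rw [show z + (j:ℝ) • h + h = z + ((j:ℝ) + 1) • h by module,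
      show z + (j:ℝ) • h - h = z + ((j:ℝ) - 1) • h by module]
    linarith
  have tele : ∀ z ∈ D0, ∑ j ∈ Finset.range k, ψ (z + (j : ℝ) • h) ≤ 2 * Λ / k := by
    intro z hz
    have e : ∀ j : ℕ, ψ (z + (j : ℝ) • h) = (b (z + (j:ℝ) • h) - b (z + ((j + 1 : ℕ):ℝ) • h)) +
        (b (z + (((j + 1 : ℕ):ℝ) - 1) • h) - b (z + ((j:ℝ) - 1) • h)) := by
      intro j
      simp only [hψ]
      rw [show z + (j:ℝ) • h + h = z + ((j + 1 : ℕ):ℝ) • h by push_cast; module,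
        show z + (j:ℝ) • h - h = z + ((j:ℝ) - 1) • h by module,
        show (((j + 1 : ℕ):ℝ) - 1) = j by push_cast; ring]
      ring
    simp only [e]
    rw [Finset.sum_add_distrib, Finset.sum_range_sub' (fun j : ℕ => b (z + (j:ℝ) • h)),
      Finset.sum_range_sub (fun j : ℕ => b (z + ((j:ℝ) - 1) • h))]
    have kk : (k:ℝ) ≤ ((2 * k : ℕ) : ℝ) := by push_cast; linarith
    have s1 := conc_step hb b0 b1 hk (x := z) (h := -h) (by simpa using inQ z hz 0 (by simp))
      (by have := inQ z hz (-k) (by rw [abs_neg, Nat.abs_cast]; exact kk)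
          rwa [neg_smul, ← smul_neg] at this)
    have s2 := conc_step hb b0 b1 hk (x := z + ((k:ℝ) - 1) • h) (h := h)
      (inQ z hz (k - 1) (by push_cast; rw [abs_le]; constructor <;> linarith))
      (by have := inQ z hz (2 * k - 1) (by push_cast; rw [abs_le]; constructor <;> linarith)
          convert this using 1; module)
    rw [show z + ((k:ℝ) - 1) • h + h = z + (k:ℝ) • h by module] at s2
    have z1 : z + ((0:ℕ):ℝ) • h = z := by simp
    have z2 : z + (((0:ℕ):ℝ) - 1) • h = z + -h := by simp
    rw [z1, z2]
    have : 2 * Λ / k = Λ / k + Λ / k := by ring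
    rw [this]
    linarith
  have each : ∀ j ∈ Finset.range k, ∫ z in D1, ψ z ≤ ∫ z in D0, ψ (z + (j : ℝ) • h) := by
    intro j hj
    rw [Finset.mem_range] at hj
    refine shift_le mψ bψ measurableSet_closedBall measurableSet_closedBall (fin _) _ ?_ (fun z hz => ψ0 z hz j hj)
    intro z hz
    have h1 : ‖z + (j:ℝ) • h‖ ≤ r / 2 := by simpa [hD1] using hz
    have hj' : (j : ℝ) + 1 ≤ k := by exact_mod_cast hj
    have j0 : (0:ℝ) ≤ j := by positivity
    have := nrm_aux h1 hw (j := -j) (by push_cast; rw [abs_le]; constructor <;> linarith)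
    rw [mem_closedBall_zero_iff]
    rw [neg_smul, add_neg_cancel_right] at this
    linarith
  have is : ∀ j ∈ Finset.range k, IntegrableOn (fun z => ψ (z + (j : ℝ) • h)) D0 := fun j _ =>
    bint (mψ.comp (measurable_add_const _)) (fun z => bψ _) (fin _)
  have tot : (k:ℝ) * ∫ z in D1, ψ z ≤ 2 * Λ / k * volume.real Q := by
    calc (k:ℝ) * ∫ z in D1, ψ z = ∑ j ∈ Finset.range k, ∫ z in D1, ψ z := by simp
      _ ≤ ∑ j ∈ Finset.range k, ∫ z in D0, ψ (z + (j : ℝ) • h) := Finset.sum_le_sum each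
      _ = ∫ z in D0, ∑ j ∈ Finset.range k, ψ (z + (j : ℝ) • h) := (integral_finsetSum _ is).symm
      _ ≤ ∫ z in D0, 2 * Λ / k := by
          refine setIntegral_mono_on (integrable_finsetSum _ is) (integrableOn_const (fin _).ne) measurableSet_closedBall tele
      _ = 2 * Λ / k * volume.real D0 := by rw [setIntegral_const, smul_eq_mul, mul_comm]
      _ ≤ _ := by
          refine mul_le_mul_of_nonneg_left ?_ (by positivity)
          exact measureReal_mono (Metric.closedBall_subset_closedBall (by linarith)) (fin _).ne
  rw [le_div_iff₀ (by positivity)]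
  have e : 2 * Λ / k * volume.real Q * k = 2 * Λ * volume.real Q := by field_simp
  rw [← e]
  calc (∫ z in D1, ψ z) * (k:ℝ) ^ 2 = (k * ∫ z in D1, ψ z) * k := by ring
    _ ≤ _ := by gcongr

end an
end St8

open MeasureTheory Set Pointwise
set_option linter.unusedSectionVars false
namespace St8

section an
variable {m : ℕ} {r Λ η : ℝ}

/-- data of the prism problem -/
structure Pr (r Λ η : ℝ) (b b' g : (Fin m → ℝ) → ℝ) : Prop where
  hr : 0 < r
  mb : Measurable b
  mb' : Measurable b'
  cb : ConcaveOn ℝ (Metric.closedBall 0 r) b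
  cb' : ConcaveOn ℝ (Metric.closedBall 0 r) b'
  b0 : ∀ z, 0 ≤ b z
  b1 : ∀ z, b z ≤ Λ
  b0' : ∀ z, 0 ≤ b' z
  b1' : ∀ z, b' z ≤ Λ
  ig : IntegrableOn g (Metric.closedBall 0 r)
  hg : ∀ z h, z + h ∈ Metric.closedBall (0 : Fin m → ℝ) r → z - h ∈ Metric.closedBall (0 : Fin m → ℝ) r →
    (b (z + h) + b' (z - h)) / 2 ≤ g z
  hV : ∫ z in Metric.closedBall 0 r, g z ≤
    ((∫ z in Metric.closedBall 0 r, b z) + ∫ z in Metric.closedBall 0 r, b' z) / 2 + η ^ 2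

variable {b b' g : (Fin m → ℝ) → ℝ}

lemma finb (ρ : ℝ) : volume (Metric.closedBall (0 : Fin m → ℝ) ρ) < ⊤ := (isCompact_closedBall _ _).measure_lt_top

lemma Pr.diff (P : Pr r Λ η b b' g) {k : ℕ} (hk : 1 ≤ k) {h : Fin m → ℝ}
    (hw : ‖((2 * k : ℕ) : ℝ) • h‖ ≤ r / 4) :
    ∫ z in Metric.closedBall (0 : Fin m → ℝ) (r / 2), |(b' (z + h) - b (z + h)) - (b' (z - h) - b (z - h))| ≤
      4 * η ^ 2 + 4 * Λ * volume.real (Metric.closedBall (0 : Fin m → ℝ) r) / k ^ 2 := by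
  have hr := P.hr
  have s1 := second_diff P.hr P.mb P.cb P.b0 P.b1 hk hw
  have s2 := second_diff P.hr P.mb' P.cb' P.b0' P.b1' hk hw
  set D1 := Metric.closedBall (0 : Fin m → ℝ) (r / 2) with hD1
  set Q := Metric.closedBall (0 : Fin m → ℝ) r with hQ
  have sub : D1 ⊆ Q := Metric.closedBall_subset_closedBall (by linarith)
  have bd : ∀ {f : (Fin m → ℝ) → ℝ}, (∀ z, 0 ≤ f z) → (∀ z, f z ≤ Λ) → ∀ z, |f z| ≤ Λ := by
    intro f h0 h1 z; rw [abs_of_nonneg (h0 z)]; exact h1 z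
  have i1 : ∀ (c : Fin m → ℝ) (S) , volume S < ⊤ → IntegrableOn (fun z => b (z + c)) S := fun c S hS =>
    bint (P.mb.comp (measurable_add_const c)) (fun z => bd P.b0 P.b1 _) hS
  have i2 : ∀ (c : Fin m → ℝ) (S) , volume S < ⊤ → IntegrableOn (fun z => b' (z + c)) S := fun c S hS =>
    bint (P.mb'.comp (measurable_add_const c)) (fun z => bd P.b0' P.b1' _) hS
  have b10 : IntegrableOn b Q := bint P.mb (bd P.b0 P.b1) (finb _)
  have b20 : IntegrableOn b' Q := bint P.mb' (bd P.b0' P.b1') (finb _)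
  have b1p := i1 h D1 (finb _)
  have b1m := i1 (-h) D1 (finb _)
  have b2p := i2 h D1 (finb _)
  have b2m := i2 (-h) D1 (finb _)
  simp only [← sub_eq_add_neg] at b1m b2m
  set A : (Fin m → ℝ) → ℝ := fun z => |(b' (z + h) - b (z + h)) - (b' (z - h) - b (z - h))| with hA
  have iA : IntegrableOn A D1 := ((b2p.sub b1p).sub (b2m.sub b1m)).abs
  set ψ : (Fin m → ℝ) → ℝ := fun z => 2 * b z - b (z + h) - b (z - h)
  set ψ' : (Fin m → ℝ) → ℝ := fun z => 2 * b' z - b' (z + h) - b' (z - h)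
  have iψ : IntegrableOn ψ D1 := (((b10.mono_set sub).const_mul 2).sub b1p).sub b1m
  have iψ' : IntegrableOn ψ' D1 := (((b20.mono_set sub).const_mul 2).sub b2p).sub b2m
  set F : (Fin m → ℝ) → ℝ := fun z => (A z - (ψ z + ψ' z)) / 4
  have iF : IntegrableOn F D1 := (iA.sub (iψ.add iψ')).div_const 4
  have pw : ∀ z ∈ Q, (b z + b' z) / 2 + D1.indicator F z ≤ g z := by
    intro z hz
    by_cases hz1 : z ∈ D1
    · rw [indicator_of_mem hz1]
      have hz' : ‖z‖ ≤ r / 2 := by simpa [hD1] using hz1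
      have k1 : (1:ℝ) ≤ k := by exact_mod_cast hk
      have hp : z + h ∈ Q := by
        have := nrm_aux hz' hw (j := 1) (by rw [abs_one]; push_cast; linarith)
        rw [hQ, mem_closedBall_zero_iff]
        rw [one_smul] at this; linarith
      have hm : z - h ∈ Q := by
        have := nrm_aux hz' hw (j := -1) (by rw [abs_neg, abs_one]; push_cast; linarith)
        rw [hQ, mem_closedBall_zero_iff]
        rw [neg_one_smul, ← sub_eq_add_neg] at this; linarith
      have g1 := P.hg z h hp hm
      have g2 := P.hg z (-h) (by rwa [← sub_eq_add_neg]) (by rwa [sub_neg_eq_add])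
      rw [← sub_eq_add_neg, sub_neg_eq_add] at g2
      have : A z ≤ 4 * g z - (b (z + h) + b (z - h) + b' (z + h) + b' (z - h)) := by
        simp only [hA]
        rw [abs_le]; constructor <;> linarith
      simp only [F, ψ, ψ']
      linarith
    · rw [indicator_of_notMem hz1, add_zero]
      have := P.hg z 0 (by rw [add_zero]; exact hz) (by rw [sub_zero]; exact hz)
      rw [add_zero, sub_zero] at this; exact this
  have isum0 : IntegrableOn (fun z => b z + b' z) Q := b10.add b20
  have isum : IntegrableOn (fun z => (b z + b' z) / 2) Q := isum0.div_const 2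
  have iind : IntegrableOn (fun z => D1.indicator F z) Q := (iF.integrable_indicator measurableSet_closedBall).integrableOn
  have isum2 : IntegrableOn (fun z => (b z + b' z) / 2 + D1.indicator F z) Q := isum.add iind
  have I := setIntegral_mono_on isum2
    P.ig measurableSet_closedBall pw
  have e1 : ∫ z in Q, ((b z + b' z) / 2 + D1.indicator F z) = ((∫ z in Q, b z) + ∫ z in Q, b' z) / 2 + ∫ z in D1, F z := by
    rw [integral_add isum iind,
      integral_div, integral_add b10 b20, setIntegral_indicator measurableSet_closedBall,
      inter_eq_self_of_subset_right sub]
  have e2 : ∫ z in D1, F z = ((∫ z in D1, A z) - ((∫ z in D1, ψ z) + ∫ z in D1, ψ' z)) / 4 := by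
    have iψψ : IntegrableOn (fun z => ψ z + ψ' z) D1 := iψ.add iψ'
    have : ∫ z in D1, F z = ∫ z in D1, (A z - (ψ z + ψ' z)) / 4 := rfl
    rw [this, integral_div, integral_sub iA iψψ, integral_add iψ iψ']
  have I' := (e1.symm.le.trans I).trans P.hV
  rw [e2] at I'
  have : 4 * Λ * volume.real Q / k ^ 2 = 2 * Λ * volume.real Q / k ^ 2 + 2 * Λ * volume.real Q / k ^ 2 := by ring
  rw [this]
  linarith

lemma Pr.shift (P : Pr r Λ η b b' g) (h0 : 0 < η) (h1 : η ≤ 1) {w : Fin m → ℝ} (hw : ‖w‖ ≤ r / 4) :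
    ∫ z in Metric.closedBall (0 : Fin m → ℝ) (r / 8), |(b' (z + w) - b (z + w)) - (b' z - b z)| ≤
      (8 + 4 * Λ * volume.real (Metric.closedBall (0 : Fin m → ℝ) r)) * η := by
  have hr := P.hr
  have Λ0 : 0 ≤ Λ := (P.b0 0).trans (P.b1 0)
  set vQ := volume.real (Metric.closedBall (0 : Fin m → ℝ) r)
  have vQ0 : 0 ≤ vQ := measureReal_nonneg
  set k := ⌈1 / η⌉₊ with hkd
  have kl : 1 / η ≤ k := Nat.le_ceil _
  have ku : (k:ℝ) ≤ 2 / η := by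
    have := (Nat.ceil_lt_add_one (show 0 ≤ 1 / η by positivity)).le
    rw [← hkd] at this
    refine this.trans ?_
    have : 1 ≤ 1 / η := by rw [le_div_iff₀ h0]; linarith
    have e : 2 / η = 1 / η + 1 / η := by ring
    linarith
  have k0 : (0:ℝ) < k := lt_of_lt_of_le (by positivity) kl
  have hk : 1 ≤ k := by exact_mod_cast k0
  set h : Fin m → ℝ := (1 / (2 * k : ℝ)) • w with hh
  have hwk : ((2 * k : ℕ) : ℝ) • h = w := by
    rw [hh, smul_smul]; push_cast
    rw [mul_one_div_cancel (by positivity), one_smul]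
  have D := P.diff hk (h := h) (by rw [hwk]; exact hw)
  set β : (Fin m → ℝ) → ℝ := fun z => b' z - b z with hβ
  have mβ : Measurable β := P.mb'.sub P.mb
  have bβ : ∀ z, |β z| ≤ Λ := by
    intro z; rw [hβ, abs_le]
    have := P.b0 z; have := P.b1 z; have := P.b0' z; have := P.b1' z
    constructor <;> simp only <;> linarith
  set A : (Fin m → ℝ) → ℝ := fun z => |β (z + h) - β (z - h)| with hA
  have mA : Measurable A := by
    have h1 : Measurable fun z => β (z + h) := mβ.comp (measurable_add_const h)
    have h2 : Measurable fun z => β (z - h) := mβ.comp (measurable_sub_const h)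
    have := (h1.sub h2)
    exact this.abs
  have bA : ∀ z, |A z| ≤ 2 * Λ := by
    intro z; simp only [hA]; rw [abs_abs]
    refine (abs_sub _ _).trans ?_
    have := bβ (z + h); have := bβ (z - h); linarith
  have each : ∀ j ∈ Finset.range k, ∫ z in Metric.closedBall (0 : Fin m → ℝ) (r / 8), A (z + (2 * j + 1 : ℝ) • h)
      ≤ ∫ z in Metric.closedBall (0 : Fin m → ℝ) (r / 2), A z := by
    intro j hj
    rw [Finset.mem_range] at hj
    refine shift_le2 mA bA measurableSet_closedBall measurableSet_closedBall (finb _) _ ?_ (fun z => abs_nonneg _)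
    intro z hz
    have hz' : ‖z‖ ≤ r / 8 := by simpa using hz
    have hj' : (j : ℝ) + 1 ≤ k := by exact_mod_cast hj
    have j0 : (0:ℝ) ≤ j := by positivity
    have := nrm_aux hz' (h := h) (k := k) (c := r / 4) (by rw [hwk]; exact hw) (j := 2 * j + 1) (by
      push_cast; rw [abs_le]; constructor <;> linarith)
    rw [mem_closedBall_zero_iff]
    linarith
  have is : ∀ j ∈ Finset.range k, IntegrableOn (fun z => A (z + (2 * j + 1 : ℝ) • h)) (Metric.closedBall (0 : Fin m → ℝ) (r / 8)) := fun j _ =>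
    bint (mA.comp (measurable_add_const _)) (fun z => bA _) (finb _)
  have pw : ∀ z, |β (z + w) - β z| ≤ ∑ j ∈ Finset.range k, A (z + (2 * j + 1 : ℝ) • h) := by
    intro z
    have e1 : β (z + w) - β z = ∑ j ∈ Finset.range k, (β (z + (2 * ((j + 1 : ℕ) : ℝ)) • h) - β (z + (2 * (j : ℝ)) • h)) := by
      rw [Finset.sum_range_sub (fun j : ℕ => β (z + (2 * (j : ℝ)) • h))]
      simp only [Nat.cast_zero, mul_zero, zero_smul, add_zero]
      rw [← hwk]; push_cast; rfl
    rw [e1]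
    refine (Finset.abs_sum_le_sum_abs _ _).trans (le_of_eq ?_)
    refine Finset.sum_congr rfl fun j _ => ?_
    have q1 : z + (2 * (j : ℝ) + 1) • h + h = z + (2 * ((j + 1 : ℕ) : ℝ)) • h := by
      clear_value h; push_cast; module
    have q2 : z + (2 * (j : ℝ) + 1) • h - h = z + (2 * (j : ℝ)) • h := by
      clear_value h; module
    show _ = |β (z + (2 * (j : ℝ) + 1) • h + h) - β (z + (2 * (j : ℝ) + 1) • h - h)|
    rw [q1, q2]
  have iβ : IntegrableOn (fun z => |β (z + w) - β z|) (Metric.closedBall (0 : Fin m → ℝ) (r / 8)) := by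
    have q : Measurable fun z => |β (z + w) - β z| := ((mβ.comp (measurable_add_const w)).sub mβ).abs
    refine bint (C := 2 * Λ) q (fun z => ?_) (finb _)
    rw [abs_abs]
    refine (abs_sub _ _).trans ?_
    have := bβ (z + w); have := bβ z; linarith
  calc ∫ z in Metric.closedBall (0 : Fin m → ℝ) (r / 8), |β (z + w) - β z|
      ≤ ∫ z in Metric.closedBall (0 : Fin m → ℝ) (r / 8), ∑ j ∈ Finset.range k, A (z + (2 * j + 1 : ℝ) • h) :=
        setIntegral_mono iβ (integrable_finsetSum _ is) pw
    _ = ∑ j ∈ Finset.range k, ∫ z in Metric.closedBall (0 : Fin m → ℝ) (r / 8), A (z + (2 * j + 1 : ℝ) • h) :=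
        integral_finsetSum _ is
    _ ≤ ∑ j ∈ Finset.range k, (4 * η ^ 2 + 4 * Λ * vQ / k ^ 2) := Finset.sum_le_sum fun j hj => (each j hj).trans D
    _ = 4 * (k * η) * η + 4 * Λ * vQ * (1 / k) := by simp; field_simp
    _ ≤ 4 * 2 * η + 4 * Λ * vQ * η := by
        gcongr
        · rwa [le_div_iff₀ h0] at ku
        · rw [div_le_iff₀ k0]; rw [div_le_iff₀ h0] at kl; linarith
    _ = _ := by ring

lemma Pr.final (P : Pr r Λ η b b' g) (h0 : 0 < η) (h1 : η ≤ 1)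
    (hD : |∫ z in Metric.closedBall (0 : Fin m → ℝ) (r / 8), (b' z - b z)| ≤ η) :
    ∫ z in Metric.closedBall (0 : Fin m → ℝ) (r / 8), |b' z - b z| ≤
      (2 ^ m * (8 + 4 * Λ * volume.real (Metric.closedBall (0 : Fin m → ℝ) r)) + 1) * η := by
  have hr := P.hr
  have sh := fun w hw => P.shift h0 h1 (w := w) hw
  set C1 := (8 + 4 * Λ * volume.real (Metric.closedBall (0 : Fin m → ℝ) r)) with hC1
  set β : (Fin m → ℝ) → ℝ := fun z => b' z - b z with hβ
  have mβ : Measurable β := P.mb'.sub P.mb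
  have bβ : ∀ z, |β z| ≤ Λ := by
    intro z; rw [hβ, abs_le]
    have := P.b0 z; have := P.b1 z; have := P.b0' z; have := P.b1' z
    constructor <;> simp only <;> linarith
  set D := Metric.closedBall (0 : Fin m → ℝ) (r / 8) with hDd
  set W := Metric.closedBall (0 : Fin m → ℝ) (r / 4) with hW
  have fD : volume D < ⊤ := finb _
  have fW : volume W < ⊤ := finb _
  have vol : ∀ ρ, 0 ≤ ρ → volume.real (Metric.closedBall (0 : Fin m → ℝ) ρ) = (2 * ρ) ^ m := by
    intro ρ hρ
    rw [measureReal_def, Real.volume_pi_closedBall _ hρ, ENNReal.toReal_ofReal (by positivity)]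
    simp
  have vD : volume.real D = (2 * (r / 8)) ^ m := vol _ (by positivity)
  have vW : volume.real W = 2 ^ m * volume.real D := by
    rw [vD, hW, vol _ (by positivity), ← mul_pow]; congr 1; ring
  have vD0 : 0 < volume.real D := by rw [vD]; positivity
  set F : (Fin m → ℝ) → (Fin m → ℝ) → ℝ := fun z w => |β (z + w) - β z| with hF
  have mF : Measurable (Function.uncurry F) := by
    have a1 : Measurable fun p : (Fin m → ℝ) × (Fin m → ℝ) => β (p.1 + p.2) := mβ.comp measurable_add
    have a2 : Measurable fun p : (Fin m → ℝ) × (Fin m → ℝ) => β p.1 := mβ.comp measurable_fst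
    exact (a1.sub a2).abs
  have bF : ∀ z w, |F z w| ≤ 2 * Λ := by
    intro z w; simp only [hF]; rw [abs_abs]
    refine (abs_sub _ _).trans ?_
    have := bβ (z + w); have := bβ z; linarith
  have : IsFiniteMeasure (volume.restrict D) := ⟨by simpa using fD⟩
  have : IsFiniteMeasure (volume.restrict W) := ⟨by simpa using fW⟩
  have iF : Integrable (Function.uncurry F) ((volume.restrict D).prod (volume.restrict W)) :=
    Integrable.of_bound mF.aestronglyMeasurable (2 * Λ) (Filter.Eventually.of_forall fun p => bF p.1 p.2)
  have swap := integral_integral_swap iF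
  have iβ : ∀ S : Set (Fin m → ℝ), volume S < ⊤ → IntegrableOn β S := fun S hS => bint mβ bβ hS
  have pw : ∀ z ∈ D, volume.real D * |β z| ≤ (∫ w in W, F z w) + η := by
    intro z hz
    have e1 : volume.real D * β z = (∫ y in D, (β z - β y)) + ∫ y in D, β y := by
      rw [integral_sub (f := fun _ => β z) (integrable_const _) (iβ D fD), setIntegral_const, smul_eq_mul]; ring
    have e2 : |∫ y in D, (β z - β y)| ≤ ∫ w in W, F z w := by
      refine (abs_integral_le_integral_abs).trans ?_
      have e3 : ∀ y, |β z - β y| = F z (y + -z) := by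
        intro y; simp only [hF]; rw [abs_sub_comm]; congr 3; abel
      simp only [e3]
      refine shift_le2 (f := F z) (mF.comp measurable_prodMk_left) (bF z) measurableSet_closedBall measurableSet_closedBall fW
        (-z) ?_ (fun w => abs_nonneg _)
      intro y hy
      have n1 : ‖z‖ ≤ r / 8 := by simpa [hDd] using hz
      have n2 : ‖y‖ ≤ r / 8 := by simpa [hDd] using hy
      rw [mem_closedBall_zero_iff, ← sub_eq_add_neg]
      refine (norm_sub_le _ _).trans (by linarith)
    rw [← abs_of_pos vD0, ← abs_mul, e1]
    exact (abs_add_le _ _).trans (add_le_add e2 hD)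
  have iin : IntegrableOn (fun z => ∫ w in W, F z w) D := iF.integral_prod_left
  have I1 : volume.real D * ∫ z in D, |β z| ≤ (∫ z in D, ∫ w in W, F z w) + volume.real D * η := by
    rw [← integral_const_mul]
    have := setIntegral_mono_on ((iβ D fD).abs.const_mul (volume.real D)) (iin.add (integrableOn_const fD.ne (C := η))) measurableSet_closedBall pw
    refine this.trans (le_of_eq ?_)
    rw [Pi.add_def] 
    rw [integral_add iin (integrableOn_const fD.ne), setIntegral_const, smul_eq_mul]
  have I2 : ∫ z in D, ∫ w in W, F z w ≤ volume.real W * (C1 * η) := by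
    rw [swap]
    have := setIntegral_mono_on (f := fun w => ∫ z in D, F z w) (g := fun _ => C1 * η) iF.integral_prod_right (integrableOn_const fW.ne) measurableSet_closedBall
      (fun w hw => sh w (by simpa [hW] using hw))
    refine this.trans (le_of_eq ?_)
    rw [setIntegral_const, smul_eq_mul]
  rw [vW] at I2
  have : volume.real D * ∫ z in D, |β z| ≤ volume.real D * ((2 ^ m * C1 + 1) * η) := by
    refine I1.trans ((add_le_add_left I2 _).trans (le_of_eq ?_))
    ring
  exact le_of_mul_le_mul_left this vD0

end an
end St8

open MeasureTheory Set Pointwise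
set_option linter.unusedSectionVars false
namespace St8

section fib
variable {m : ℕ}

/-- vertical fibre length -/
noncomputable def fbr (Y : Set (ℝ × (Fin m → ℝ))) (z : Fin m → ℝ) : ℝ :=
  volume.real {s : ℝ | (s, z) ∈ Y}

lemma fib_sub {Y : Set (ℝ × (Fin m → ℝ))} {Λ : ℝ} (hb : ∀ p ∈ Y, |p.1| ≤ Λ) (z : Fin m → ℝ) :
    {s : ℝ | (s, z) ∈ Y} ⊆ Icc (-Λ) Λ := fun s hs => abs_le.1 (hb _ hs)

lemma fib_fin {Y : Set (ℝ × (Fin m → ℝ))} {Λ : ℝ} (hb : ∀ p ∈ Y, |p.1| ≤ Λ) (z : Fin m → ℝ) :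
    volume {s : ℝ | (s, z) ∈ Y} < ⊤ :=
  (measure_mono (fib_sub hb z)).trans_lt isCompact_Icc.measure_lt_top

lemma fbr_nonneg (Y : Set (ℝ × (Fin m → ℝ))) (z : Fin m → ℝ) : 0 ≤ fbr Y z := measureReal_nonneg

lemma fbr_le {Y : Set (ℝ × (Fin m → ℝ))} {Λ : ℝ} (h0 : 0 ≤ Λ) (hb : ∀ p ∈ Y, |p.1| ≤ Λ) (z : Fin m → ℝ) :
    fbr Y z ≤ 2 * Λ := by
  refine (measureReal_mono (fib_sub hb z) isCompact_Icc.measure_lt_top.ne).trans (le_of_eq ?_)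
  rw [Real.volume_real_Icc_of_le (by linarith)]; ring

lemma fbr_meas {Y : Set (ℝ × (Fin m → ℝ))} (hY : MeasurableSet Y) : Measurable (fbr Y) :=
  (measurable_measure_prodMk_right hY).ennreal_toReal

lemma fbr_int {Y : Set (ℝ × (Fin m → ℝ))} {Λ : ℝ} (hY : MeasurableSet Y) (hb : ∀ p ∈ Y, |p.1| ≤ Λ)
    {S : Set (Fin m → ℝ)} (hS : MeasurableSet S) :
    ∫ z in S, fbr Y z = volume.real (Y ∩ Prod.snd ⁻¹' S) := by
  rw [measureReal_def, Measure.volume_eq_prod, Measure.prod_apply_symm (hY.inter (measurable_snd hS))]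
  have : ∫ z in S, fbr Y z = ∫ z in S, (volume ((fun x : ℝ => (x, z)) ⁻¹' Y)).toReal := rfl
  rw [this, integral_toReal (measurable_measure_prodMk_right hY).aemeasurable
    (Filter.Eventually.of_forall fun z => fib_fin hb z), ← lintegral_indicator hS]
  congr 2
  ext z
  by_cases hz : z ∈ S
  · rw [indicator_of_mem hz]
    congr 1
    ext s
    simp [hz]
  · rw [indicator_of_notMem hz]
    symm
    convert measure_empty (μ := (volume : Measure ℝ))
    ext s
    simp [hz]

lemma fbr_conc {X Y Z : Set (ℝ × (Fin m → ℝ))} {Λ : ℝ} (hX : IsCompact X) (hY : IsCompact Y)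
    (hb : ∀ p ∈ Z, |p.1| ≤ Λ) {t : ℝ} (h0 : 0 < t) (h1 : t < 1)
    (H : ∀ a ∈ X, ∀ b ∈ Y, t • a + (1 - t) • b ∈ Z) {x y : Fin m → ℝ} (hx : ((0:ℝ), x) ∈ X) (hy : ((0:ℝ), y) ∈ Y) :
    t * fbr X x + (1 - t) * fbr Y y ≤ fbr Z (t • x + (1 - t) • y) := by
  have mX : MeasurableSet {s : ℝ | (s, x) ∈ X} := measurable_prodMk_right hX.measurableSet
  have mY : MeasurableSet {s : ℝ | (s, y) ∈ Y} := measurable_prodMk_right hY.measurableSet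
  have := bm1 h0 h1 (A := {s : ℝ | (s, x) ∈ X}) (B := {s : ℝ | (s, y) ∈ Y})
    (C := {s : ℝ | (s, t • x + (1 - t) • y) ∈ Z}) mX mY ⟨0, hx⟩ ⟨0, hy⟩ (fun a ha b hb => H _ ha _ hb)
  have h2 := ENNReal.toReal_mono (fib_fin hb _).ne this
  have hfX : volume {s : ℝ | (s, x) ∈ X} ≠ ⊤ := by
    have c : IsCompact (Prod.fst '' X) := hX.image continuous_fst
    exact ((measure_mono (t := Prod.fst '' X) (fun s hs => ⟨(s, x), hs, rfl⟩)).trans_lt c.measure_lt_top).ne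
  have hfY : volume {s : ℝ | (s, y) ∈ Y} ≠ ⊤ := by
    have c : IsCompact (Prod.fst '' Y) := hY.image continuous_fst
    exact ((measure_mono (t := Prod.fst '' Y) (fun s hs => ⟨(s, y), hs, rfl⟩)).trans_lt c.measure_lt_top).ne
  rw [ENNReal.toReal_add (ENNReal.mul_ne_top (by simp) hfX) (ENNReal.mul_ne_top (by simp) hfY),
    ENNReal.toReal_mul, ENNReal.toReal_mul, ENNReal.toReal_ofReal h0.le, ENNReal.toReal_ofReal (by linarith)] at h2
  exact h2

lemma fbr_concave {X : Set (ℝ × (Fin m → ℝ))} {Λ r : ℝ} (hX : IsCompact X) (cX : Convex ℝ X)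
    (hb : ∀ p ∈ X, |p.1| ≤ Λ) (h0 : ∀ z, ‖z‖ ≤ r → ((0:ℝ), z) ∈ X) :
    ConcaveOn ℝ (Metric.closedBall 0 r) (fbr X) := by
  refine ⟨convex_closedBall _ _, fun x hx y hy a b ha hb' hab => ?_⟩
  obtain rfl : b = 1 - a := by linarith
  rcases ha.eq_or_lt with rfl | ha
  · simp
  rcases hb'.eq_or_lt with h | hb1
  · obtain rfl : a = 1 := by linarith
    simp
  exact fbr_conc hX hX hb ha (by linarith) (fun p hp q hq => cX hp hq ha.le hb' (by ring))
    (h0 x (by simpa using hx)) (h0 y (by simpa using hy))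

lemma fbr_diff {X Y : Set (ℝ × (Fin m → ℝ))} {Λ : ℝ} (hX : IsCompact X) (hY : IsCompact Y)
    (cX : Convex ℝ X) (cY : Convex ℝ Y)
    (bX : ∀ p ∈ X, |p.1| ≤ Λ) (bY : ∀ p ∈ Y, |p.1| ≤ Λ) (pX : ∀ p ∈ X, 0 ≤ p.1) (pY : ∀ p ∈ Y, 0 ≤ p.1)
    {z : Fin m → ℝ} (hx : ((0:ℝ), z) ∈ X) (hy : ((0:ℝ), z) ∈ Y) :
    fbr (X \ Y ∪ Y \ X) z ≤ |fbr Y z - fbr X z| := by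
  have mX : MeasurableSet {s : ℝ | (s, z) ∈ X} := measurable_prodMk_right hX.measurableSet
  have mY : MeasurableSet {s : ℝ | (s, z) ∈ Y} := measurable_prodMk_right hY.measurableSet
  have down : ∀ {X : Set (ℝ × (Fin m → ℝ))}, Convex ℝ X → ((0:ℝ), z) ∈ X → ∀ s s', 0 ≤ s' → s' ≤ s → (s, z) ∈ X → (s', z) ∈ X := by
    intro X cX h0 s s' p0 hs h
    rcases p0.eq_or_lt with rfl | hp
    · exact h0
    have s0 : 0 < s := hp.trans_le hs
    have := cX h h0 (show (0:ℝ) ≤ s' / s by positivity) (show (0:ℝ) ≤ 1 - s' / s by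
      rw [sub_nonneg, div_le_one s0]; exact hs) (by ring)
    have e : (s' / s) • ((s, z) : ℝ × (Fin m → ℝ)) + (1 - s' / s) • ((0:ℝ), z) = (s', z) := by
      ext i
      · simp; field_simp
      · simp
    rwa [e] at this
  have key : {s : ℝ | (s, z) ∈ X} ⊆ {s : ℝ | (s, z) ∈ Y} ∨ {s : ℝ | (s, z) ∈ Y} ⊆ {s : ℝ | (s, z) ∈ X} := by
    by_contra hc
    push Not at hc
    obtain ⟨h1, h2⟩ := hc
    obtain ⟨s, hs, hs'⟩ := not_subset.1 h1
    obtain ⟨u, hu, hu'⟩ := not_subset.1 h2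
    rcases le_total s u with h | h
    · exact hs' (down cY hy u s (pX _ hs) h hu)
    · exact hu' (down cX hx s u (pY _ hu) h hs)
  rcases key with h | h
  · have e : {s : ℝ | (s, z) ∈ X \ Y ∪ Y \ X} = {s : ℝ | (s, z) ∈ Y} \ {s : ℝ | (s, z) ∈ X} := by
      ext s
      constructor
      · rintro (⟨a, b⟩ | ⟨a, b⟩)
        · exact absurd (h a) b
        · exact ⟨a, b⟩
      · rintro ⟨a, b⟩; exact Or.inr ⟨a, b⟩
    unfold fbr
    rw [e, measureReal_sdiff h mX (fib_fin bY z).ne]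
    exact le_abs_self _
  · have e : {s : ℝ | (s, z) ∈ X \ Y ∪ Y \ X} = {s : ℝ | (s, z) ∈ X} \ {s : ℝ | (s, z) ∈ Y} := by
      ext s
      constructor
      · rintro (⟨a, b⟩ | ⟨a, b⟩)
        · exact ⟨a, b⟩
        · exact absurd (h a) b
      · rintro ⟨a, b⟩; exact Or.inl ⟨a, b⟩
    unfold fbr
    rw [e, measureReal_sdiff h mY (fib_fin bX z).ne, abs_sub_comm]
    exact le_abs_self _

lemma Coord.fst_le {θ : E m} {Φ : E m ≃L[ℝ] ℝ × (Fin m → ℝ)} (h : Coord θ Φ) (x : E m) : |(Φ x).1| ≤ ‖x‖ := by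
  refine abs_le_of_sq_le_sq ?_ (norm_nonneg x)
  rw [h.nrm]
  have := Finset.sum_nonneg (s := Finset.univ) (f := fun i => (Φ x).2 i ^ 2) (fun i _ => sq_nonneg _)
  linarith

lemma Coord.snd_le {θ : E m} {Φ : E m ≃L[ℝ] ℝ × (Fin m → ℝ)} (h : Coord θ Φ) (x : E m) : ‖(Φ x).2‖ ≤ ‖x‖ :=
  (pi_norm_le_iff_of_nonneg (norm_nonneg _)).2 fun i => h.abs_snd_le x i

lemma Coord.sym_le {θ : E m} {Φ : E m ≃L[ℝ] ℝ × (Fin m → ℝ)} (h : Coord θ Φ) (z : Fin m → ℝ) :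
    ‖Φ.symm ((0:ℝ), z)‖ ≤ (m + 1) * ‖z‖ := by
  refine le_of_sq_le_sq ?_ (by positivity)
  rw [h.nrm, Φ.apply_symm_apply]
  have : ∑ i, z i ^ 2 ≤ ∑ i : Fin m, ‖z‖ ^ 2 := by
    refine Finset.sum_le_sum fun i _ => ?_
    exact sq_le_sq' (by have := (abs_le.1 (norm_le_pi_norm z i)).1; exact this) ((abs_le.1 (norm_le_pi_norm z i)).2)
  simp at this
  have m0 : (0:ℝ) ≤ m := by positivity
  have : (m:ℝ) * ‖z‖ ^ 2 ≤ (m + 1) ^ 2 * ‖z‖ ^ 2 := by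
    gcongr; nlinarith
  simp only
  linarith [mul_pow ((m:ℝ) + 1) ‖z‖ 2, zero_pow (M₀ := ℝ) two_ne_zero]

end fib
end St8

open MeasureTheory Set Pointwise
set_option linter.unusedSectionVars false
namespace St8

section prism
variable {m : ℕ} {u : E m} {Φ : E m ≃L[ℝ] ℝ × (Fin m → ℝ)}

/-- upper half -/
def upr (Φ : E m ≃L[ℝ] ℝ × (Fin m → ℝ)) (K : Set (E m)) : Set (E m) := K ∩ {x | 0 ≤ (Φ x).1}

lemma upr_compact {K : Set (E m)} (hK : IsCompact K) : IsCompact (upr Φ K) :=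
  hK.inter_right (isClosed_le continuous_const (by fun_prop))

lemma upr_convex {K : Set (E m)} (hK : Convex ℝ K) : Convex ℝ (upr Φ K) := by
  refine hK.inter ?_
  intro x hx y hy a b ha hb hab
  simp only [mem_ofPred_eq, map_add, map_smul, Prod.fst_add, Prod.smul_fst, smul_eq_mul] at *
  positivity

lemma img_bdd (h : Coord u Φ) {K : Set (E m)} {Λ : ℝ} (hK : K ⊆ Metric.closedBall 0 Λ) :
    ∀ p ∈ Φ '' K, |p.1| ≤ Λ := by
  rintro _ ⟨x, hx, rfl⟩
  exact (h.fst_le x).trans (by simpa using hK hx)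

lemma cell_vol (h : Coord u Φ) {K : Set (E m)} {Λ ρ : ℝ} (hK : IsCompact K)
    (bK : K ⊆ Metric.closedBall 0 Λ) :
    ∫ z in Metric.closedBall 0 ρ, fbr (Φ '' upr Φ K) z = volume.real (K ∩ cell Φ ρ) := by
  rw [fbr_int ((upr_compact hK).image Φ.continuous).measurableSet (img_bdd h (inter_subset_left.trans bK))
    measurableSet_closedBall, ← h.vol (K ∩ cell Φ ρ)]
  congr 1
  ext p
  obtain ⟨x, rfl⟩ := Φ.surjective p
  simp only [mem_inter_iff, Φ.injective.mem_set_image, upr, cell, mem_preimage, mem_closedBall_zero_iff, mem_ofPred_eq]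
  tauto

lemma prism (m : ℕ) : ∃ k : ℕ, ∀ (Λ η : ℝ) (K K' : Set (E m)) (u : E m) (Φ : E m ≃L[ℝ] ℝ × (Fin m → ℝ)),
    2 ≤ Λ → 0 < η → Good Λ η K K' → Metric.closedBall 0 (1 / Λ) ⊆ K → Metric.closedBall 0 (1 / Λ) ⊆ K' →
    ‖u‖ = 1 → Coord u Φ →
    volume.real ((K \ K' ∪ K' \ K) ∩ cell Φ (1 / ((m + 3) * Λ) / 8)) ≤ Λ ^ k * η := by
  obtain ⟨kc, hc⟩ := cells m
  obtain ⟨kv, -, hv⟩ := vol_consts m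
  obtain ⟨k0, hk0⟩ := exists_pow_le (c := 2 ^ m * (8 * (m + 3)))
  refine ⟨kv + (k0 + 1) * (7 + kc), fun Λ η K K' u Φ hΛ hη G bK bK' hu h => ?_⟩
  have L0 : 0 < Λ := by linarith
  set L := Λ ^ (k0 + 1) with hL
  have hm : (0:ℝ) ≤ m := by positivity
  have p1 : (1:ℝ) ≤ 2 ^ m := one_le_pow₀ (by norm_num)
  have L1 : 2 ^ m * (8 * (m + 3)) * Λ ≤ L := by
    rw [hL, pow_succ]; gcongr; exact hk0 Λ hΛ
  have L2 : 8 * (m + 3) * Λ ≤ L := by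
    refine le_trans ?_ L1
    have : 1 * (8 * ((m:ℝ) + 3)) ≤ 2 ^ m * (8 * (m + 3)) := by gcongr
    have := mul_le_mul_of_nonneg_right this L0.le
    linarith
  have LΛ : Λ ≤ L := le_self_pow₀ (by linarith) (by omega)
  have L3 : 2 ^ m ≤ L := by
    refine le_trans ?_ L1
    rw [mul_assoc]
    refine le_mul_of_one_le_right (by positivity) ?_
    nlinarith
  have L4 : 2 ≤ L := hΛ.trans LΛ
  have Lp : 0 < L := by linarith
  set η1 := L ^ kc * η with hη1
  have e1p : 0 < η1 := by positivity
  have etot : Λ ^ (kv + (k0 + 1) * (7 + kc)) * η = Λ ^ kv * (L ^ 7 * η1) := by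
    rw [hη1, hL]; ring
  rw [etot]
  have one_v : 1 ≤ Λ ^ kv := one_le_pow₀ (by linarith)
  have one_L : 1 ≤ L ^ 7 := one_le_pow₀ (by linarith)
  rcases lt_or_ge 1 η1 with hbig | hsm
  · calc volume.real ((K \ K' ∪ K' \ K) ∩ cell Φ (1 / ((m + 3) * Λ) / 8))
        ≤ volume.real (Metric.closedBall (0 : E m) Λ) := by
          refine measureReal_mono ?_ (isCompact_closedBall _ _).measure_lt_top.ne
          refine inter_subset_left.trans (union_subset ?_ ?_)
          · exact sdiff_subset.trans G.bM
          · exact sdiff_subset.trans G.bN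
      _ ≤ Λ ^ kv := (hv Λ hΛ).2
      _ ≤ Λ ^ kv * (L ^ 7 * η1) := by
          refine le_mul_of_one_le_right (by positivity) ?_
          exact one_le_mul_of_one_le_of_one_le one_L hbig.le
  set r := 1 / ((m + 3) * Λ) with hr
  have r0 : 0 < r := by positivity
  have rL : 1 / L ≤ r / 8 := by
    rw [hr, div_div]
    refine one_div_le_one_div_of_le (by positivity) ?_
    linarith
  have rΛ : (m + 3) * r = 1 / Λ := by rw [hr]; field_simp
  have r3 : 3 * r ≤ 1 / Λ := by rw [← rΛ]; gcongr; linarith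
  have G' : Good L η K K' := G.mono LΛ hη.le le_rfl
  have G1 := hc L η r K K' u Φ L4 hη G' hu h (rL.trans (by linarith))
    ((Metric.closedBall_subset_closedBall r3).trans bK)
  have G2 := hc L η (r / 8) K K' u Φ L4 hη G' hu h rL
    ((Metric.closedBall_subset_closedBall (by linarith)).trans bK)
  have zin : ∀ {K : Set (E m)}, Metric.closedBall 0 (1 / Λ) ⊆ K → ∀ z, ‖z‖ ≤ r → ((0:ℝ), z) ∈ Φ '' upr Φ K := by
    intro K bK z hz
    refine ⟨Φ.symm (0, z), ⟨bK ?_, ?_⟩, Φ.apply_symm_apply _⟩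
    · rw [mem_closedBall_zero_iff, ← rΛ]
      refine (h.sym_le z).trans ?_
      have := mul_le_mul_of_nonneg_left hz (show (0:ℝ) ≤ m + 1 by positivity)
      linarith
    · simp
  have zX := zin bK
  have zX' := zin bK'
  set X := Φ '' upr Φ K with hX
  set X' := Φ '' upr Φ K' with hX'
  have bX : ∀ p ∈ X, |p.1| ≤ L := img_bdd h (inter_subset_left.trans G'.bM)
  have bX' : ∀ p ∈ X', |p.1| ≤ L := img_bdd h (inter_subset_left.trans G'.bN)
  have kX : IsCompact X := (upr_compact G.hM).image Φ.continuous
  have kX' : IsCompact X' := (upr_compact G.hN).image Φ.continuous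
  have cX : Convex ℝ X := (upr_convex G.cM).is_linear_image ⟨map_add Φ, map_smul Φ⟩
  have cX' : Convex ℝ X' := (upr_convex G.cN).is_linear_image ⟨map_add Φ, map_smul Φ⟩
  set Md := mid (K ∩ cell Φ r) (K' ∩ cell Φ r) with hMd
  have kMd : IsCompact (Φ '' Md) := (mid_compact G1.hM G1.hN).image Φ.continuous
  have bMd : ∀ p ∈ Φ '' Md, |p.1| ≤ L := img_bdd h (mid_ball G1.bM G1.bN)
  have P : Pr r (2 * L) η1 (fbr X) (fbr X') (fbr (Φ '' Md)) := by
    refine ⟨r0, fbr_meas kX.measurableSet, fbr_meas kX'.measurableSet, fbr_concave kX cX bX zX,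
      fbr_concave kX' cX' bX' zX', fbr_nonneg _, fbr_le Lp.le bX, fbr_nonneg _, fbr_le Lp.le bX', ?_, ?_, ?_⟩
    · refine bint (fbr_meas kMd.measurableSet) (C := 2 * L) (fun z => ?_) (finb _)
      rw [abs_of_nonneg (fbr_nonneg _ _)]; exact fbr_le Lp.le bMd z
    · intro z w h1 h2
      have n1 : ‖z + w‖ ≤ r := by simpa using h1
      have n2 : ‖z - w‖ ≤ r := by simpa using h2
      have eY : ∀ {K : Set (E m)} {y}, ‖y‖ ≤ r → fbr (Φ '' upr Φ K) y = fbr (Φ '' (K ∩ cell Φ r)) y := by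
        intro K y hy
        unfold fbr
        congr 1
        ext s
        obtain ⟨x, hx⟩ := Φ.surjective (s, y)
        show (s, y) ∈ Φ '' upr Φ K ↔ (s, y) ∈ Φ '' (K ∩ cell Φ r)
        rw [← hx, Φ.injective.mem_set_image, Φ.injective.mem_set_image]
        constructor
        · rintro ⟨q1, q2⟩
          exact ⟨q1, q2, by rw [hx]; exact hy⟩
        · rintro ⟨q1, q2, _⟩
          exact ⟨q1, q2⟩
      have zc : ∀ {K : Set (E m)} {y}, ‖y‖ ≤ r → ((0:ℝ), y) ∈ Φ '' upr Φ K → ((0:ℝ), y) ∈ Φ '' (K ∩ cell Φ r) := by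
        rintro K y hy ⟨x, hx, e⟩
        refine ⟨x, ⟨hx.1, hx.2, ?_⟩, e⟩
        rw [e]; exact hy
      have := fbr_conc (t := 1 / 2) (G1.hM.image Φ.continuous) (G1.hN.image Φ.continuous) bMd (by norm_num) (by norm_num) (x := z + w) (y := z - w) (by
        rintro _ ⟨a, ha, rfl⟩ _ ⟨b, hb, rfl⟩
        refine ⟨_, mem_mid ha hb, ?_⟩
        rw [map_add, map_smul, map_smul]; norm_num) (zc n1 (zX _ n1)) (zc n2 (zX' _ n2))
      rw [← eY n1, ← eY n2] at this
      have e : (1/2 : ℝ) • (z + w) + (1 - 1/2 : ℝ) • (z - w) = z := by module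
      rw [e] at this
      linarith
    · rw [cell_vol h G.hM G.bM, cell_vol h G.hN G.bN]
      refine le_trans ?_ G1.def'
      rw [fbr_int kMd.measurableSet bMd measurableSet_closedBall, ← h.vol]
      exact measureReal_mono inter_subset_left kMd.measure_lt_top.ne
  have bd : ∀ {X : Set (ℝ × (Fin m → ℝ))}, IsCompact X → (∀ p ∈ X, |p.1| ≤ L) → ∀ ρ, IntegrableOn (fbr X) (Metric.closedBall 0 ρ) := by
    intro X kX bX ρ
    refine bint (fbr_meas kX.measurableSet) (C := 2 * L) (fun z => ?_) (finb _)
    rw [abs_of_nonneg (fbr_nonneg _ _)]; exact fbr_le Lp.le bX z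
  have F := P.final e1p hsm (by
    rw [integral_sub (bd kX' bX' _) (bd kX bX _), cell_vol h G.hM G.bM, cell_vol h G.hN G.bN, abs_sub_comm]
    exact G2.dV)
  have mW : MeasurableSet (X \ X' ∪ X' \ X) :=
    (kX.measurableSet.diff kX'.measurableSet).union (kX'.measurableSet.diff kX.measurableSet)
  have bW : ∀ p ∈ X \ X' ∪ X' \ X, |p.1| ≤ L := by
    rintro p (hp | hp)
    · exact bX p hp.1
    · exact bX' p hp.1
  have pos : ∀ {K : Set (E m)}, ∀ p ∈ Φ '' upr Φ K, 0 ≤ p.1 := by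
    rintro K _ ⟨x, hx, rfl⟩; exact hx.2
  have e2 : volume.real ((K \ K' ∪ K' \ K) ∩ cell Φ (r / 8)) = ∫ z in Metric.closedBall 0 (r / 8), fbr (X \ X' ∪ X' \ X) z := by
    rw [fbr_int mW bW measurableSet_closedBall, ← h.vol]
    congr 1
    ext p
    obtain ⟨x, rfl⟩ := Φ.surjective p
    simp only [mem_inter_iff, mem_union, mem_sdiff, hX, hX', Φ.injective.mem_set_image, upr, cell, mem_preimage, mem_closedBall_zero_iff, mem_ofPred_eq]
    tauto
  have I1 : ∫ z in Metric.closedBall 0 (r / 8), fbr (X \ X' ∪ X' \ X) z ≤ ∫ z in Metric.closedBall 0 (r / 8), |fbr X' z - fbr X z| := by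
    refine setIntegral_mono_on ?_ ((bd kX' bX' _).sub (bd kX bX _)).abs measurableSet_closedBall ?_
    · refine bint (fbr_meas mW) (C := 2 * L) (fun z => ?_) (finb _)
      rw [abs_of_nonneg (fbr_nonneg _ _)]; exact fbr_le Lp.le bW z
    · intro z hz
      have hz' : ‖z‖ ≤ r := by
        rw [mem_closedBall_zero_iff] at hz; linarith
      exact fbr_diff kX kX' cX cX' bX bX' pos pos (zX z hz') (zX' z hz')
  rw [e2]
  refine (I1.trans F).trans ?_
  have vQ : volume.real (Metric.closedBall (0 : Fin m → ℝ) r) ≤ 1 := by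
    rw [measureReal_def, Real.volume_pi_closedBall _ r0.le, ENNReal.toReal_ofReal (by positivity)]
    refine pow_le_one₀ (by positivity) ?_
    have : r ≤ 1 / 2 := by
      rw [hr]
      refine one_div_le_one_div_of_le (by norm_num) ?_
      nlinarith
    linarith
  have vQ0 : 0 ≤ volume.real (Metric.closedBall (0 : Fin m → ℝ) r) := measureReal_nonneg
  calc (2 ^ m * (8 + 4 * (2 * L) * volume.real (Metric.closedBall (0 : Fin m → ℝ) r)) + 1) * η1
      ≤ (L * (8 + 4 * (2 * L) * 1) + 1) * η1 := by gcongr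
    _ ≤ L ^ 7 * η1 := by
        gcongr
        have h5 : 32 ≤ L ^ 5 := by
          calc (32:ℝ) = 2 ^ 5 := by norm_num
            _ ≤ L ^ 5 := by gcongr
        have h6 : 32 * L ^ 2 ≤ L ^ 5 * L ^ 2 := by gcongr
        have h7 : L ^ 7 = L ^ 5 * L ^ 2 := by ring
        rw [h7]
        nlinarith
    _ ≤ Λ ^ kv * (L ^ 7 * η1) := le_mul_of_one_le_left (by positivity) one_v

end prism
end St8

open MeasureTheory Set Pointwise
set_option linter.unusedSectionVars false
namespace St8

section mct
variable {m : ℕ}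

lemma averaging {W : Set (E m)} {Λ ρ c : ℝ} (mW : MeasurableSet W) (bW : W ⊆ Metric.closedBall 0 Λ)
    (hρ : ρ ≤ Λ) (c0 : 0 ≤ c)
    (hc : ∀ y, volume.real (W ∩ Metric.closedBall y ρ) ≤ c) :
    volume.real W * volume.real (Metric.closedBall (0 : E m) ρ) ≤ c * volume.real (Metric.closedBall (0 : E m) (2 * Λ)) := by
  set P : Set (E m × E m) := {p | p.1 ∈ W ∧ dist p.1 p.2 ≤ ρ} with hP
  have mP : MeasurableSet P := (measurable_fst mW).inter
    (isClosed_le (f := fun p : E m × E m => dist p.1 p.2) (g := fun _ => ρ) (by fun_prop) continuous_const).measurableSet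
  have fB : ∀ r, volume (Metric.closedBall (0 : E m) r) ≠ ⊤ := fun r => (isCompact_closedBall _ _).measure_lt_top.ne
  have fW : volume W ≠ ⊤ := ((measure_mono bW).trans_lt (fB _).lt_top).ne
  have e1 := Measure.prod_apply (μ := (volume : Measure (E m))) (ν := (volume : Measure (E m))) mP
  have e2 := Measure.prod_apply_symm (μ := (volume : Measure (E m))) (ν := (volume : Measure (E m))) mP
  have h1 : ∫⁻ x, volume (Prod.mk x ⁻¹' P) = volume W * volume (Metric.closedBall (0 : E m) ρ) := by
    rw [mul_comm, ← setLIntegral_const, ← lintegral_indicator mW]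
    congr 1
    ext x
    by_cases hx : x ∈ W
    · rw [indicator_of_mem hx, ← Measure.addHaar_closedBall_center volume x ρ]
      congr 1
      ext y
      simp [hP, hx, dist_comm]
    · rw [indicator_of_notMem hx]
      convert measure_empty (μ := (volume : Measure (E m)))
      ext y
      simp [hP, hx]
  have h2 : ∫⁻ y, volume ((fun x => (x, y)) ⁻¹' P) ≤ ENNReal.ofReal c * volume (Metric.closedBall (0 : E m) (2 * Λ)) := by
    rw [← setLIntegral_const, ← lintegral_indicator measurableSet_closedBall]
    refine lintegral_mono fun y => ?_
    have e : (fun x => (x, y)) ⁻¹' P = W ∩ Metric.closedBall y ρ := by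
      ext x; simp [hP]
    simp only [e]
    by_cases hy : y ∈ Metric.closedBall (0 : E m) (2 * Λ)
    · rw [indicator_of_mem hy]
      rw [← ENNReal.ofReal_toReal ((measure_mono inter_subset_left).trans_lt fW.lt_top).ne]
      exact ENNReal.ofReal_le_ofReal (hc y)
    · rw [indicator_of_notMem hy]
      have : W ∩ Metric.closedBall y ρ = ∅ := by
        rw [eq_empty_iff_forall_notMem]
        rintro x ⟨hx, hxy⟩
        apply hy
        have a1 : ‖x‖ ≤ Λ := by simpa using bW hx
        rw [mem_closedBall_zero_iff]
        have a2 : ‖x - y‖ ≤ ρ := by rwa [Metric.mem_closedBall, dist_eq_norm] at hxy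
        have := norm_sub_le x (x - y)
        rw [sub_sub_cancel] at this
        linarith
      rw [this, measure_empty]
  have h4 : volume W * volume (Metric.closedBall (0 : E m) ρ) ≤ ENNReal.ofReal c * volume (Metric.closedBall (0 : E m) (2 * Λ)) := by
    rw [← h1, ← e1, e2]; exact h2
  have := ENNReal.toReal_mono (ENNReal.mul_ne_top (by simp) (fB _)) h4
  rwa [ENNReal.toReal_mul, ENNReal.toReal_mul, ENNReal.toReal_ofReal c0] at this

lemma exists_dir (y : E m) : ∃ u : E m, ‖u‖ = 1 ∧ y = ‖y‖ • u := by
  by_cases hy : y = 0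
  · exact ⟨EuclideanSpace.single 0 1, by simp, by simp [hy]⟩
  · have := norm_pos_iff.2 hy
    refine ⟨‖y‖⁻¹ • y, ?_, ?_⟩
    · rw [norm_smul, norm_inv, norm_norm, inv_mul_cancel₀ this.ne']
    · rw [smul_smul, mul_inv_cancel₀ this.ne', one_smul]

lemma mct (m : ℕ) : ∃ k : ℕ, ∀ (Λ η : ℝ) (K K' : Set (E m)),
    2 ≤ Λ → 0 < η → Good Λ η K K' → Metric.closedBall 0 (1 / Λ) ⊆ K → Metric.closedBall 0 (1 / Λ) ⊆ K' →
    volume.real (K \ K' ∪ K' \ K) ≤ Λ ^ k * η := by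
  obtain ⟨kp, hp⟩ := prism m
  obtain ⟨kv, -, hv⟩ := vol_consts m
  obtain ⟨k0, hk0⟩ := exists_pow_le (c := 8 * (m + 3))
  refine ⟨kp + (k0 + 1) * kv + (k0 + 1) * kv, fun Λ η K K' hΛ hη G bK bK' => ?_⟩
  have L0 : 0 < Λ := by linarith
  set L := Λ ^ (k0 + 1) with hL
  have hm : (0:ℝ) ≤ m := by positivity
  have L2 : 8 * (m + 3) * Λ ≤ L := by
    rw [hL, pow_succ]; gcongr; exact hk0 Λ hΛ
  have LΛ : 2 * Λ ≤ L := by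
    refine le_trans ?_ L2; gcongr; linarith
  set ρ := 1 / ((m + 3) * Λ) / 8 with hρ
  have ρ0 : 0 < ρ := by positivity
  have ρL : 1 / L ≤ ρ := by
    rw [hρ, div_div]
    exact one_div_le_one_div_of_le (by positivity) (by linarith)
  have ρΛ : 2 * ρ ≤ 1 / Λ := by
    have e : (m + 3) * (8 * ρ) = 1 / Λ := by rw [hρ]; field_simp
    rw [← e]
    have : 1 * (8 * ρ) ≤ (m + 3) * (8 * ρ) := by gcongr; linarith
    linarith
  have ρ1 : ρ ≤ Λ := by
    have : 1 / Λ ≤ 1 := by rw [div_le_one L0]; linarith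
    linarith
  set W := K \ K' ∪ K' \ K with hW
  have mW : MeasurableSet W :=
    (G.hM.measurableSet.diff G.hN.measurableSet).union (G.hN.measurableSet.diff G.hM.measurableSet)
  have bW : W ⊆ Metric.closedBall 0 Λ := union_subset (sdiff_subset.trans G.bM) (sdiff_subset.trans G.bN)
  have fW : volume W ≠ ⊤ := ((measure_mono bW).trans_lt (isCompact_closedBall _ _).measure_lt_top).ne
  have loc : ∀ y, volume.real (W ∩ Metric.closedBall y ρ) ≤ Λ ^ kp * η := by
    intro y
    obtain ⟨u, hu, hy⟩ := exists_dir y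
    obtain ⟨Φ, h⟩ := exists_coord hu
    refine le_trans (measureReal_mono ?_ ((measure_mono inter_subset_left).trans_lt fW.lt_top).ne) (hp Λ η K K' u Φ hΛ hη G bK bK' hu h)
    rintro x ⟨hxW, hx⟩
    refine ⟨hxW, ?_⟩
    have hx' : ‖x - y‖ ≤ ρ := by rwa [Metric.mem_closedBall, dist_eq_norm] at hx
    have y1 : (Φ y).1 = ‖y‖ := by
      rw [h.fst]
      conv_lhs => rw [hy]
      rw [inner_smul_right, real_inner_self_eq_norm_sq, hu]; simp
    have y2 : (Φ y).2 = 0 := by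
      have := h.nrm y
      rw [y1] at this
      have s0 : ∑ i, (Φ y).2 i ^ 2 = 0 := by linarith
      rw [Finset.sum_eq_zero_iff_of_nonneg (fun i _ => sq_nonneg _)] at s0
      ext i
      exact pow_eq_zero_iff two_ne_zero |>.1 (s0 i (Finset.mem_univ i))
    have e : Φ x = Φ y + Φ (x - y) := by rw [← map_add]; congr 1; abel
    constructor
    · by_contra hneg
      push Not at hneg
      rw [e, Prod.fst_add, y1] at hneg
      have a1 := (abs_le.1 (h.fst_le (x - y))).1
      have a2 : ‖y‖ ≤ ρ := by linarith
      have a3 : ‖x‖ ≤ 1 / Λ := by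
        have := norm_add_le (x - y) y
        rw [sub_add_cancel] at this
        linarith
      have a4 : x ∈ Metric.closedBall (0 : E m) (1 / Λ) := by simpa using a3
      rcases hxW with q | q
      · exact q.2 (bK' a4)
      · exact q.2 (bK a4)
    · rw [e, Prod.snd_add, y2, zero_add]
      exact (h.snd_le _).trans hx'
  have av := averaging mW bW ρ1 (by positivity) loc
  have v1 := (hv L (by linarith)).1 0 ρ ρL
  have v2 : volume.real (Metric.closedBall (0 : E m) (2 * Λ)) ≤ L ^ kv :=
    (measureReal_mono (Metric.closedBall_subset_closedBall LΛ) (isCompact_closedBall _ _).measure_lt_top.ne).trans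
      (hv L (by linarith)).2
  have Lp : 0 < L := by positivity
  have a1 : volume.real W * (1 / L ^ kv) ≤ Λ ^ kp * η * L ^ kv :=
    (mul_le_mul_of_nonneg_left v1 measureReal_nonneg).trans (av.trans (by gcongr))
  rw [mul_one_div, div_le_iff₀ (by positivity)] at a1
  refine a1.trans (le_of_eq ?_)
  rw [hL]; ring

end mct
end St8

open MeasureTheory Set Pointwise
set_option linter.unusedSectionVars false
namespace St8

section inr
variable {m : ℕ}

lemma sep {K : Set (E m)} (hK : IsClosed K) (cK : Convex ℝ K) (nK : K.Nonempty) {y : E m} (hy : y ∉ K) :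
    ∃ (θ : E m) (s : ℝ), ‖θ‖ = 1 ∧ (∀ x ∈ K, inner ℝ θ x < s) ∧ s < inner ℝ θ y := by
  obtain ⟨f, u, hu, huy⟩ := geometric_hahn_banach_closed_point cK hK hy
  set w : E m := (InnerProductSpace.toDual ℝ (E m)).symm f with hw
  have hf : ∀ x, f x = inner ℝ w x := fun x => by rw [hw, InnerProductSpace.toDual_symm_apply]
  have w0 : 0 < ‖w‖ := by
    rw [norm_pos_iff]
    intro h
    obtain ⟨x, hx⟩ := nK
    have h1 := hu x hx
    rw [hf, h, inner_zero_left] at h1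
    rw [hf, h, inner_zero_left] at huy
    linarith
  refine ⟨‖w‖⁻¹ • w, ‖w‖⁻¹ * u, ?_, fun x hx => ?_, ?_⟩
  · rw [norm_smul, norm_inv, norm_norm, inv_mul_cancel₀ w0.ne']
  · rw [real_inner_smul_left, ← hf]
    exact mul_lt_mul_of_pos_left (hu x hx) (by positivity)
  · rw [real_inner_smul_left, ← hf]
    exact mul_lt_mul_of_pos_left huy (by positivity)

lemma inradius {K : Set (E m)} (hK : IsCompact K) (cK : Convex ℝ K) {R : ℝ} (hR : 0 < R)
    (bK : K ⊆ Metric.closedBall 0 R) (v0 : 0 < volume.real K) :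
    Metric.closedBall (bar K) (volume.real K / (8 * (2 * R) ^ m)) ⊆ K := by
  intro y hy
  by_contra hyK
  have nK : K.Nonempty := by
    by_contra hc
    rw [not_nonempty_iff_eq_empty] at hc
    simp [hc] at v0
  obtain ⟨θ, s, hθ, hs, hsy⟩ := sep hK.isClosed cK nK hyK
  set V := volume.real K with hV
  set D := (2 * R) ^ m with hD
  have D0 : 0 < D := by positivity
  set c := bar K with hc
  have s1 : s < inner ℝ θ c + V / (8 * D) := by
    have h1 : inner ℝ θ y = inner ℝ θ c + inner ℝ θ (y - c) := by rw [inner_sub_right]; ring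
    have h2 := (le_abs_self _).trans (abs_real_inner_le_norm θ (y - c))
    rw [hθ, one_mul] at h2
    rw [Metric.mem_closedBall, dist_eq_norm] at hy
    linarith
  set h := V / (2 * D) with hh
  have h0 : 0 < h := by positivity
  have m1 : mu θ K s = V := by
    rw [mu, hV]; congr 1
    exact inter_eq_left.2 fun x hx => (hs x hx).le
  have m2 := mu_lip hθ hK hR bK (s := s - h) (s' := s) (by linarith)
  have m3 : V / 2 ≤ mu θ K (s - h) := by
    have : D * h = V / 2 := by rw [hh]; field_simp
    rw [sub_sub_cancel, ← hD, this, m1] at m2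
    linarith
  have iK : IntegrableOn (fun x : E m => s - inner ℝ θ x) K :=
    ContinuousOn.integrableOn_compact hK (by fun_prop)
  have iK1 : IntegrableOn (fun x : E m => inner ℝ θ x) K :=
    ContinuousOn.integrableOn_compact hK (by fun_prop)
  have iK2 : IntegrableOn (fun x : E m => x) K :=
    ContinuousOn.integrableOn_compact hK (by fun_prop)
  have e1 : ∫ x in K, (s - inner ℝ θ x) = V * (s - inner ℝ θ c) := by
    have : IntegrableOn (fun _ : E m => s) K := ContinuousOn.integrableOn_compact hK (by fun_prop)
    rw [integral_sub this iK1, setIntegral_const, integral_inner iK2, hc, bar, inner_smul_right, smul_eq_mul, ← hV]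
    field_simp
  have kH := half_compact hK θ (s - h)
  have e2 : mu θ K (s - h) * h ≤ ∫ x in K, (s - inner ℝ θ x) := by
    calc mu θ K (s - h) * h = ∫ x in K ∩ {x | inner ℝ θ x ≤ s - h}, h := by
          rw [setIntegral_const, smul_eq_mul]; rfl
      _ ≤ ∫ x in K ∩ {x | inner ℝ θ x ≤ s - h}, (s - inner ℝ θ x) := by
          refine setIntegral_mono_on (ContinuousOn.integrableOn_compact kH (by fun_prop)) (iK.mono_set inter_subset_left) kH.measurableSet ?_
          intro x hx
          have : inner ℝ θ x ≤ s - h := hx.2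
          linarith
      _ ≤ _ := by
          refine setIntegral_mono_set iK ?_ (Filter.Eventually.of_forall fun x hx => hx.1)
          refine (ae_restrict_iff' hK.measurableSet).2 (Filter.Eventually.of_forall fun x hx => ?_)
          have := hs x hx
          show 0 ≤ s - inner ℝ θ x
          linarith
  have e3 : V / 2 * h ≤ V * (s - inner ℝ θ c) := by
    rw [← e1]; exact le_trans (mul_le_mul_of_nonneg_right m3 h0.le) e2
  have e4 : V * (s - inner ℝ θ c) < V * (V / (8 * D)) := mul_lt_mul_of_pos_left (by linarith) v0
  have e5 : V / 2 * h = V * (V / (4 * D)) := by rw [hh]; field_simp; ring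
  rw [e5] at e3
  have e6 := lt_of_mul_lt_mul_left (e3.trans_lt e4) v0.le
  rw [div_lt_div_iff₀ (by positivity) (by positivity)] at e6
  nlinarith [mul_pos v0 D0]

lemma vol_tr (M : Set (E m)) (v : E m) : volume.real ((fun x => x + v) '' M) = volume.real M := by
  rw [measureReal_def, measureReal_def, image_add_right, measure_preimage_add_right]

lemma bar_tr {M : Set (E m)} (hM : IsCompact M) (h0 : 0 < volume.real M) (v : E m) : bar ((fun x => x + v) '' M) = bar M + v := by
  unfold bar
  rw [vol_tr, (measurePreserving_add_right volume v).setIntegral_image_emb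
    (MeasurableEquiv.addRight v).measurableEmbedding]
  have i1 : IntegrableOn (fun x : E m => x) M := ContinuousOn.integrableOn_compact hM (by fun_prop)
  have i2 : IntegrableOn (fun _ : E m => v) M := ContinuousOn.integrableOn_compact hM (by fun_prop)
  rw [integral_add i1 i2, setIntegral_const, smul_add, smul_smul, inv_mul_cancel₀ h0.ne', one_smul]

lemma mid_tr (M N : Set (E m)) (v w : E m) : mid ((fun x => x + v) '' M) ((fun x => x + w) '' N) =
    (fun x => x + ((1/2 : ℝ) • v + (1/2 : ℝ) • w)) '' mid M N := by
  ext x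
  constructor
  · rintro ⟨⟨_, _⟩, ⟨⟨a, ha, rfl⟩, ⟨b, hb, rfl⟩⟩, rfl⟩
    exact ⟨_, mem_mid ha hb, by simp only; module⟩
  · rintro ⟨_, ⟨⟨a, b⟩, ⟨ha, hb⟩, rfl⟩, rfl⟩
    exact ⟨(a + v, b + w), ⟨⟨a, ha, rfl⟩, ⟨b, hb, rfl⟩⟩, by simp only; module⟩

end inr
end St8

open MeasureTheory Set Pointwise
set_option linter.unusedSectionVars false
namespace St8

section cs
variable {m : ℕ}

lemma tr_compact {K : Set (E m)} (hK : IsCompact K) (v : E m) : IsCompact ((fun x => x + v) '' K) :=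
  hK.image (by fun_prop)

lemma tr_convex {K : Set (E m)} (hK : Convex ℝ K) (v : E m) : Convex ℝ ((fun x => x + v) '' K) := by
  have e : (fun x => x + v) = fun x => v + x := funext fun x => add_comm _ _
  rw [e]; exact hK.translate v

lemma mem_tr {K : Set (E m)} {v x : E m} : x ∈ (fun x => x + v) '' K ↔ x - v ∈ K := by
  constructor
  · rintro ⟨a, ha, rfl⟩; simpa using ha
  · intro h; exact ⟨x - v, h, by simp⟩

lemma inr_ball {Λ : ℝ} (hΛ : 2 ≤ Λ) {K : Set (E m)} (hK : IsCompact K) (cK : Convex ℝ K)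
    (bK : K ⊆ Metric.closedBall 0 Λ) (vK : 1 / Λ ≤ volume.real K) :
    Metric.closedBall (bar K) (1 / Λ ^ (4 + 2 * m)) ⊆ K := by
  have L0 : 0 < Λ := by linarith
  set L := Λ ^ (4 + 2 * m) with hL
  have v0 : 0 < volume.real K := lt_of_lt_of_le (by positivity) vK
  refine (Metric.closedBall_subset_closedBall ?_).trans (inradius hK cK L0 bK v0)
  rw [le_div_iff₀ (by positivity)]
  refine le_trans ?_ vK
  rw [div_mul_eq_mul_div, one_mul, div_le_div_iff₀ (by positivity) L0, one_mul]
  have e1 : (2 * Λ) ^ m ≤ (Λ ^ 2) ^ m := by gcongr; nlinarith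
  have e2 : (8:ℝ) ≤ Λ ^ 3 := by
    calc (8:ℝ) = 2 ^ 3 := by norm_num
      _ ≤ Λ ^ 3 := by gcongr
  calc 8 * (2 * Λ) ^ m * Λ ≤ Λ ^ 3 * (Λ ^ 2) ^ m * Λ := by gcongr
    _ = L := by rw [hL]; ring

lemma cs (m : ℕ) : ∃ k : ℕ, ∀ (Λ ε : ℝ) (K1 K2 : Set (E m)),
    2 ≤ Λ → 0 < ε → IsCompact K1 → IsCompact K2 → Convex ℝ K1 → Convex ℝ K2 →
    K1 ⊆ Metric.closedBall 0 Λ → K2 ⊆ Metric.closedBall 0 Λ →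
    1 / Λ ≤ volume.real K1 → 1 / Λ ≤ volume.real K2 →
    |volume.real K1 - volume.real K2| ≤ ε →
    volume.real (mid K1 K2) ≤ (volume.real K1 + volume.real K2) / 2 + ε ^ 2 →
    Metric.closedBall (bar K1) (1 / Λ ^ (4 + 2 * m)) ⊆ K1 ∧
    Metric.closedBall (bar K2) (1 / Λ ^ (4 + 2 * m)) ⊆ K2 ∧
    volume.real (K1 \ ((fun x => x + (bar K1 - bar K2)) '' K2) ∪ ((fun x => x + (bar K1 - bar K2)) '' K2) \ K1) ≤ Λ ^ k * ε := by
  obtain ⟨k, hk⟩ := mct m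
  refine ⟨(4 + 2 * m) * k, fun Λ ε K1 K2 hΛ hε h1 h2 c1 c2 b1 b2 v1 v2 dv dm => ?_⟩
  have L0 : 0 < Λ := by linarith
  set L := Λ ^ (4 + 2 * m) with hL
  have LL : 2 * Λ ≤ L := by
    have : Λ ^ 2 ≤ L := pow_le_pow_right₀ (by linarith) (by omega)
    nlinarith
  have i1 := inr_ball hΛ h1 c1 b1 v1
  have i2 := inr_ball hΛ h2 c2 b2 v2
  refine ⟨i1, i2, ?_⟩
  have shb : ∀ {K : Set (E m)}, IsCompact K → K ⊆ Metric.closedBall 0 Λ →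
      (fun x => x + -bar K) '' K ⊆ Metric.closedBall 0 L := by
    rintro K hK bK _ ⟨x, hx, rfl⟩
    have e1 : ‖x‖ ≤ Λ := by simpa using bK hx
    have e2 := norm_bar_le hK L0.le bK
    rw [mem_closedBall_zero_iff]
    refine (norm_add_le _ _).trans ?_
    rw [norm_neg]; linarith
  have shi : ∀ {K : Set (E m)}, Metric.closedBall (bar K) (1 / L) ⊆ K →
      Metric.closedBall 0 (1 / L) ⊆ (fun x => x + -bar K) '' K := by
    intro K hi x hx
    rw [mem_tr]
    apply hi
    rw [Metric.mem_closedBall, dist_eq_norm, sub_neg_eq_add, add_sub_cancel_right]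
    simpa using hx
  have p1 : 0 < volume.real K1 := lt_of_lt_of_le (by positivity) v1
  have p2 : 0 < volume.real K2 := lt_of_lt_of_le (by positivity) v2
  have G : Good L ε ((fun x => x + -bar K1) '' K1) ((fun x => x + -bar K2) '' K2) := by
    refine ⟨tr_compact h1 _, tr_compact h2 _, tr_convex c1 _, tr_convex c2 _, shb h1 b1, shb h2 b2, ?_, ?_, ?_⟩
    · rw [vol_tr, vol_tr]; exact dv
    · rw [mid_tr, vol_tr, vol_tr, vol_tr]; exact dm
    · rw [bar_tr h1 p1, bar_tr h2 p2]; simpa using hε.le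
  have M := hk L ε _ _ (by linarith) hε G (shi i1) (shi i2)
  rw [← vol_tr _ (bar K1)] at M
  rw [pow_mul, ← hL]
  refine le_of_eq_of_le ?_ M
  congr 1
  ext x
  have e1 : x - bar K1 - -bar K1 = x := by abel
  have e2 : x - bar K1 - -bar K2 = x - (bar K1 - bar K2) := by abel
  simp only [mem_tr, mem_union, mem_sdiff, e1, e2]

lemma pre_vol (X : Set (E m)) (p : E m) {r : ℝ} (hr : 0 < r) :
    volume.real ((fun w => p + r • w) ⁻¹' X) = volume.real X / r ^ (m + 1) := by
  have e : (fun w : E m => p + r • w) ⁻¹' X = (fun w => r • w) ⁻¹' ((fun w => p + w) ⁻¹' X) := rfl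
  rw [e, measureReal_def, Measure.addHaar_preimage_smul volume hr.ne', measure_preimage_add, ENNReal.toReal_mul,
    ENNReal.toReal_ofReal (abs_nonneg _), finrank_euclideanSpace_fin, abs_of_pos (by positivity), measureReal_def]
  field_simp

lemma img_vol (X : Set (E m)) (p : E m) {r : ℝ} (hr : 0 < r) :
    volume.real ((fun w => p + r • w) '' X) = r ^ (m + 1) * volume.real X := by
  have inj : Function.Injective (fun w : E m => p + r • w) := by
    intro a b h
    exact smul_right_injective _ hr.ne' (add_left_cancel h)
  have := pre_vol ((fun w => p + r • w) '' X) p hr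
  rw [preimage_image_eq _ inj, eq_div_iff (by positivity)] at this
  rw [← this]; ring

/-- convexification -/
lemma cvx {A B K1 K2 : Set (E m)} {c1 c2 : E m} {ρ e1 e2 t lam : ℝ}
    (f1 : volume K1 ≠ ⊤) (f2 : volume K2 ≠ ⊤) (cc1 : Convex ℝ K1) (cc2 : Convex ℝ K2)
    (i1 : Metric.closedBall c1 ρ ⊆ K1) (i2 : Metric.closedBall c2 ρ ⊆ K2)
    (hA : volume.real (K1 \ A) ≤ e1) (hB : volume.real (K2 \ B) ≤ e2)
    (t0 : 0 < t) (t1 : t < 1) (l0 : 0 < lam) (l1 : lam ≤ 1)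
    (H : e1 / (lam * (1 - t)) ^ (m + 1) + e2 / (lam * t) ^ (m + 1) < volume.real (Metric.closedBall (0 : E m) ρ))
    {a b : E m} (ha : a ∈ K1) (hb : b ∈ K2) :
    (1 - lam) • (t • a + (1 - t) • b) + lam • (t • c1 + (1 - t) • c2) ∈ t • A + (1 - t) • B := by
  have s0 : 0 < 1 - t := by linarith
  set Q := Metric.closedBall (0 : E m) ρ with hQ
  set fA : E m → E m := fun w => ((1 - lam) • a + lam • c1) + (lam * (1 - t)) • w with hfA
  set fB : E m → E m := fun w => ((1 - lam) • b + lam • c2) + (lam * t) • (-w) with hfB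
  have inA : ∀ w ∈ Q, fA w ∈ K1 := by
    intro w hw
    have hw' : ‖w‖ ≤ ρ := by simpa [hQ] using hw
    have : c1 + (1 - t) • w ∈ K1 := by
      apply i1
      rw [Metric.mem_closedBall, dist_eq_norm, add_sub_cancel_left, norm_smul, Real.norm_of_nonneg s0.le]
      nlinarith [norm_nonneg w]
    have h2 := cc1 ha this (show 0 ≤ 1 - lam by linarith) l0.le (by ring)
    convert h2 using 1
    simp only [hfA]; module
  have inB : ∀ w ∈ Q, fB w ∈ K2 := by
    intro w hw
    have hw' : ‖w‖ ≤ ρ := by simpa [hQ] using hw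
    have : c2 + t • (-w) ∈ K2 := by
      apply i2
      rw [Metric.mem_closedBall, dist_eq_norm, add_sub_cancel_left, norm_smul, norm_neg, Real.norm_of_nonneg t0.le]
      nlinarith [norm_nonneg w]
    have h2 := cc2 hb this (show 0 ≤ 1 - lam by linarith) l0.le (by ring)
    convert h2 using 1
    simp only [hfB]; module
  have fpre : ∀ {X : Set (E m)} (p : E m) {r : ℝ}, 0 < r → volume X ≠ ⊤ → volume ((fun w => p + r • w) ⁻¹' X) ≠ ⊤ := by
    intro X p r hr hX
    have e : (fun w : E m => p + r • w) ⁻¹' X = (fun w => r • w) ⁻¹' ((fun w => p + w) ⁻¹' X) := rfl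
    rw [e, Measure.addHaar_preimage_smul volume hr.ne', measure_preimage_add]
    exact ENNReal.mul_ne_top (by simp) hX
  have fa : volume (K1 \ A) ≠ ⊤ := ((measure_mono sdiff_subset).trans_lt f1.lt_top).ne
  have fb : volume (K2 \ B) ≠ ⊤ := ((measure_mono sdiff_subset).trans_lt f2.lt_top).ne
  have r1 : 0 < lam * (1 - t) := by positivity
  have r2 : 0 < lam * t := by positivity
  have VA : volume.real (fA ⁻¹' (K1 \ A)) ≤ e1 / (lam * (1 - t)) ^ (m + 1) := by
    rw [hfA, pre_vol _ _ r1]; gcongr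
  have VB : volume.real (fB ⁻¹' (K2 \ B)) ≤ e2 / (lam * t) ^ (m + 1) := by
    have e : fB ⁻¹' (K2 \ B) = -((fun w => ((1 - lam) • b + lam • c2) + (lam * t) • w) ⁻¹' (K2 \ B)) := rfl
    rw [e, measureReal_def, Measure.measure_neg, ← measureReal_def, pre_vol _ _ r2]; gcongr
  have FB : volume (fB ⁻¹' (K2 \ B)) ≠ ⊤ := by
    have e : fB ⁻¹' (K2 \ B) = -((fun w => ((1 - lam) • b + lam • c2) + (lam * t) • w) ⁻¹' (K2 \ B)) := rfl
    rw [e, Measure.measure_neg]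
    exact fpre _ r2 fb
  obtain ⟨w, hwQ, hw⟩ : ∃ w ∈ Q, w ∉ fA ⁻¹' (K1 \ A) ∪ fB ⁻¹' (K2 \ B) := by
    by_contra hc
    push Not at hc
    have := measureReal_mono (μ := volume) hc (by
      refine ((measure_union_le _ _).trans_lt (ENNReal.add_lt_top.2 ⟨(fpre _ r1 fa).lt_top, FB.lt_top⟩)).ne)
    have h3 := measureReal_union_le (μ := volume) (fA ⁻¹' (K1 \ A)) (fB ⁻¹' (K2 \ B))
    linarith
  have wA : fA w ∈ A := by
    by_contra hc
    exact hw (Or.inl ⟨inA w hwQ, hc⟩)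
  have wB : fB w ∈ B := by
    by_contra hc
    exact hw (Or.inr ⟨inB w hwQ, hc⟩)
  refine ⟨t • fA w, smul_mem_smul_set wA, (1 - t) • fB w, smul_mem_smul_set wB, ?_⟩
  simp only [hfA, hfB]
  module

lemma mid_pow {K1 K2 X : Set (E m)} (h1 : IsCompact K1) (h2 : IsCompact K2) (hX : IsCompact X)
    (c2 : Convex ℝ K2) {t : ℝ} (t0 : 0 < t) (t1 : t ≤ 1 / 2)
    (H : ∀ a ∈ K1, ∀ b ∈ K2, t • a + (1 - t) • b ∈ X) :
    volume.real (mid K1 K2) ^ (2 * t) * volume.real K2 ^ (1 - 2 * t) ≤ volume.real X := by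
  rcases t1.eq_or_lt with rfl | t1
  · norm_num
    refine measureReal_mono ?_ hX.measure_lt_top.ne
    rintro _ ⟨⟨a, b⟩, ⟨ha, hb⟩, rfl⟩
    have := H a ha b hb
    norm_num at this ⊢
    exact this
  · refine BM_E m (2 * t) (by linarith) (by linarith) _ _ _ (mid_compact h1 h2) h2 hX ?_
    rintro _ ⟨⟨a, b⟩, ⟨ha, hb⟩, rfl⟩ y hy
    have s0 : 0 < 1 - t := by linarith
    have h3 := c2 hb hy (show 0 ≤ t / (1 - t) by positivity) (show 0 ≤ (1 - 2 * t) / (1 - t) from div_nonneg (by linarith) s0.le)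
      (by field_simp; ring)
    have := H a ha _ h3
    convert this using 1
    rw [smul_add (1 - t), smul_smul (1 - t), smul_smul (1 - t), mul_div_cancel₀ _ s0.ne', mul_div_cancel₀ _ s0.ne']
    simp only
    module

lemma mid_comm' (K1 K2 : Set (E m)) : mid K1 K2 = mid K2 K1 := by
  ext x
  constructor
  · rintro ⟨⟨a, b⟩, ⟨ha, hb⟩, rfl⟩
    exact ⟨(b, a), ⟨hb, ha⟩, add_comm _ _⟩
  · rintro ⟨⟨a, b⟩, ⟨ha, hb⟩, rfl⟩
    exact ⟨(b, a), ⟨hb, ha⟩, add_comm _ _⟩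

/-- hull estimate -/
lemma hull {K Q S : Set (E m)} {c p : E m} {ρ w d e e' : ℝ} (hK : IsCompact K) (cK : Convex ℝ K)
    (hρ : 0 < ρ) (iK : Metric.closedBall c ρ ⊆ K) (w0 : 0 < w) (w1 : w < 1) (d0 : 0 < d) (d1 : d ≤ 1)
    (fS : volume S ≠ ⊤)
    (hS : ∀ x ∈ Q, w • p + (1 - w) • x ∈ S) (h1 : volume.real (S \ K) ≤ e) (h2 : volume.real (K \ Q) ≤ e')
    (hp : p ∉ (fun x => -(d • c) + (1 + d) • x) '' K) :
    (1 - w) ^ (m + 1) * (volume.real (Metric.closedBall c (w * d / 2 * ρ)) - e') ≤ e := by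
  have cin : c ∈ K := iK (by simp [hρ.le])
  obtain ⟨θ, s, hθ, hs, hsp⟩ := sep (K := (fun x => -(d • c) + (1 + d) • x) '' K) (hK.image (by fun_prop)).isClosed
    (by
      have := (cK.smul (1 + d)).translate (-(d • c))
      rw [← image_smul, image_image] at this
      exact this) (Set.Nonempty.image _ ⟨c, cin⟩) hp
  obtain ⟨x, hx, hmax⟩ := hK.exists_isMaxOn ⟨c, cin⟩ (f := fun x => inner ℝ θ x) (by fun_prop)
  have hmax' : ∀ y ∈ K, inner ℝ θ y ≤ inner ℝ θ x := fun y hy => hmax hy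
  set σ := w * d / 2 with hσ
  have σ0 : 0 < σ := by positivity
  have σ1 : σ ≤ 1 := by rw [hσ]; nlinarith
  set y := (1 - σ) • x + σ • c with hy
  have s0 : 0 < 1 - w := by linarith
  have hρh : inner ℝ θ c + ρ ≤ inner ℝ θ x := by
    have := hmax' (c + ρ • θ) (iK (by
      rw [Metric.mem_closedBall, dist_eq_norm, add_sub_cancel_left, norm_smul, hθ, Real.norm_of_nonneg hρ.le, mul_one]))
    rw [inner_add_right, inner_smul_right, real_inner_self_eq_norm_sq, hθ] at this
    linarith
  have ballK : Metric.closedBall y (σ * ρ) ⊆ K := by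
    intro q hq
    rw [Metric.mem_closedBall, dist_eq_norm] at hq
    have h3 : c + σ⁻¹ • (q - y) ∈ K := by
      apply iK
      rw [Metric.mem_closedBall, dist_eq_norm, add_sub_cancel_left, norm_smul, Real.norm_of_nonneg (by positivity), inv_mul_le_iff₀ σ0]
      exact hq
    have h4 := cK hx h3 (show 0 ≤ 1 - σ by linarith) σ0.le (by ring)
    convert h4 using 1
    rw [smul_add σ, smul_smul σ, mul_inv_cancel₀ σ0.ne', hy]
    clear_value σ
    module
  have fb : volume (Metric.closedBall y (σ * ρ)) ≠ ⊤ := (isCompact_closedBall _ _).measure_lt_top.ne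
  have fKQ : volume (K \ Q) ≠ ⊤ := ((measure_mono sdiff_subset).trans_lt hK.measure_lt_top).ne
  have v1 : volume.real (Metric.closedBall c (σ * ρ)) - e' ≤ volume.real (Metric.closedBall y (σ * ρ) ∩ Q) := by
    have e1 : volume.real (Metric.closedBall c (σ * ρ)) = volume.real (Metric.closedBall y (σ * ρ)) :=
      (vol_ball c (r := σ * ρ) (by positivity)).trans (vol_ball y (by positivity)).symm
    have e2 : volume.real (Metric.closedBall y (σ * ρ)) ≤ volume.real (Metric.closedBall y (σ * ρ) ∩ Q ∪ K \ Q) := by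
      refine measureReal_mono ?_ ?_
      · intro q hq
        by_cases h : q ∈ Q
        · exact Or.inl ⟨hq, h⟩
        · exact Or.inr ⟨ballK hq, h⟩
      · refine ((measure_union_le _ _).trans_lt (ENNReal.add_lt_top.2 ⟨?_, fKQ.lt_top⟩)).ne
        exact (measure_mono inter_subset_left).trans_lt fb.lt_top
    have e3 := measureReal_union_le (μ := volume) (Metric.closedBall y (σ * ρ) ∩ Q) (K \ Q)
    linarith
  have sub : (fun q => w • p + (1 - w) • q) '' (Metric.closedBall y (σ * ρ) ∩ Q) ⊆ S \ K := by
    rintro _ ⟨q, ⟨hq, hqQ⟩, rfl⟩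
    refine ⟨hS q hqQ, fun hc => ?_⟩
    have g1 := hmax' _ hc
    rw [inner_add_right, inner_smul_right, inner_smul_right] at g1
    have g2 : inner ℝ θ y - σ * ρ ≤ inner ℝ θ q := by
      rw [Metric.mem_closedBall, dist_eq_norm] at hq
      have := neg_le_of_abs_le ((abs_real_inner_le_norm θ (q - y)).trans (by rw [hθ, one_mul]))
      rw [inner_sub_right] at this
      linarith
    have g3 : inner ℝ θ y = (1 - σ) * inner ℝ θ x + σ * inner ℝ θ c := by
      rw [hy, inner_add_right, inner_smul_right, inner_smul_right]
    have g4 : -(d * inner ℝ θ c) + (1 + d) * inner ℝ θ x < inner ℝ θ p := by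
      have := hs _ ⟨x, hx, rfl⟩
      rw [inner_add_right, inner_neg_right, inner_smul_right, inner_smul_right] at this
      linarith
    set h := inner ℝ θ x - inner ℝ θ c with hh
    have hρ2 : ρ ≤ h := by linarith
    -- everything relative to the centre
    have q1 : inner ℝ θ x - 2 * σ * h ≤ inner ℝ θ q := by
      have : σ * ρ ≤ σ * h := by gcongr
      rw [g3] at g2
      have e : (1 - σ) * inner ℝ θ x + σ * inner ℝ θ c = inner ℝ θ x - σ * h := by rw [hh]; ring
      linarith
    have q2 : inner ℝ θ x + d * h < inner ℝ θ p := by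
      have e : -(d * inner ℝ θ c) + (1 + d) * inner ℝ θ x = inner ℝ θ x + d * h := by rw [hh]; ring
      linarith
    have q3 := mul_lt_mul_of_pos_left q2 w0
    have q4 := mul_le_mul_of_nonneg_left q1 s0.le
    have q5 : (1 - w) * (2 * σ * h) ≤ w * d * h := by
      have e : 2 * σ * h = w * d * h := by rw [hσ]; ring
      rw [e]
      have : 0 ≤ w * d * h := by
        have : 0 ≤ h := by linarith
        positivity
      nlinarith
    nlinarith
  have v2 := measureReal_mono (μ := volume) sub ((measure_mono sdiff_subset).trans_lt fS.lt_top).ne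
  rw [img_vol _ _ s0] at v2
  refine le_trans ?_ (v2.trans h1)
  gcongr

end cs
end St8

open MeasureTheory Set Pointwise
set_option linter.unusedSectionVars false
namespace St8

section core
variable {m : ℕ}

lemma exp_small {x : ℝ} (h0 : 0 ≤ x) (h1 : x ≤ 1 / 2) : Real.exp x ≤ 1 + 2 * x := by
  refine (Real.exp_bound_div_one_sub_of_interval h0 (by linarith)).trans ?_
  rw [div_le_iff₀ (by linarith)]
  nlinarith

lemma mid_bound1 {Λ e t : ℝ} {K1 K2 X : Set (E m)} (h1 : IsCompact K1) (h2 : IsCompact K2) (hX : IsCompact X)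
    (c2 : Convex ℝ K2) (hΛ : 2 ≤ Λ) (e0 : 0 ≤ e) (e1 : 4 * e * Λ ≤ 1) (t0 : 1 / Λ ≤ t) (t1 : t ≤ 1 / 2)
    (H : ∀ a ∈ K1, ∀ b ∈ K2, t • a + (1 - t) • b ∈ X) (v2 : 1 - 2 * e ≤ volume.real K2) (vX : volume.real X ≤ 1 + e) :
    volume.real (mid K1 K2) ≤ 1 + 4 * e * Λ := by
  have L0 : 0 < Λ := by linarith
  have tp : 0 < t := lt_of_lt_of_le (by positivity) t0
  have M := (mid_pow h1 h2 hX c2 tp t1 H).trans vX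
  have e8 : e ≤ 1 / 8 := by nlinarith
  set V := volume.real (mid K1 K2)
  have V0 : 0 ≤ V := measureReal_nonneg
  have p0 : 0 ≤ V ^ (2 * t) := Real.rpow_nonneg V0 _
  have p1 : 1 - 2 * e ≤ volume.real K2 ^ (1 - 2 * t) := by
    calc 1 - 2 * e = (1 - 2 * e) ^ (1:ℝ) := (Real.rpow_one _).symm
      _ ≤ (1 - 2 * e) ^ (1 - 2 * t) := Real.rpow_le_rpow_of_exponent_ge (by linarith) (by linarith) (by linarith)
      _ ≤ _ := Real.rpow_le_rpow (by linarith) v2 (by linarith)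
  have p2 : V ^ (2 * t) ≤ 1 + 4 * e := by
    have := mul_le_mul_of_nonneg_left p1 p0
    nlinarith
  have p3 : V ≤ Real.exp (2 * e * Λ) := by
    have q : V = (V ^ (2 * t)) ^ (1 / (2 * t)) := by
      rw [← Real.rpow_mul V0, mul_one_div_cancel (by positivity), Real.rpow_one]
    rw [q]
    calc (V ^ (2 * t)) ^ (1 / (2 * t)) ≤ (Real.exp (4 * e)) ^ (1 / (2 * t)) := by
          refine Real.rpow_le_rpow p0 ?_ (by positivity)
          have := Real.add_one_le_exp (4 * e); linarith
      _ = Real.exp (4 * e * (1 / (2 * t))) := by rw [← Real.exp_mul]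
      _ ≤ _ := by
          apply Real.exp_le_exp.2
          have : 1 / t ≤ Λ := by rw [div_le_iff₀ tp]; rw [div_le_iff₀ L0] at t0; linarith
          have h3 : 4 * e * (1 / (2 * t)) = 2 * e * (1 / t) := by field_simp; ring
          rw [h3]; gcongr
  have := exp_small (x := 2 * e * Λ) (by positivity) (by linarith)
  linarith

lemma mid_bound {Λ e t : ℝ} {K1 K2 X : Set (E m)} (h1 : IsCompact K1) (h2 : IsCompact K2) (hX : IsCompact X)
    (c1 : Convex ℝ K1) (c2 : Convex ℝ K2) (hΛ : 2 ≤ Λ) (e0 : 0 ≤ e) (e1 : 4 * e * Λ ≤ 1) (t0 : 1 / Λ ≤ t) (t1 : t ≤ 1 - 1 / Λ)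
    (H : ∀ a ∈ K1, ∀ b ∈ K2, t • a + (1 - t) • b ∈ X) (v1 : 1 - 2 * e ≤ volume.real K1)
    (v2 : 1 - 2 * e ≤ volume.real K2) (vX : volume.real X ≤ 1 + e) :
    volume.real (mid K1 K2) ≤ 1 + 4 * e * Λ := by
  rcases le_total t (1 / 2) with h | h
  · exact mid_bound1 h1 h2 hX c2 hΛ e0 e1 t0 h H v2 vX
  · rw [mid_comm']
    refine mid_bound1 (t := 1 - t) h2 h1 hX c1 hΛ e0 e1 (by linarith) (by linarith) ?_ v1 vX
    intro a ha b hb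
    have := H b hb a ha
    rw [add_comm, sub_sub_cancel]; exact this

lemma bern {x : ℝ} (h : x ≤ 1) (n : ℕ) : 1 - n * x ≤ (1 - x) ^ n := by
  have := one_add_mul_le_pow (a := -x) (by linarith) n
  simpa [sub_eq_add_neg] using this

lemma fin_sub {X Y : Set (E m)} (h : X ⊆ Y) (hY : volume Y ≠ ⊤) : volume X ≠ ⊤ :=
  ((measure_mono h).trans_lt hY.lt_top).ne

lemma sd_tri {X Y Z : Set (E m)} (hX : volume X ≠ ⊤) (hY : volume Y ≠ ⊤) :
    volume.real (X \ Z) ≤ volume.real (X \ Y) + volume.real (Y \ Z) := by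
  refine le_trans (measureReal_mono (s₂ := X \ Y ∪ Y \ Z) ?_ ?_) (measureReal_union_le _ _)
  · intro x hx
    by_cases h : x ∈ Y
    · exact Or.inr ⟨h, hx.2⟩
    · exact Or.inl ⟨hx.1, h⟩
  · exact ((measure_union_le _ _).trans_lt (ENNReal.add_lt_top.2 ⟨(fin_sub sdiff_subset hX).lt_top, (fin_sub sdiff_subset hY).lt_top⟩)).ne

lemma vol_sd_ge {X Y : Set (E m)} (hX : volume X ≠ ⊤) (hY : volume Y ≠ ⊤) :
    volume.real X ≤ volume.real Y + volume.real (X \ Y) := by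
  have := sd_tri (Z := ∅) hX hY
  simp only [sdiff_empty] at this
  linarith

lemma tr_sdiff (X Y : Set (E m)) (v : E m) :
    ((fun x => x + v) '' X) \ ((fun x => x + v) '' Y) = (fun x => x + v) '' (X \ Y) := by
  ext x; simp only [mem_sdiff, mem_tr]

lemma tr_fin {X : Set (E m)} (h : volume X ≠ ⊤) (v : E m) : volume ((fun x => x + v) '' X) ≠ ⊤ := by
  rw [image_add_right]
  rwa [measure_preimage_add_right]

/-- bound on the volume of the convexified Minkowski combination -/
lemma ks_bound {K1 K2 S : Set (E m)} {t lam z : ℝ} {c : E m} (fS : volume S ≠ ⊤) 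
    (z0 : 0 ≤ z) (zl : z ≤ lam) (l0 : 0 < lam) (l1 : ((m + 1 : ℕ) : ℝ) * lam ≤ 1 / 4) (vS : volume.real S ≤ 1 + z)
    (H : ∀ a ∈ K1, ∀ b ∈ K2, (1 - lam) • (t • a + (1 - t) • b) + lam • c ∈ S) :
    volume.real (t • K1 + (1 - t) • K2) ≤ 1 + 4 * ((m + 1 : ℕ) : ℝ) * lam := by
  have n1 : (1:ℝ) ≤ ((m + 1 : ℕ) : ℝ) := by push_cast; linarith [(Nat.cast_nonneg m : (0:ℝ) ≤ m)]
  set n : ℝ := ((m + 1 : ℕ) : ℝ) with hn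
  have l2 : lam ≤ n * lam := by nlinarith
  have sub : (fun x => lam • c + (1 - lam) • x) '' (t • K1 + (1 - t) • K2) ⊆ S := by
    rintro _ ⟨_, ⟨_, ⟨a, ha, rfl⟩, _, ⟨b, hb, rfl⟩, rfl⟩, rfl⟩
    have := H a ha b hb
    rw [add_comm] at this
    exact this
  have V := (measureReal_mono (μ := volume) sub fS).trans vS
  rw [img_vol _ _ (by linarith)] at V
  have b := bern (x := lam) (by linarith) (m + 1)
  rw [← hn] at b
  set W := volume.real (t • K1 + (1 - t) • K2)
  have W0 : 0 ≤ W := measureReal_nonneg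
  set x := n * lam with hx
  have h1 : (1 - x) * W ≤ 1 + x := by
    have := mul_le_mul_of_nonneg_right b W0
    linarith
  have h2 : 4 * n * lam = 4 * x := by rw [hx]; ring
  rw [h2]
  clear_value x W n
  by_contra hc
  push Not at hc
  have x0 : 0 < x := by linarith
  have := mul_lt_mul_of_pos_left hc (show 0 < 1 - x by linarith)
  nlinarith

end core
end St8

open MeasureTheory Set Pointwise
set_option linter.unusedSectionVars false
namespace St8

section core
variable {m : ℕ}

/-- from near-equality to the midpoint deficit -/
lemma core_a {A B K1 K2 : Set (E m)} {c1 c2 : E m} {Λ t z lam ε : ℝ}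
    (hA : IsCompact A) (hB : IsCompact B) (h1 : IsCompact K1) (h2 : IsCompact K2)
    (cc1 : Convex ℝ K1) (cc2 : Convex ℝ K2) (hΛ : 2 ≤ Λ) (t0 : 1 / Λ ≤ t) (t1 : t ≤ 1 - 1 / Λ)
    (z0 : 0 ≤ z) (zl : z ≤ lam) (l0 : 0 < lam) (l1 : 16 * ((m + 1 : ℕ) : ℝ) * lam * Λ ≤ 1)
    (le : 20 * ((m + 1 : ℕ) : ℝ) * lam * Λ ≤ ε ^ 2) (e0 : 0 < ε)
    (C : ∀ a ∈ K1, ∀ b ∈ K2, (1 - lam) • (t • a + (1 - t) • b) + lam • (t • c1 + (1 - t) • c2) ∈ t • A + (1 - t) • B)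
    (v1 : 1 - 2 * z ≤ volume.real K1) (v1' : volume.real K1 ≤ 1 + 2 * z)
    (v2 : 1 - 2 * z ≤ volume.real K2) (v2' : volume.real K2 ≤ 1 + 2 * z)
    (vS : volume.real (t • A + (1 - t) • B) ≤ 1 + z) :
    |volume.real K1 - volume.real K2| ≤ ε ∧
    volume.real (mid K1 K2) ≤ (volume.real K1 + volume.real K2) / 2 + ε ^ 2 := by
  have n1 : (1:ℝ) ≤ ((m + 1 : ℕ) : ℝ) := by push_cast; linarith [(Nat.cast_nonneg m : (0:ℝ) ≤ m)]
  have S := ks_bound (K1 := K1) (K2 := K2) (t := t) ((hA.smul t).add (hB.smul (1 - t))).measure_lt_top.ne z0 zl l0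
    (by
      have : 0 < ((m + 1 : ℕ) : ℝ) * lam := by positivity
      nlinarith) vS C
  set n : ℝ := ((m + 1 : ℕ) : ℝ) with hn
  have ln : lam ≤ n * lam := by nlinarith
  have M := mid_bound (X := t • K1 + (1 - t) • K2) (e := 4 * n * lam) h1 h2 ((h1.smul t).add (h2.smul (1 - t))) cc1 cc2 hΛ
    (by positivity) (by linarith) t0 t1 (fun a ha b hb => ⟨_, smul_mem_smul_set ha, _, smul_mem_smul_set hb, rfl⟩)
    (by linarith) (by linarith) S
  have q1 : lam * 2 ≤ n * lam * Λ := by nlinarith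
  constructor
  · have : 4 * z ≤ ε := by
      refine le_of_sq_le_sq ?_ e0.le
      have z1 : z ≤ 1 := by nlinarith
      nlinarith
    rw [abs_le]; constructor <;> linarith
  · nlinarith

set_option maxHeartbeats 1000000 in
/-- the translated picture -/
lemma core_b {A B K1 K2 : Set (E m)} {v c1 c2 : E m} {Λ t z lam η d ρ : ℝ}
    (hA : IsCompact A) (hB : IsCompact B) (h1 : IsCompact K1) (h2 : IsCompact K2)
    (cc1 : Convex ℝ K1) (hΛ : 2 ≤ Λ) (t0 : 1 / Λ ≤ t) (t1 : t ≤ 1 - 1 / Λ) (hρ : 0 < ρ)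
    (i1 : Metric.closedBall c1 ρ ⊆ K1) (hv : c2 + v = c1)
    (z0 : 0 ≤ z) (zl : z ≤ lam) (l0 : 0 < lam) (l1 : 16 * ((m + 1 : ℕ) : ℝ) * lam * Λ ≤ 1)
    (lη : 5 * ((m + 1 : ℕ) : ℝ) * lam ≤ η) 
    (C : ∀ a ∈ K1, ∀ b ∈ K2, (1 - lam) • (t • a + (1 - t) • b) + lam • (t • c1 + (1 - t) • c2) ∈ t • A + (1 - t) • B)
    (v1 : 1 - 2 * z ≤ volume.real K1) (v1' : volume.real K1 ≤ 1 + 2 * z)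
    (vS : volume.real (t • A + (1 - t) • B) ≤ 1 + z)
    (hη : volume.real (K1 \ ((fun x => x + v) '' K2) ∪ ((fun x => x + v) '' K2) \ K1) ≤ η)
    (z1 : volume.real (A \ K1) ≤ z) (z2 : volume.real (K1 \ A) ≤ z)
    (z3 : volume.real (B \ K2) ≤ z) (z4 : volume.real (K2 \ B) ≤ z)
    (d0 : 0 < d) (d1 : ((m + 1 : ℕ) : ℝ) * d ≤ 1 / 2)
    (hd : 4 * η * Λ ^ (m + 1) < (d / (2 * Λ)) ^ (m + 1) * volume.real (Metric.closedBall (0 : E m) ρ)) :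
    volume.real (A \ ((fun x => x + v) '' B)) + volume.real (((fun x => x + v) '' B) \ A) ≤ 6 * η ∧
    ∃ K : Set (E m), IsCompact K ∧ Convex ℝ K ∧ A ⊆ K ∧ (fun x => x + v) '' B ⊆ K ∧
      volume.real (K \ A) + volume.real (K \ ((fun x => x + v) '' B)) ≤ 8 * ((m + 1 : ℕ) : ℝ) * d + 3 * η := by
  have n1 : (1:ℝ) ≤ ((m + 1 : ℕ) : ℝ) := by push_cast; linarith [(Nat.cast_nonneg m : (0:ℝ) ≤ m)]
  set n : ℝ := ((m + 1 : ℕ) : ℝ) with hn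
  have L0 : 0 < Λ := by linarith
  have iL : 0 < 1 / Λ := by positivity
  have tp : 0 < t := by linarith
  have tp1 : t < 1 := by linarith
  have ln : lam ≤ n * lam := by nlinarith
  have l32 : lam ≤ 1 / 32 := by
    have : n * lam * 2 ≤ n * lam * Λ := by gcongr
    linarith
  have fA : volume A ≠ ⊤ := hA.measure_lt_top.ne
  have fB : volume B ≠ ⊤ := hB.measure_lt_top.ne
  have f1 : volume K1 ≠ ⊤ := h1.measure_lt_top.ne
  have f2 : volume K2 ≠ ⊤ := h2.measure_lt_top.ne
  have fB' := tr_fin fB v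
  have f2' := tr_fin f2 v
  have z3' : volume.real (((fun x => x + v) '' B) \ ((fun x => x + v) '' K2)) ≤ z := by
    rw [tr_sdiff, vol_tr]; exact z3
  have z4' : volume.real (((fun x => x + v) '' K2) \ ((fun x => x + v) '' B)) ≤ z := by
    rw [tr_sdiff, vol_tr]; exact z4
  set B' := (fun x => x + v) '' B with hB'
  set K2' := (fun x => x + v) '' K2 with hK2'
  have fu : volume (K1 \ K2' ∪ K2' \ K1) ≠ ⊤ :=
    ((measure_union_le _ _).trans_lt (ENNReal.add_lt_top.2 ⟨(fin_sub sdiff_subset f1).lt_top, (fin_sub sdiff_subset f2').lt_top⟩)).ne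
  have w1 : volume.real (K1 \ K2') ≤ η := (measureReal_mono subset_union_left fu).trans hη
  have w2 : volume.real (K2' \ K1) ≤ η := (measureReal_mono subset_union_right fu).trans hη
  have zη : 5 * z ≤ η := by linarith
  have AB : volume.real (A \ B') ≤ z + (η + z) :=
    (sd_tri fA f1).trans (add_le_add z1 ((sd_tri f1 f2').trans (add_le_add w1 z4')))
  have BA : volume.real (B' \ A) ≤ z + (η + z) :=
    (sd_tri fB' f2').trans (add_le_add z3' ((sd_tri f2' f1).trans (add_le_add w2 z2)))
  have K1B : volume.real (K1 \ B') ≤ η + z := (sd_tri f1 f2').trans (add_le_add w1 z4')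
  refine ⟨by linarith, ?_⟩
  -- the translated sum set
  have cS : IsCompact (t • A + (1 - t) • B) := (hA.smul t).add (hB.smul (1 - t))
  have fS' := tr_fin cS.measure_lt_top.ne ((1 - t) • v)
  have vS' : volume.real ((fun x => x + (1 - t) • v) '' (t • A + (1 - t) • B)) ≤ 1 + z := by rw [vol_tr]; exact vS
  have mS' : ∀ a ∈ A, ∀ b ∈ B', t • a + (1 - t) • b ∈ (fun x => x + (1 - t) • v) '' (t • A + (1 - t) • B) := by
    rintro a ha _ ⟨b, hb, rfl⟩
    exact ⟨_, ⟨_, smul_mem_smul_set ha, _, smul_mem_smul_set hb, rfl⟩, by simp only [smul_add]; abel⟩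
  have c1in : c1 ∈ K1 := i1 (by simp [hρ.le])
  have sub : (fun x => lam • c1 + (1 - lam) • x) '' (K1 ∩ K2') ⊆
      ((fun x => x + (1 - t) • v) '' (t • A + (1 - t) • B)) ∩ K1 := by
    rintro _ ⟨x, ⟨hx, hx2⟩, rfl⟩
    rw [mem_tr] at hx2
    constructor
    · refine ⟨_, C x hx _ hx2, ?_⟩
      have : c2 = c1 - v := by rw [← hv]; abel
      simp only
      rw [this]; module
    · have := cc1 c1in hx l0.le (show 0 ≤ 1 - lam by linarith) (by ring)
      exact this
  set S' := (fun x => x + (1 - t) • v) '' (t • A + (1 - t) • B) with hS'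
  have mono := measureReal_mono (μ := volume) sub (fin_sub inter_subset_left fS')
  rw [img_vol _ _ (by linarith)] at mono
  have bl := bern (x := lam) (by linarith) (m + 1)
  rw [← hn] at bl
  have vI : volume.real K1 - η ≤ volume.real (K1 ∩ K2') := by
    have := vol_sd_ge (X := K1) (Y := K1 ∩ K2') f1 (fin_sub inter_subset_left f1)
    rw [sdiff_self_inter] at this
    linarith
  have vI2 : volume.real (K1 ∩ K2') ≤ 2 := by
    have := measureReal_mono (μ := volume) (inter_subset_left : K1 ∩ K2' ⊆ K1) f1
    linarith
  have vI0 : 0 ≤ volume.real (K1 ∩ K2') := measureReal_nonneg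
  have SK : volume.real (S' \ K1) ≤ 2 * η := by
    have e1 : volume.real (S' ∩ K1) + volume.real (S' \ K1) = volume.real S' :=
      measureReal_inter_add_sdiff h1.measurableSet fS'
    have e2 := mul_le_mul_of_nonneg_right bl vI0
    have e3 : n * lam * volume.real (K1 ∩ K2') ≤ n * lam * 2 := by gcongr
    have e4 : (1 - n * lam) * volume.real (K1 ∩ K2') = volume.real (K1 ∩ K2') - n * lam * volume.real (K1 ∩ K2') := by ring
    rw [e4] at e2
    have : 5 * (n * lam) ≤ η := by linarith
    linarith
  have dn : d ≤ n * d := le_mul_of_one_le_left d0.le n1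
  have d1' : d ≤ 1 := by linarith
  have η0 : 0 ≤ η := by linarith
  -- hull step
  have key : ∀ (w : ℝ) (p : E m) (Q : Set (E m)), 1 / Λ ≤ w → w ≤ 1 - 1 / Λ →
      (∀ x ∈ Q, w • p + (1 - w) • x ∈ S') → volume.real (K1 \ Q) ≤ η + z →
      p ∈ (fun x => -(d • c1) + (1 + d) • x) '' K1 := by
    intro w p Q w0 w1 hS hQ
    by_contra hp
    have wp : 0 < w := by linarith
    have hu := hull (e := 2 * η) (e' := η + z) h1 cc1 hρ i1 wp (by linarith) d0 d1' fS' hS SK hQ hp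
    have q0 : volume.real (Metric.closedBall (0:E m) ρ) = ρ ^ (m + 1) * volume.real (Metric.closedBall (0:E m) 1) :=
      vol_ball 0 hρ.le
    have q1 : (d / (2 * Λ)) ^ (m + 1) * volume.real (Metric.closedBall (0:E m) ρ) ≤
        volume.real (Metric.closedBall c1 (w * d / 2 * ρ)) := by
      rw [vol_ball c1 (by positivity), q0, mul_pow _ ρ, mul_assoc]
      have hb : 0 ≤ ρ ^ (m + 1) * volume.real (Metric.closedBall (0:E m) 1) := by positivity
      refine mul_le_mul_of_nonneg_right (pow_le_pow_left₀ (by positivity) ?_ _) hb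
      rw [div_le_div_iff₀ (by positivity) (by norm_num)]
      rw [div_le_iff₀ L0] at w0
      have := mul_le_mul_of_nonneg_right w0 d0.le
      linarith
    have q2 : (1 / Λ) ^ (m + 1) ≤ (1 - w) ^ (m + 1) := by gcongr; linarith
    have q3 : 1 ≤ Λ ^ (m + 1) := one_le_pow₀ (by linarith)
    have q6 : 4 * η ≤ 4 * η * Λ ^ (m + 1) := le_mul_of_one_le_right (by positivity) q3
    have q4 : 0 ≤ volume.real (Metric.closedBall c1 (w * d / 2 * ρ)) - (η + z) := by linarith
    have q5 := (mul_le_mul_of_nonneg_right q2 q4).trans hu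
    rw [one_div_pow, one_div_mul_eq_div, div_le_iff₀ (by positivity)] at q5
    linarith
  have AK : A ⊆ (fun x => -(d • c1) + (1 + d) • x) '' K1 := fun a ha =>
    key t a B' t0 t1 (fun x hx => mS' a ha x hx) K1B
  have BK : B' ⊆ (fun x => -(d • c1) + (1 + d) • x) '' K1 := fun b hb =>
    key (1 - t) b A (by linarith) (by linarith) (fun x hx => by
      rw [sub_sub_cancel, add_comm]; exact mS' x hx b hb) (by linarith)
  have cK : IsCompact ((fun x => -(d • c1) + (1 + d) • x) '' K1) := h1.image (by fun_prop)
  have KK : K1 ⊆ (fun x => -(d • c1) + (1 + d) • x) '' K1 := by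
    intro x hx
    have dp : 0 < 1 + d := by linarith
    refine ⟨(1 / (1 + d)) • x + (d / (1 + d)) • c1, cc1 hx c1in (by positivity) (by positivity) (by field_simp), ?_⟩
    simp only
    rw [smul_add, smul_smul, smul_smul, mul_one_div_cancel dp.ne', mul_div_cancel₀ _ dp.ne']
    module
  have VK : volume.real (((fun x => -(d • c1) + (1 + d) • x) '' K1) \ K1) ≤ 4 * n * d := by
    rw [measureReal_sdiff KK h1.measurableSet (h₁ := cK.measure_lt_top.ne), img_vol _ _ (by linarith)]
    have e1 : (1 + d) ^ (m + 1) ≤ Real.exp (n * d) := by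
      rw [hn, Real.exp_nat_mul]
      gcongr
      have := Real.add_one_le_exp d; linarith
    have e2 := exp_small (x := n * d) (by positivity) d1
    have e3 : volume.real K1 ≤ 2 := by linarith
    have e4 : (1 + d) ^ (m + 1) * volume.real K1 ≤ (1 + 2 * (n * d)) * volume.real K1 := by
      gcongr; linarith
    have e5 : 2 * (n * d) * volume.real K1 ≤ 2 * (n * d) * 2 := by gcongr
    linarith
  refine ⟨_, cK, ?_, AK, BK, ?_⟩
  · have := (cc1.smul (1 + d)).translate (-(d • c1))
    rw [← image_smul, image_image] at this
    exact this
  · have r1 := (sd_tri (Z := A) cK.measure_lt_top.ne f1).trans (add_le_add VK z2)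
    have r2 := (sd_tri (Z := B') cK.measure_lt_top.ne f1).trans (add_le_add VK K1B)
    linarith

end core
end St8

open MeasureTheory Set Pointwise
set_option linter.unusedSectionVars false
namespace St8

section core
variable {m : ℕ}

lemma nums {n p q k1 a b b' : ℕ} {Λ y : ℝ} (hn : 1 ≤ n) (hΛ : 2 ≤ Λ) (hy : 0 < y) (hp : 20 * (n:ℝ) ≤ Λ ^ p)
    (ha : a = n + q + 2) (hb : b = p + a + 1) (hb' : b' = 3 * n + q + 3 + k1 + b) (hk : Λ ^ (p + b' + 1) * y ≤ 1) :
    y ≤ 1 ∧ y ^ (2 * n ^ 2) ≤ Λ ^ a * y ^ (2 * n) ∧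
    20 * (n:ℝ) * (Λ ^ a * y ^ (2 * n)) * Λ ≤ (Λ ^ b * y ^ n) ^ 2 ∧ Λ ^ b * y ^ n ≤ 1 ∧
    2 * y ^ (2 * n ^ 2) * Λ ^ n < (Λ ^ a * y ^ (2 * n)) ^ n * (1 / Λ ^ q) ∧
    (n:ℝ) * (Λ ^ b' * y) ≤ 1 / 2 ∧
    4 * (Λ ^ k1 * (Λ ^ b * y ^ n)) * Λ ^ n < ((Λ ^ b' * y) / (2 * Λ)) ^ n * (1 / Λ ^ q) ∧
    6 * (Λ ^ k1 * (Λ ^ b * y ^ n)) ≤ Λ ^ (p + b' + 1) * y ^ n ∧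
    8 * (n:ℝ) * (Λ ^ b' * y) + 3 * (Λ ^ k1 * (Λ ^ b * y ^ n)) ≤ Λ ^ (p + b' + 1) * y := by
  have L1 : 1 ≤ Λ := by linarith
  have L1' : 1 < Λ := by linarith
  have L0 : 0 < Λ := by linarith
  have y1 : y ≤ 1 := by
    refine le_trans ?_ hk
    exact le_mul_of_one_le_left hy.le (one_le_pow₀ L1)
  have yn : y ^ n ≤ y := pow_le_of_le_one hy.le y1 (by omega)
  have four : (4:ℝ) ≤ Λ ^ 2 := by nlinarith
  have eight : (8:ℝ) ≤ Λ ^ 3 := by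
    calc (8:ℝ) = 2 ^ 3 := by norm_num
      _ ≤ Λ ^ 3 := by gcongr
  refine ⟨y1, ?_, ?_, ?_, ?_, ?_, ?_, ?_, ?_⟩
  · calc y ^ (2 * n ^ 2) ≤ y ^ (2 * n) := pow_le_pow_of_le_one hy.le y1 (by nlinarith)
      _ ≤ _ := le_mul_of_one_le_left (by positivity) (one_le_pow₀ L1)
  · calc 20 * (n:ℝ) * (Λ ^ a * y ^ (2 * n)) * Λ ≤ Λ ^ p * (Λ ^ a * y ^ (2 * n)) * Λ := by gcongr
      _ = Λ ^ b * y ^ (2 * n) := by rw [hb]; ring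
      _ ≤ (Λ ^ b * Λ ^ b) * y ^ (2 * n) := by
          gcongr
          exact le_mul_of_one_le_left (by positivity) (one_le_pow₀ L1)
      _ = _ := by ring
  · calc Λ ^ b * y ^ n ≤ Λ ^ (p + b' + 1) * y := by
          exact mul_le_mul (pow_le_pow_right₀ L1 (by omega)) yn (by positivity) (by positivity)
      _ ≤ 1 := hk
  · have e : (Λ ^ a * y ^ (2 * n)) ^ n * (1 / Λ ^ q) = y ^ (2 * n ^ 2) * (Λ ^ (a * n) / Λ ^ q) := by
      rw [mul_pow, ← pow_mul, ← pow_mul]; ring_nf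
    rw [e, mul_assoc, mul_left_comm]
    refine mul_lt_mul_of_pos_left ?_ (by positivity)
    rw [lt_div_iff₀ (by positivity)]
    calc 2 * Λ ^ n * Λ ^ q ≤ Λ * Λ ^ n * Λ ^ q := by gcongr
      _ = Λ ^ (n + q + 1) := by ring
      _ < Λ ^ (a * n) := pow_lt_pow_right₀ L1' (by rw [ha]; nlinarith)
  · have : 2 * (n:ℝ) ≤ Λ ^ p := by linarith [(Nat.cast_nonneg n : (0:ℝ) ≤ n)]
    have h2 : 2 * (n:ℝ) * (Λ ^ b' * y) ≤ Λ ^ p * Λ ^ 1 * (Λ ^ b' * y) := by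
      refine mul_le_mul_of_nonneg_right ?_ (by positivity)
      refine this.trans (le_mul_of_one_le_right (by positivity) (one_le_pow₀ L1))
    have h3 : Λ ^ p * Λ ^ 1 * (Λ ^ b' * y) = Λ ^ (p + b' + 1) * y := by ring
    linarith
  · have e : (Λ ^ b' * y / Λ ^ 2) ^ n * (1 / Λ ^ q) = Λ ^ (b' * n) / Λ ^ (2 * n + q) * y ^ n := by
      rw [div_pow, mul_pow, ← pow_mul, ← pow_mul, pow_add]; field_simp
    refine lt_of_lt_of_le ?_ (show (Λ ^ b' * y / Λ ^ 2) ^ n * (1 / Λ ^ q) ≤ _ by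
      gcongr
      nlinarith)
    rw [e]
    calc 4 * (Λ ^ k1 * (Λ ^ b * y ^ n)) * Λ ^ n ≤ Λ ^ 2 * (Λ ^ k1 * (Λ ^ b * y ^ n)) * Λ ^ n := by gcongr
      _ = Λ ^ (2 + k1 + b + n) * y ^ n := by ring
      _ < _ := by
        gcongr
        rw [lt_div_iff₀ (by positivity), ← pow_add]
        refine pow_lt_pow_right₀ L1' ?_
        calc 2 + k1 + b + n + (2 * n + q) < b' := by omega
          _ ≤ b' * n := Nat.le_mul_of_pos_right _ hn
  · calc 6 * (Λ ^ k1 * (Λ ^ b * y ^ n)) ≤ Λ ^ 3 * (Λ ^ k1 * (Λ ^ b * y ^ n)) := by gcongr; linarith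
      _ = Λ ^ (3 + k1 + b) * y ^ n := by ring
      _ ≤ _ := mul_le_mul_of_nonneg_right (pow_le_pow_right₀ L1 (by omega)) (by positivity)
  · have h1 : 8 * (n:ℝ) * (Λ ^ b' * y) ≤ Λ ^ (p + b') * y := by
      calc 8 * (n:ℝ) * (Λ ^ b' * y) ≤ Λ ^ p * (Λ ^ b' * y) := by
            gcongr; linarith [(Nat.cast_nonneg n : (0:ℝ) ≤ n)]
        _ = _ := by ring
    have h2 : 3 * (Λ ^ k1 * (Λ ^ b * y ^ n)) ≤ Λ ^ (p + b') * y := by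
      calc 3 * (Λ ^ k1 * (Λ ^ b * y ^ n)) ≤ Λ ^ 2 * (Λ ^ k1 * (Λ ^ b * y)) := by gcongr; linarith
        _ = Λ ^ (2 + k1 + b) * y := by ring
        _ ≤ _ := mul_le_mul_of_nonneg_right (pow_le_pow_right₀ L1 (by omega)) (by positivity)
    have h3 : Λ ^ (p + b' + 1) * y = (Λ ^ (p + b') * y) * Λ := by ring
    have h4 : (Λ ^ (p + b') * y) * 2 ≤ (Λ ^ (p + b') * y) * Λ := by gcongr
    linarith

lemma core (m : ℕ) : ∃ k : ℕ, ∀ (Λ t y z : ℝ) (A B K1 K2 : Set (E m)), 2 ≤ Λ → IsCompact A → IsCompact B →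
    IsCompact K1 → IsCompact K2 → Convex ℝ K1 → Convex ℝ K2 →
    K1 ⊆ Metric.closedBall 0 Λ → K2 ⊆ Metric.closedBall 0 Λ → 1 / Λ ≤ t → t ≤ 1 - 1 / Λ →
    0 < y → Λ ^ k * y ≤ 1 → z = y ^ (2 * (m + 1) ^ 2) →
    |volume.real A - 1| ≤ z → |volume.real B - 1| ≤ z → volume.real (t • A + (1 - t) • B) ≤ 1 + z →
    volume.real (A \ K1) ≤ z → volume.real (K1 \ A) ≤ z → volume.real (B \ K2) ≤ z → volume.real (K2 \ B) ≤ z →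
    volume.real (A \ ((fun x => x + (bar K1 - bar K2)) '' B)) +
      volume.real (((fun x => x + (bar K1 - bar K2)) '' B) \ A) ≤ Λ ^ k * y ^ (m + 1) ∧
    ∃ K : Set (E m), IsCompact K ∧ Convex ℝ K ∧ A ⊆ K ∧ (fun x => x + (bar K1 - bar K2)) '' B ⊆ K ∧
      volume.real (K \ A) + volume.real (K \ ((fun x => x + (bar K1 - bar K2)) '' B)) ≤ Λ ^ k * y := by
  obtain ⟨kv, -, hkv⟩ := vol_consts m
  obtain ⟨k1, hcs⟩ := cs m
  obtain ⟨p, hp⟩ := exists_pow_le (c := 20 * ((m + 1 : ℕ) : ℝ))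
  refine ⟨p + (3 * (m + 1) + (4 + 2 * m) * kv + 3 + k1 + (p + ((m + 1) + (4 + 2 * m) * kv + 2) + 1)) + 1, ?_⟩
  intro Λ t y z A B K1 K2 hΛ hA hB h1 h2 cc1 cc2 b1 b2 t0 t1 hy hk hz vA vB vS z1 z2 z3 z4
  obtain ⟨y1, zl, le, e1, H, hd1, hd, F1, F2⟩ := nums (n := m + 1) (p := p) (q := (4 + 2 * m) * kv) (k1 := k1) (by omega) hΛ hy (hp Λ hΛ) rfl rfl rfl hk
  rw [← hz] at zl H
  generalize p + (3 * (m + 1) + (4 + 2 * m) * kv + 3 + k1 + (p + ((m + 1) + (4 + 2 * m) * kv + 2) + 1)) + 1 = k at *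
  have L0 : 0 < Λ := by linarith
  have d0 : 0 < Λ ^ (3 * (m + 1) + (4 + 2 * m) * kv + 3 + k1 + (p + (m + 1 + (4 + 2 * m) * kv + 2) + 1)) * y := by positivity
  generalize Λ ^ (3 * (m + 1) + (4 + 2 * m) * kv + 3 + k1 + (p + (m + 1 + (4 + 2 * m) * kv + 2) + 1)) * y = d at *
  have l0 : 0 < Λ ^ (m + 1 + (4 + 2 * m) * kv + 2) * y ^ (2 * (m + 1)) := by positivity
  have e0 : 0 < Λ ^ (p + (m + 1 + (4 + 2 * m) * kv + 2) + 1) * y ^ (m + 1) := by positivity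
  generalize Λ ^ (m + 1 + (4 + 2 * m) * kv + 2) * y ^ (2 * (m + 1)) = lam at *
  generalize Λ ^ (p + (m + 1 + (4 + 2 * m) * kv + 2) + 1) * y ^ (m + 1) = ε at *
  have Lbig : 2 ≤ Λ ^ (4 + 2 * m) := hΛ.trans (le_self_pow₀ (by linarith) (by omega))
  have vb : 1 / Λ ^ ((4 + 2 * m) * kv) ≤ volume.real (Metric.closedBall (0:E m) (1 / Λ ^ (4 + 2 * m))) := by
    rw [pow_mul]
    exact (hkv _ Lbig).1 0 _ le_rfl
  have ρ0 : 0 < 1 / Λ ^ (4 + 2 * m) := by positivity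
  have z0 : 0 ≤ z := by rw [hz]; positivity
  have n1 : (1:ℝ) ≤ ((m + 1 : ℕ) : ℝ) := by push_cast; linarith [(Nat.cast_nonneg m : (0:ℝ) ≤ m)]
  have iL : 0 < 1 / Λ := by positivity
  have iL2 : 1 / Λ ≤ 1 / 2 := one_div_le_one_div_of_le (by norm_num) hΛ
  have tp : 0 < t := by linarith
  have tp1 : t < 1 := by linarith
  have ee : ε ^ 2 ≤ ε := pow_le_of_le_one e0.le e1 (by norm_num)
  have nl0 : 0 < ((m + 1 : ℕ) : ℝ) * lam * Λ := by positivity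
  have l1 : 16 * ((m + 1 : ℕ) : ℝ) * lam * Λ ≤ 1 := by linarith
  have l2 : ((m + 1 : ℕ) : ℝ) * lam ≤ ((m + 1 : ℕ) : ℝ) * lam * Λ := le_mul_of_one_le_right (by positivity) (by linarith)
  have l3 : lam ≤ ((m + 1 : ℕ) : ℝ) * lam := le_mul_of_one_le_left l0.le n1
  have l16 : lam ≤ 1 / 16 := by linarith
  have fA : volume A ≠ ⊤ := hA.measure_lt_top.ne
  have fB : volume B ≠ ⊤ := hB.measure_lt_top.ne
  have f1 : volume K1 ≠ ⊤ := h1.measure_lt_top.ne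
  have f2 : volume K2 ≠ ⊤ := h2.measure_lt_top.ne
  rw [abs_le] at vA vB
  have v1 : 1 - 2 * z ≤ volume.real K1 := by have := vol_sd_ge fA f1; linarith
  have v1' : volume.real K1 ≤ 1 + 2 * z := by have := vol_sd_ge f1 fA; linarith
  have v2 : 1 - 2 * z ≤ volume.real K2 := by have := vol_sd_ge fB f2; linarith
  have v2' : volume.real K2 ≤ 1 + 2 * z := by have := vol_sd_ge f2 fB; linarith
  have i1 := inr_ball hΛ h1 cc1 b1 (by linarith)
  have i2 := inr_ball hΛ h2 cc2 b2 (by linarith)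
  have C : ∀ a ∈ K1, ∀ b ∈ K2, (1 - lam) • (t • a + (1 - t) • b) + lam • (t • bar K1 + (1 - t) • bar K2) ∈ t • A + (1 - t) • B := by
    intro a ha b hb
    refine cvx f1 f2 cc1 cc2 i1 i2 z2 z4 tp tp1 l0 (by linarith) ?_ ha hb
    have g : ∀ s : ℝ, 1 / Λ ≤ s → z / (lam * s) ^ (m + 1) ≤ z * Λ ^ (m + 1) / lam ^ (m + 1) := by
      intro s hs
      have sp : 0 < s := by linarith
      rw [div_le_div_iff₀ (by positivity) (by positivity), mul_pow, mul_assoc]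
      refine mul_le_mul_of_nonneg_left ?_ z0
      have : 1 ≤ (Λ * s) ^ (m + 1) := by
        apply one_le_pow₀
        rw [div_le_iff₀ L0] at hs; linarith
      calc lam ^ (m + 1) = lam ^ (m + 1) * 1 := (mul_one _).symm
        _ ≤ lam ^ (m + 1) * (Λ * s) ^ (m + 1) := by gcongr
        _ = _ := by rw [mul_pow]; ring
    have g1 := g (1 - t) (by linarith)
    have g2 := g t t0
    have H' : 2 * (z * Λ ^ (m + 1) / lam ^ (m + 1)) < 1 / Λ ^ ((4 + 2 * m) * kv) := by
      rw [← mul_div_assoc, div_lt_iff₀ (by positivity)]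
      linarith
    linarith
  obtain ⟨a1, a2⟩ := core_a (lam := lam) (ε := ε) hA hB h1 h2 cc1 cc2 hΛ t0 t1 z0 zl l0 l1 le e0 C v1 v1' v2 v2' vS
  obtain ⟨-, -, hη⟩ := hcs Λ ε K1 K2 hΛ e0 h1 h2 cc1 cc2 b1 b2 (by linarith) (by linarith) a1 a2
  have eη : ε ≤ Λ ^ k1 * ε := le_mul_of_one_le_left e0.le (one_le_pow₀ (by linarith))
  have R := core_b (v := bar K1 - bar K2) (d := d) hA hB h1 h2 cc1 hΛ t0 t1 ρ0 i1 (by abel) z0 zl l0 l1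
    (by linarith) C v1 v1' vS hη z1 z2 z3 z4 d0 hd1 (hd.trans_le (by gcongr))
  obtain ⟨R1, K, cK, xK, AK, BK, R2⟩ := R
  exact ⟨R1.trans F1, K, cK, xK, AK, BK, R2.trans F2⟩

end core
end St8

open MeasureTheory Set Pointwise
set_option linter.unusedSectionVars false
namespace St8

section fin
variable {m : ℕ}

lemma closed_up {A K : Set (E m)} {Λ ζ : ℝ} (bA : A ⊆ Metric.closedBall 0 Λ) (cK : Convex ℝ K)
    (h : volume (symmDiff A K) ≤ ENNReal.ofReal ζ) (z0 : 0 ≤ ζ) :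
    ∃ K1 : Set (E m), IsCompact K1 ∧ Convex ℝ K1 ∧ K1 ⊆ Metric.closedBall 0 Λ ∧
      volume.real (A \ K1) ≤ ζ ∧ volume.real (K1 \ A) ≤ ζ := by
  have cc : Convex ℝ (K ∩ Metric.closedBall 0 Λ) := cK.inter (convex_closedBall _ _)
  have sub : closure (K ∩ Metric.closedBall 0 Λ) ⊆ Metric.closedBall 0 Λ :=
    closure_minimal inter_subset_right Metric.isClosed_closedBall
  refine ⟨closure (K ∩ Metric.closedBall 0 Λ), ?_, cc.closure, sub, ?_, ?_⟩
  · exact (isCompact_closedBall _ _).of_isClosed_subset isClosed_closure sub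
  · refine ENNReal.toReal_le_of_le_ofReal z0 (le_trans (measure_mono ?_) h)
    rintro x ⟨hx, hx2⟩
    exact Or.inl ⟨hx, fun hk => hx2 (subset_closure ⟨hk, bA hx⟩)⟩
  · refine ENNReal.toReal_le_of_le_ofReal z0 ?_
    have : closure (K ∩ Metric.closedBall 0 Λ) \ A ⊆ symmDiff A K ∪ frontier (K ∩ Metric.closedBall 0 Λ) := by
      rintro x ⟨hx, hxA⟩
      rw [closure_eq_self_union_frontier] at hx
      rcases hx with hx | hx
      · exact Or.inl (Or.inr ⟨hx.1, hxA⟩)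
      · exact Or.inr hx
    refine (measure_mono this).trans ((measure_union_le _ _).trans ?_)
    rw [cc.addHaar_frontier volume, add_zero]
    exact h

lemma limit_case {X : ENNReal} {C y0 yM : ℝ} (h : y0 < yM) (j : ℕ)
    (H : ∀ y, y0 < y → y ≤ yM → X ≤ ENNReal.ofReal (C * y ^ j)) : X ≤ ENNReal.ofReal (C * y0 ^ j) := by
  have T : Filter.Tendsto (fun y : ℝ => ENNReal.ofReal (C * y ^ j)) (nhdsWithin y0 (Ioi y0)) (nhds (ENNReal.ofReal (C * y0 ^ j))) := by
    refine ((ENNReal.continuous_ofReal.comp ?_).tendsto y0).mono_left nhdsWithin_le_nhds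
    fun_prop
  refine ge_of_tendsto T ?_
  filter_upwards [Ioc_mem_nhdsGT h] with y hy
  exact H y hy.1 hy.2

lemma real_sum {X Y : Set (E m)} {c : ℝ} (fX : volume X ≠ ⊤) (fY : volume Y ≠ ⊤) (h : volume.real X + volume.real Y ≤ c) :
    volume X + volume Y ≤ ENNReal.ofReal c := by
  rw [← ofReal_measureReal fX, ← ofReal_measureReal fY, ← ENNReal.ofReal_add measureReal_nonneg measureReal_nonneg]
  exact ENNReal.ofReal_le_ofReal h

lemma sym_le_add (X Y : Set (E m)) : volume (symmDiff X Y) ≤ volume (X \ Y) + volume (Y \ X) :=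
  measure_union_le _ _

lemma final_m (m : ℕ) : ∃ q : ℕ, 1 ≤ q ∧ ∀ (A B K_A K_B : Set (E m)) (Λ t δ ζ y0 w0 : ℝ), 2 ≤ Λ → 
    IsCompact A → IsCompact B → 1 / Λ ≤ t → t ≤ 1 - 1 / Λ →
    |volume.real A - 1| + |volume.real B - 1| + |volume.real (t • A + (1 - t) • B) - 1| ≤ δ →
    A ⊆ Metric.closedBall 0 Λ → B ⊆ Metric.closedBall 0 Λ → Convex ℝ K_A → Convex ℝ K_B →
    volume (symmDiff A K_A) + volume (symmDiff B K_B) ≤ ENNReal.ofReal ζ → δ ≤ ζ →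
    0 ≤ y0 → y0 ^ (2 * (m + 1) ^ 2) = ζ → 0 ≤ w0 → w0 ^ (m + 1) = y0 →
    ∃ v : E m, volume (symmDiff A ((fun x => x + v) '' B)) ≤ ENNReal.ofReal (Λ ^ q * y0 ^ (m + 1)) ∧
      ∃ K : Set (E m), Convex ℝ K ∧ A ⊆ K ∧ (fun x => x + v) '' B ⊆ K ∧
        volume (K \ A) + volume (K \ ((fun x => x + v) '' B)) ≤ ENNReal.ofReal (Λ ^ q * w0) := by
  obtain ⟨kv, -, hkv⟩ := vol_consts m
  obtain ⟨k, hcore⟩ := core m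
  refine ⟨kv + 1 + k * (m + 1), by omega, ?_⟩
  intro A B K_A K_B Λ t δ ζ y0 w0 hΛ hA hB t0 t1 hδ bA bB cA cB hζ δζ hy0 hyζ hw0 hwy
  have L0 : 0 < Λ := by linarith
  have L1 : 1 ≤ Λ := by linarith
  have a1 := abs_nonneg (volume.real A - 1)
  have a2 := abs_nonneg (volume.real B - 1)
  have a3 := abs_nonneg (volume.real (t • A + (1 - t) • B) - 1)
  have ζ0 : 0 ≤ ζ := by linarith
  have vb : volume.real (Metric.closedBall (0:E m) Λ) ≤ Λ ^ kv := (hkv Λ hΛ).2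
  have fb : volume (Metric.closedBall (0:E m) Λ) ≠ ⊤ := (isCompact_closedBall _ _).measure_lt_top.ne
  by_cases hc : Λ ^ k * y0 < 1
  · obtain ⟨K1, h1, cc1, b1, z1, z2⟩ := closed_up bA cA (le_self_add.trans hζ) ζ0
    obtain ⟨K2, h2, cc2, b2, z3, z4⟩ := closed_up bB cB (le_add_self.trans hζ) ζ0
    have yM : y0 < 1 / Λ ^ k := by rw [lt_div_iff₀ (by positivity)]; linarith
    have y01 : y0 ≤ 1 := by
      have : y0 ≤ Λ ^ k * y0 := le_mul_of_one_le_left hy0 (one_le_pow₀ L1)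
      linarith
    have w01 : w0 ≤ 1 := by
      by_contra hcon
      push Not at hcon
      have := one_lt_pow₀ hcon (Nat.succ_ne_zero m)
      rw [hwy] at this
      linarith
    have yw : y0 ≤ w0 := by rw [← hwy]; exact pow_le_of_le_one hw0 w01 (by omega)
    have main : ∀ y, y0 < y → y ≤ 1 / Λ ^ k → _ := fun y h3 h4 =>
      hcore Λ t y (y ^ (2 * (m + 1) ^ 2)) A B K1 K2 hΛ hA hB h1 h2 cc1 cc2 b1 b2 t0 t1 (by linarith)
        (by rw [le_div_iff₀ (by positivity)] at h4; linarith) rfl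
    have zy : ∀ y, y0 < y → ζ ≤ y ^ (2 * (m + 1) ^ 2) := by
      intro y hy
      rw [← hyζ]; gcongr
    have main2 := fun y h3 h4 => main y h3 h4 (by linarith [zy y h3]) (by linarith [zy y h3])
      (by have := le_abs_self (volume.real (t • A + (1 - t) • B) - 1); linarith [zy y h3])
      (z1.trans (zy y h3)) (z2.trans (zy y h3)) (z3.trans (zy y h3)) (z4.trans (zy y h3))
    have kq : Λ ^ k ≤ Λ ^ (kv + 1 + k * (m + 1)) := pow_le_pow_right₀ L1 (by nlinarith)
    have fA : volume A ≠ ⊤ := hA.measure_lt_top.ne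
    have fB := tr_fin hB.measure_lt_top.ne (bar K1 - bar K2)
    refine ⟨bar K1 - bar K2, ?_, convexHull ℝ (A ∪ (fun x => x + (bar K1 - bar K2)) '' B), convex_convexHull _ _, ?_, ?_, ?_⟩
    · refine (limit_case (C := Λ ^ k) yM (m + 1) (fun y h3 h4 => ?_)).trans (ENNReal.ofReal_le_ofReal (by gcongr))
      exact (sym_le_add _ _).trans (real_sum (fin_sub sdiff_subset fA) (fin_sub sdiff_subset fB) (main2 y h3 h4).1)
    · exact subset_union_left.trans (subset_convexHull _ _)
    · exact subset_union_right.trans (subset_convexHull _ _)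
    · have := limit_case (X := volume (convexHull ℝ (A ∪ (fun x => x + (bar K1 - bar K2)) '' B) \ A) +
          volume (convexHull ℝ (A ∪ (fun x => x + (bar K1 - bar K2)) '' B) \ ((fun x => x + (bar K1 - bar K2)) '' B))) (C := Λ ^ k) yM 1 ?_
      · refine this.trans (ENNReal.ofReal_le_ofReal ?_)
        rw [pow_one]
        gcongr
      · intro y h3 h4
        obtain ⟨-, K, cK, xK, AK, BK, hK⟩ := main2 y h3 h4
        rw [pow_one]
        have hs := convexHull_min (union_subset AK BK) xK
        refine le_trans (add_le_add (measure_mono (sdiff_subset_sdiff_left hs)) (measure_mono (sdiff_subset_sdiff_left hs))) ?_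
        have fK : volume K ≠ ⊤ := cK.measure_lt_top.ne
        exact real_sum (fin_sub sdiff_subset fK) (fin_sub sdiff_subset fK) hK
  · push Not at hc
    have e0 : (fun x : E m => x + 0) '' B = B := by simp
    have B2 : 2 * volume.real (Metric.closedBall (0:E m) Λ) ≤ Λ ^ (kv + 1) := by
      calc 2 * volume.real (Metric.closedBall (0:E m) Λ) ≤ Λ * Λ ^ kv := by gcongr
        _ = _ := by ring
    have F : ∀ X Y : Set (E m), X ⊆ Metric.closedBall 0 Λ → Y ⊆ Metric.closedBall 0 Λ →
        volume X + volume Y ≤ ENNReal.ofReal (Λ ^ (kv + 1)) := by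
      intro X Y hX hY
      refine real_sum (fin_sub hX fb) (fin_sub hY fb) ?_
      have r1 := measureReal_mono (μ := volume) hX fb
      have r2 := measureReal_mono (μ := volume) hY fb
      linarith
    have wl : 1 ≤ Λ ^ (k * (m + 1)) * w0 := by
      have h3 : 1 ≤ Λ ^ k * w0 := by
        by_contra hcon
        push Not at hcon
        have h4 : (Λ ^ k * w0) ^ (m + 1) < 1 := pow_lt_one₀ (by positivity) hcon (by omega)
        rw [mul_pow, hwy] at h4
        have : Λ ^ k * y0 ≤ (Λ ^ k) ^ (m + 1) * y0 := by
          gcongr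
          exact le_self_pow₀ (one_le_pow₀ L1) (by omega)
        linarith
      refine h3.trans ?_
      gcongr
      nlinarith
    have yl : 1 ≤ Λ ^ (k * (m + 1)) * y0 ^ (m + 1) := by
      have := one_le_pow₀ hc (n := m + 1)
      rwa [mul_pow, ← pow_mul] at this
    refine ⟨0, ?_, Metric.closedBall 0 Λ, convex_closedBall _ _, bA, ?_, ?_⟩
    · rw [e0]
      refine ((sym_le_add _ _).trans (F _ _ (sdiff_subset.trans bA) (sdiff_subset.trans bB))).trans (ENNReal.ofReal_le_ofReal ?_)
      rw [pow_add _ (kv + 1), mul_assoc]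
      exact le_mul_of_one_le_right (by positivity) yl
    · rw [e0]; exact bB
    · rw [e0]
      refine (F _ _ sdiff_subset sdiff_subset).trans (ENNReal.ofReal_le_ofReal ?_)
      rw [pow_add _ (kv + 1), mul_assoc]
      exact le_mul_of_one_le_right (by positivity) wl

end fin
end St8

theorem statement8 (n : ℕ) (hn : 2 ≤ n) :
    ∃ N L : ℝ, 1 < N ∧ 1 < L ∧
      ∀ (A B K_A K_B : Set (EuclideanSpace ℝ (Fin n))) (τ t δ ζ R : ℝ),
        IsCompact A → IsCompact B →
        0 < τ → τ ≤ 1 / 2 → t ∈ Set.Icc τ (1 - τ) →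
        |(volume A).toReal - 1| + |(volume B).toReal - 1| +
          |(volume (t • A + (1 - t) • B)).toReal - 1| ≤ δ →
        A ⊆ Metric.closedBall 0 R → B ⊆ Metric.closedBall 0 R → R ≤ τ ^ (-N) →
        Convex ℝ K_A → Convex ℝ K_B →
        volume (symmDiff A K_A) + volume (symmDiff B K_B) ≤ ENNReal.ofReal ζ →
        δ ≤ ζ →
        ∃ v : EuclideanSpace ℝ (Fin n),
          volume (symmDiff A ((· + v) '' B)) ≤
            ENNReal.ofReal (τ ^ (-L) * ζ ^ (1 / (2 * (n : ℝ)))) ∧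
          ∃ K : Set (EuclideanSpace ℝ (Fin n)), Convex ℝ K ∧ A ⊆ K ∧ (· + v) '' B ⊆ K ∧
            volume (K \ A) + volume (K \ ((· + v) '' B)) ≤
              ENNReal.ofReal (τ ^ (-L) * ζ ^ (1 / (2 * (n : ℝ) ^ 3))) := by
  obtain ⟨m, rfl⟩ : ∃ m, n = m + 1 := ⟨n - 1, by omega⟩
  obtain ⟨q, hq, H⟩ := St8.final_m m
  have hq' : (1:ℝ) ≤ q := by exact_mod_cast hq
  refine ⟨2, 2 * q, by norm_num, by linarith, ?_⟩
  intro A B K_A K_B τ t δ ζ R hA hB τ0 τ1 ht hδ bA bB hR cA cB hζ δζ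
  have a1 := abs_nonneg ((volume A).toReal - 1)
  have a2 := abs_nonneg ((volume B).toReal - 1)
  have a3 := abs_nonneg ((volume (t • A + (1 - t) • B)).toReal - 1)
  have ζ0 : 0 ≤ ζ := by linarith
  have n0 : (0:ℝ) < ((m + 1 : ℕ) : ℝ) := by positivity
  have e2 : τ ^ (-(2:ℝ)) = 1 / τ ^ 2 := by
    rw [Real.rpow_neg τ0.le, Real.rpow_two, one_div]
  have eL : τ ^ (-(2 * (q:ℝ))) = (1 / τ ^ 2) ^ q := by
    rw [← e2, ← Real.rpow_natCast, ← Real.rpow_mul τ0.le]; congr 1; ring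
  rw [e2] at hR
  have tt : τ ^ 2 ≤ τ := by nlinarith
  have t4 : τ ^ 2 ≤ 1 / 2 := by linarith
  have i2 : 1 / (1 / τ ^ 2) = τ ^ 2 := by rw [one_div_one_div]
  have R1 : Metric.closedBall (0 : EuclideanSpace ℝ (Fin (m + 1))) R ⊆ Metric.closedBall 0 (1 / τ ^ 2) :=
    Metric.closedBall_subset_closedBall hR
  have p1 : (ζ ^ (1 / (2 * ((m + 1 : ℕ) : ℝ) ^ 2))) ^ (m + 1) = ζ ^ (1 / (2 * ((m + 1 : ℕ) : ℝ))) := by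
    rw [← Real.rpow_natCast, ← Real.rpow_mul ζ0]; congr 1; field_simp
  have p2 : (ζ ^ (1 / (2 * ((m + 1 : ℕ) : ℝ) ^ 3))) ^ (m + 1) = ζ ^ (1 / (2 * ((m + 1 : ℕ) : ℝ) ^ 2)) := by
    rw [← Real.rpow_natCast, ← Real.rpow_mul ζ0]; congr 1; field_simp
  have p3 : (ζ ^ (1 / (2 * ((m + 1 : ℕ) : ℝ) ^ 2))) ^ (2 * (m + 1) ^ 2) = ζ := by
    rw [← Real.rpow_natCast, ← Real.rpow_mul ζ0]
    have : 1 / (2 * ((m + 1 : ℕ) : ℝ) ^ 2) * ((2 * (m + 1) ^ 2 : ℕ) : ℝ) = 1 := by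
      push_cast at n0 ⊢; field_simp
    rw [this, Real.rpow_one]
  have := H A B K_A K_B (1 / τ ^ 2) t δ ζ (ζ ^ (1 / (2 * ((m + 1 : ℕ) : ℝ) ^ 2))) (ζ ^ (1 / (2 * ((m + 1 : ℕ) : ℝ) ^ 3)))
    (by rw [le_div_iff₀ (by positivity)]; linarith) hA hB (by rw [i2]; linarith [ht.1]) (by rw [i2]; linarith [ht.2])
    hδ (bA.trans R1) (bB.trans R1) cA cB hζ δζ (Real.rpow_nonneg ζ0 _) p3 (Real.rpow_nonneg ζ0 _) p2
  rw [eL, ← p1]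
  exact this
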